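/- For i = 0, 1, 2, let h^{(i)}_{I,J} denote the number of GL_2(ℤ)-equivalence classes of irreducible integral binary quartic forms f with invariants I(f) = I and J(f) = J and with exactly 4 − 2i distinct real roots in P^1(ℂ). Call a pair (I,J) ∈ ℤ^2 eligible if there exists an integral binary quartic form with invariants I and J. Let n_0 = 4, n_1 = 2, n_2 = 2, and set Δ(I,J) = (4I^3 − J^2)/27. Then for each i ∈ {0,1,2}: lim_{X→∞} [ Σ_{(I,J)∈ℤ^2, max(|I|,|J|) < X} h^{(i)}_{I,J} ] / #{ (I,J) ∈ ℤ^2 eligible : (−1)^i Δ(I,J) > 0 and max(|I|,|J|) < X } = 2ζ(2)/n_i. -/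

import Mathlib

open Filter

/-- An integral binary quartic form `a x⁴ + b x³y + c x²y² + d xy³ + e y⁴`. -/
structure BQF where
  a : ℤ
  b : ℤ
  c : ℤ
  d : ℤ
  e : ℤ

namespace BQF

/-- The invariant `I` of a binary quartic form. -/
def I (f : BQF) : ℤ := 12 * f.a * f.e - 3 * f.b * f.d + f.c ^ 2

/-- The invariant `J` of a binary quartic form. -/
def J (f : BQF) : ℤ :=
  72 * f.a * f.c * f.e + 9 * f.b * f.c * f.d - 27 * f.a * f.d ^ 2 -
    27 * f.e * f.b ^ 2 - 2 * f.c ^ 3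

/-- Evaluation of the form at a pair of integers. -/
def evalZ (f : BQF) (x y : ℤ) : ℤ :=
  f.a * x ^ 4 + f.b * x ^ 3 * y + f.c * x ^ 2 * y ^ 2 + f.d * x * y ^ 3 + f.e * y ^ 4

/-- Evaluation of the form at a pair of reals. -/
noncomputable def evalR (f : BQF) (x y : ℝ) : ℝ :=
  (f.a : ℝ) * x ^ 4 + (f.b : ℝ) * x ^ 3 * y + (f.c : ℝ) * x ^ 2 * y ^ 2 +
    (f.d : ℝ) * x * y ^ 3 + (f.e : ℝ) * y ^ 4

/-- `GL₂(ℤ)`-equivalence: `g = γ · f` where `(γ · f)(x,y) = f((x,y)γ)` for some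
integer matrix `γ` with unit (i.e. `±1`) determinant. -/
def Equivalent (f g : BQF) : Prop :=
  ∃ γ : Matrix (Fin 2) (Fin 2) ℤ, IsUnit γ.det ∧
    ∀ x y : ℤ, g.evalZ x y = f.evalZ (x * γ 0 0 + y * γ 1 0) (x * γ 0 1 + y * γ 1 1)

/-- Irreducibility of the form over `ℚ`: it has no factor of positive degree with
rational coefficients.  Equivalently, `a ≠ 0` (no root at infinity, i.e. no factor `y`)
and the dehomogenized quartic polynomial is irreducible over `ℚ`. -/
def Irred (f : BQF) : Prop :=
  f.a ≠ 0 ∧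
    Irreducible (Polynomial.C (f.a : ℚ) * Polynomial.X ^ 4 +
      Polynomial.C (f.b : ℚ) * Polynomial.X ^ 3 +
      Polynomial.C (f.c : ℚ) * Polynomial.X ^ 2 +
      Polynomial.C (f.d : ℚ) * Polynomial.X + Polynomial.C (f.e : ℚ))

/-- The set of real roots of `f`; for a form with `a ≠ 0` all roots of `f` in `ℙ¹(ℝ)`
have the shape `(z : 1)` with `z` real. -/
def realRoots (f : BQF) : Set ℝ := {z : ℝ | f.evalR z 1 = 0}

end BQF

/-- The number of `GL₂(ℤ)`-equivalence classes of integral binary quartic forms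
satisfying the predicate `P`. -/
noncomputable def classCount (P : BQF → Prop) : ℕ :=
  Nat.card (Quot fun f g : {h : BQF // P h} => BQF.Equivalent f.1 g.1)

/-- `h^{(i)}_{I,J}`: the number of `GL₂(ℤ)`-classes of irreducible integral binary
quartic forms with invariants `I`, `J` and exactly `4 - 2i` distinct real roots. -/
noncomputable def hIJ (i : ℕ) (I₀ J₀ : ℤ) : ℕ :=
  classCount fun f => f.Irred ∧ f.realRoots.ncard = 4 - 2 * i ∧ f.I = I₀ ∧ f.J = J₀

/-- `(I,J)` is eligible if some integral binary quartic form has invariants `I` and `J`. -/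
def Eligible (I₀ J₀ : ℤ) : Prop := ∃ f : BQF, f.I = I₀ ∧ f.J = J₀

section
open Set
namespace BQF

theorem ext_eval {f g : BQF} (h : ∀ x y : ℤ, f.evalZ x y = g.evalZ x y) : f = g := by
  have h1 := h 1 0; have h2 := h 0 1; have h3 := h 1 1; have h4 := h 1 (-1); have h5 := h 2 1
  cases f; cases g
  simp only [evalZ] at *
  norm_num at *
  refine ⟨?_, ?_, ?_, ?_, ?_⟩ <;> linarith

/-- `f ∘ (m x + k y, l x + o y)` -/
def sub (f : BQF) (m k l o : ℤ) : BQF where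
  a := f.a*m^4 + f.b*m^3*l + f.c*m^2*l^2 + f.d*m*l^3 + f.e*l^4
  b := 4*f.a*m^3*k + f.b*(3*m^2*k*l+m^3*o) + f.c*(2*m*k*l^2+2*m^2*l*o) + f.d*(k*l^3+3*m*l^2*o)
    + 4*f.e*l^3*o
  c := 6*f.a*m^2*k^2 + f.b*(3*m*k^2*l+3*m^2*k*o) + f.c*(k^2*l^2+4*m*k*l*o+m^2*o^2)
    + f.d*(3*k*l^2*o+3*m*l*o^2) + 6*f.e*l^2*o^2
  d := 4*f.a*m*k^3 + f.b*(k^3*l+3*m*k^2*o) + f.c*(2*k^2*l*o+2*m*k*o^2) + f.d*(3*k*l*o^2+m*o^3)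
    + 4*f.e*l*o^3
  e := f.a*k^4 + f.b*k^3*o + f.c*k^2*o^2 + f.d*k*o^3 + f.e*o^4

theorem evalZ_sub (f : BQF) (m k l o x y : ℤ) :
    (f.sub m k l o).evalZ x y = f.evalZ (m*x+k*y) (l*x+o*y) := by
  simp only [evalZ, sub]; ring

theorem evalR_sub (f : BQF) (m k l o : ℤ) (x y : ℝ) :
    (f.sub m k l o).evalR x y = f.evalR (m*x+k*y) (l*x+o*y) := by
  simp only [evalR, sub]; push_cast; ring

theorem equiv_iff {f g : BQF} : Equivalent f g ↔
    ∃ m k l o : ℤ, (m*o-k*l = 1 ∨ m*o-k*l = -1) ∧ g = f.sub m k l o := by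
  constructor
  · rintro ⟨γ, hd, h⟩
    refine ⟨γ 0 0, γ 1 0, γ 0 1, γ 1 1, ?_, ext_eval fun x y => ?_⟩
    · rw [Matrix.det_fin_two] at hd
      rcases Int.isUnit_iff.1 hd with h | h
      · left; linarith
      · right; linarith
    · rw [h, evalZ_sub]; congr 1 <;> ring
  · rintro ⟨m, k, l, o, hd, rfl⟩
    refine ⟨!![m, l; k, o], ?_, fun x y => ?_⟩
    · rw [Matrix.det_fin_two, Int.isUnit_iff]
      simp only [Matrix.of_apply, Matrix.cons_val', Matrix.cons_val_zero, Matrix.cons_val_one,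
        Matrix.cons_val_fin_one]
      rcases hd with h | h
      · left; linarith
      · right; linarith
    · rw [evalZ_sub]; simp; congr 1 <;> ring

theorem Equivalent.refl (f : BQF) : Equivalent f f :=
  equiv_iff.2 ⟨1, 0, 0, 1, by simp, ext_eval fun x y => by rw [evalZ_sub]; congr 1 <;> ring⟩

theorem Equivalent.symm {f g : BQF} (h : Equivalent f g) : Equivalent g f := by
  obtain ⟨m, k, l, o, hd, rfl⟩ := equiv_iff.1 h
  have hd2 : (m*o-k*l)*(m*o-k*l) = 1 := by rcases hd with h | h <;> rw [h] <;> norm_num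
  refine equiv_iff.2 ⟨(m*o-k*l)*o, -(m*o-k*l)*k, -(m*o-k*l)*l, (m*o-k*l)*m, ?_,
    ext_eval fun x y => ?_⟩
  · have : (m*o-k*l)*o*((m*o-k*l)*m) - -(m*o-k*l)*k*(-(m*o-k*l)*l)
      = ((m*o-k*l)*(m*o-k*l))*(m*o-k*l) := by ring
    rw [this, hd2, one_mul]; exact hd
  · rw [evalZ_sub, evalZ_sub]
    congr 1
    · linear_combination (-x)*hd2
    · linear_combination (-y)*hd2

theorem Equivalent.trans {f g h : BQF} (h1 : Equivalent f g) (h2 : Equivalent g h) :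
    Equivalent f h := by
  obtain ⟨m, k, l, o, hd, rfl⟩ := equiv_iff.1 h1
  obtain ⟨m', k', l', o', hd', rfl⟩ := equiv_iff.1 h2
  refine equiv_iff.2 ⟨m*m'+k*l', m*k'+k*o', l*m'+o*l', l*k'+o*o', ?_, ext_eval fun x y => ?_⟩
  · have : (m*m'+k*l')*(l*k'+o*o') - (m*k'+k*o')*(l*m'+o*l') = (m*o-k*l)*(m'*o'-k'*l') := by ring
    rw [this]; rcases hd with h | h <;> rcases hd' with h' | h' <;> simp [h, h']
  · rw [evalZ_sub, evalZ_sub, evalZ_sub]; congr 1 <;> ring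

theorem I_sub (f : BQF) (m k l o : ℤ) : (f.sub m k l o).I = (m*o-k*l)^4 * f.I := by
  simp only [I, sub]; ring
theorem J_sub (f : BQF) (m k l o : ℤ) : (f.sub m k l o).J = (m*o-k*l)^6 * f.J := by
  simp only [J, sub]; ring

theorem Equivalent.I_eq {f g : BQF} (h : Equivalent f g) : g.I = f.I := by
  obtain ⟨m, k, l, o, hd, rfl⟩ := equiv_iff.1 h
  rw [I_sub]; rcases hd with h | h <;> simp [h]
theorem Equivalent.J_eq {f g : BQF} (h : Equivalent f g) : g.J = f.J := by
  obtain ⟨m, k, l, o, hd, rfl⟩ := equiv_iff.1 h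
  rw [J_sub]; rcases hd with h | h <;> simp [h]

def stoid : Setoid BQF := ⟨Equivalent, Equivalent.refl, Equivalent.symm, Equivalent.trans⟩
def cls (f : BQF) : Quotient stoid := Quotient.mk stoid f
theorem cls_eq {f g : BQF} : f.cls = g.cls ↔ Equivalent f g := Quotient.eq (r := stoid)

theorem classCount_eq (P : BQF → Prop) : classCount P = (cls '' {f | P f}).ncard := by
  unfold classCount
  rw [← Nat.card_coe_set_eq]
  refine Nat.card_congr (Equiv.ofBijective (Quot.lift (fun f => ⟨f.1.cls, f.1, f.2, rfl⟩)
    fun f g h => Subtype.ext (cls_eq.2 h)) ⟨?_, ?_⟩)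
  · rintro ⟨f⟩ ⟨g⟩ h
    exact Quot.sound (cls_eq.1 (congrArg Subtype.val h))
  · rintro ⟨_, f, hf, rfl⟩
    exact ⟨Quot.mk _ ⟨f, hf⟩, rfl⟩

/-- the forms counted -/
def AA (i : ℕ) (X : ℝ) : Set BQF := {f | f.Irred ∧ f.realRoots.ncard = 4 - 2*i ∧
  |(f.I:ℝ)| < X ∧ |(f.J:ℝ)| < X}

def IJ : Quotient stoid → ℤ × ℤ := Quotient.lift (fun f => (f.I, f.J)) fun _ _ h => by
  rw [Equivalent.I_eq h, Equivalent.J_eq h]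

theorem max_lt_iff' (p : ℤ × ℤ) (X : ℝ) :
    ((max |p.1| |p.2| : ℤ) : ℝ) < X ↔ |(p.1:ℝ)| < X ∧ |(p.2:ℝ)| < X := by
  push_cast; exact max_lt_iff

theorem numer_eq (i : ℕ) (X : ℝ) (hfin : (cls '' AA i X).Finite) :
    (∑' p : ℤ × ℤ, if ((max |p.1| |p.2| : ℤ) : ℝ) < X then (hIJ i p.1 p.2 : ℝ) else 0)
      = (cls '' AA i X).ncard := by
  classical
  set S := hfin.toFinset
  have key : ∀ p : ℤ × ℤ, (if ((max |p.1| |p.2| : ℤ) : ℝ) < X then (hIJ i p.1 p.2 : ℝ) else 0)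
      = ((S.filter fun q => IJ q = p).card : ℝ) := by
    intro p
    split_ifs with h
    · rw [max_lt_iff'] at h
      rw [hIJ, classCount_eq, ← Set.ncard_coe_finset]
      congr 2
      ext q
      simp only [S, Finset.coe_filter, Set.Finite.mem_toFinset, mem_setOf_eq, mem_image]
      constructor
      · rintro ⟨f, ⟨h1, h2, h3, h4⟩, rfl⟩
        refine ⟨⟨f, ⟨h1, h2, ?_, ?_⟩, rfl⟩, Prod.ext h3 h4⟩
        · rw [h3]; exact h.1
        · rw [h4]; exact h.2
      · rintro ⟨⟨f, ⟨h1, h2, h3, h4⟩, rfl⟩, h5⟩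
        exact ⟨f, ⟨h1, h2, congrArg Prod.fst h5, congrArg Prod.snd h5⟩, rfl⟩
    · symm
      rw [Nat.cast_eq_zero, Finset.card_eq_zero, Finset.filter_eq_empty_iff]
      rintro q hq rfl
      obtain ⟨f, hf, rfl⟩ := hfin.mem_toFinset.1 hq
      exact h ((max_lt_iff' _ _).2 hf.2.2)
  simp_rw [key]
  rw [tsum_eq_sum (s := S.image IJ), ← Nat.cast_sum, ← Finset.card_eq_sum_card_fiberwise,
    Set.ncard_eq_toFinset_card _ hfin]
  · intro q hq; exact Finset.mem_coe.2 (Finset.mem_image_of_mem _ hq)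
  · intro p hp
    rw [Nat.cast_eq_zero, Finset.card_eq_zero, Finset.filter_eq_empty_iff]
    rintro q hq rfl
    exact hp (Finset.mem_image_of_mem _ hq)

end BQF
end

section
open Set
namespace BQF

theorem card_window {s : Finset ℤ} {L : ℝ} (hL : 0 ≤ L)
    (h : ∀ x ∈ s, ∀ y ∈ s, |(x:ℝ) - y| ≤ L) : (s.card : ℝ) ≤ L + 1 := by
  rcases s.eq_empty_or_nonempty with rfl | hs
  · simp; linarith
  have hsub : s ⊆ Finset.Icc (s.min' hs) (s.min' hs + ⌊L⌋) := by
    intro x hx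
    rw [Finset.mem_Icc]
    refine ⟨Finset.min'_le _ _ hx, ?_⟩
    have := (abs_le.1 (h x hx _ (s.min'_mem hs))).2
    have : x - s.min' hs ≤ ⌊L⌋ := by rw [Int.le_floor]; push_cast; exact this
    linarith
  have h1 := Finset.card_le_card hsub
  rw [Int.card_Icc] at h1
  have h0 : 0 ≤ ⌊L⌋ := Int.floor_nonneg.2 hL
  have h2 : (s.card : ℤ) ≤ ⌊L⌋ + 1 := by omega
  have h3 : (s.card : ℝ) ≤ ⌊L⌋ + 1 := by exact_mod_cast h2
  linarith [Int.floor_le L]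

theorem card_nest {α : Type*} {s : Finset α} (g : α → ℤ) (K : Finset ℤ) (B : ℤ → ℝ)
    (hg : ∀ x ∈ s, g x ∈ K) (h : ∀ k ∈ K, ((s.filter fun x => g x = k).card : ℝ) ≤ B k) :
    (s.card : ℝ) ≤ ∑ k ∈ K, B k := by
  rw [Finset.card_eq_sum_card_fiberwise (t := K) (f := g) (fun x hx => hg x hx)]
  push_cast
  exact Finset.sum_le_sum h

theorem sum_even (F : ℕ → ℝ) (hF : ∀ j, 0 ≤ F j) (K : Finset ℤ) :
    ∑ k ∈ K, F k.natAbs ≤ 2 * ∑ j ∈ K.image Int.natAbs, F j := by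
  rw [Finset.sum_comp, Finset.mul_sum]
  refine Finset.sum_le_sum fun j _ => ?_
  rw [nsmul_eq_mul]
  refine mul_le_mul_of_nonneg_right ?_ (hF j)
  have : (K.filter fun k => k.natAbs = j) ⊆ {(j:ℤ), -(j:ℤ)} := by
    intro k hk
    have := (Finset.mem_filter.1 hk).2
    rw [Finset.mem_insert, Finset.mem_singleton]; omega
  exact_mod_cast (Finset.card_le_card this).trans Finset.card_le_two

theorem sum_inv_sqrt (M : ℝ) (hM : 0 ≤ M) (K : Finset ℤ)
    (hK : ∀ k ∈ K, k ≠ 0 ∧ |(k:ℝ)| ≤ M) : ∑ k ∈ K, 1 / √|(k:ℝ)| ≤ 4 * √M := by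
  have base : ∀ m : ℕ, ∑ k ∈ Finset.Icc 1 m, 1 / √(k:ℝ) ≤ 2 * √m := by
    intro m
    induction m with
    | zero => simp
    | succ m ih =>
      rw [Finset.sum_Icc_succ_top (by omega)]
      have h1 : 0 < √((m:ℝ)+1) := Real.sqrt_pos.2 (by positivity)
      have h2 := Real.sqrt_nonneg (m:ℝ)
      have h3 : √((m:ℝ)+1)^2 = m+1 := Real.sq_sqrt (by positivity)
      have h4 : √(m:ℝ)^2 = m := Real.sq_sqrt (by positivity)
      have : 1 / √((m:ℝ)+1) ≤ 2 * √((m:ℝ)+1) - 2 * √m := by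
        rw [div_le_iff₀ h1]; nlinarith [sq_nonneg (√((m:ℝ)+1) - √m)]
      push_cast; linarith
  have e1 : K.image Int.natAbs ⊆ Finset.Icc 1 ⌊M⌋₊ := by
    intro j hj
    obtain ⟨k, hk, rfl⟩ := Finset.mem_image.1 hj
    obtain ⟨h0, h1⟩ := hK k hk
    rw [Finset.mem_Icc, Nat.le_floor_iff hM, Nat.cast_natAbs, Int.cast_abs]
    exact ⟨by omega, h1⟩
  have e2 := base ⌊M⌋₊
  have e3 : √(⌊M⌋₊:ℝ) ≤ √M := Real.sqrt_le_sqrt (Nat.floor_le hM)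
  have e4 := sum_even (fun j => 1 / √(j:ℝ)) (fun _ => by positivity) K
  simp only [Nat.cast_natAbs, Int.cast_abs] at e4
  have e5 := Finset.sum_le_sum_of_subset_of_nonneg (f := fun j : ℕ => 1 / √(j:ℝ)) e1
    (fun _ _ _ => by positivity)
  linarith

theorem sum_inv_sqrt3 (N : ℕ) (hN : 1 ≤ N) (K : Finset ℤ)
    (hK : ∀ k ∈ K, (N:ℝ) < |(k:ℝ)|) : ∑ k ∈ K, 1 / (|(k:ℝ)| * √|(k:ℝ)|) ≤ 4 / √N := by
  have base : ∀ m : ℕ, N ≤ m →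
      ∑ k ∈ Finset.Ioc N m, 1 / ((k:ℝ) * √(k:ℝ)) ≤ 2 / √N - 2 / √m := by
    intro m hm
    induction m, hm using Nat.le_induction with
    | base => simp
    | succ m hm ih =>
      rw [← Finset.insert_Ioc_right_eq_Ioc_add_one hm, Finset.sum_insert (by simp)]
      have hm0 : (0:ℝ) < m := by exact_mod_cast (by omega : 0 < m)
      have h1 : 0 < √((m:ℝ)+1) := Real.sqrt_pos.2 (by positivity)
      have h2 : 0 < √(m:ℝ) := Real.sqrt_pos.2 hm0
      have h3 : √((m:ℝ)+1)^2 = m+1 := Real.sq_sqrt (by positivity)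
      have h4 : √(m:ℝ)^2 = m := Real.sq_sqrt (by positivity)
      have h5 : √(m:ℝ) ≤ √((m:ℝ)+1) := Real.sqrt_le_sqrt (by linarith)
      have : 1 / (((m:ℝ)+1) * √((m:ℝ)+1)) ≤ 2 / √m - 2 / √((m:ℝ)+1) := by
        rw [div_sub_div _ _ h2.ne' h1.ne', div_le_div_iff₀ (by positivity) (by positivity)]
        generalize √(m:ℝ) = x at *
        generalize √((m:ℝ)+1) = y at *
        rw [← h3]
        have hy : y^2 = x^2+1 := by rw [h3, h4]
        have : (y - x) * (y + x) = 1 := by ring_nf; linarith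
        have h6 : 1 ≤ (y-x)*(2*y) := by nlinarith
        nlinarith [mul_le_mul_of_nonneg_right h6 (by positivity : 0 ≤ y*y), mul_nonneg (sub_nonneg.2 h5) h1.le]
      push_cast at *; linarith
  set m := N + K.sup Int.natAbs
  have e1 : K.image Int.natAbs ⊆ Finset.Ioc N m := by
    intro j hj
    obtain ⟨k, hk, rfl⟩ := Finset.mem_image.1 hj
    have h1 := hK k hk
    have h2 : k.natAbs ≤ K.sup Int.natAbs := Finset.le_sup hk
    have h3 : N < k.natAbs := by
      have : (N:ℝ) < (k.natAbs:ℝ) := by rw [Nat.cast_natAbs, Int.cast_abs]; exact h1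
      exact_mod_cast this
    rw [Finset.mem_Ioc]; omega
  have e2 := base m (by omega)
  have e4 := sum_even (fun j => 1 / ((j:ℝ) * √(j:ℝ))) (fun _ => by positivity) K
  simp only [Nat.cast_natAbs, Int.cast_abs] at e4
  have e5 := Finset.sum_le_sum_of_subset_of_nonneg (f := fun j : ℕ => 1 / ((j:ℝ) * √(j:ℝ))) e1
    (fun _ _ _ => by positivity)
  have e6 : 0 ≤ 2 / √(m:ℝ) := by positivity
  have e7 : (4:ℝ) / √N = 2 * (2 / √N) := by ring
  linarith
end BQF
end

section
open Set
namespace BQF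

theorem le_of_sq_le_sq' {x y : ℝ} (h : x^2 ≤ y^2) (hy : 0 ≤ y) : x ≤ y :=
  (le_abs_self x).trans (abs_le_of_sq_le_sq h hy)

def Hz (f : BQF) : ℤ := 8 * f.a * f.c - 3 * f.b ^ 2

theorem syzygy (f : BQF) : 27 * (f.b^3 + 8*f.a^2*f.d - 4*f.a*f.b*f.c)^2
    = -f.Hz^3 + 48*f.I*f.a^2*f.Hz - 64*f.J*f.a^3 := by
  simp only [Hz, I, J]; ring

theorem dcount {A t H Δ h : ℝ} (hA : 0 < A) (hh : 0 < h) (hΔ : 0 ≤ Δ) (s : Finset ℤ)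
    (hs : ∀ d ∈ s, |27*(8*A^2*d+t)^2+H^3| ≤ Δ) :
    (s.card:ℝ) ≤ 2*(√Δ/(8*A^2)+1) ∧ (|H| = h^2 → (s.card:ℝ) ≤ 2*(Δ/h^3/(8*A^2)+1)) := by
  classical
  have key : ∀ L : ℝ, 0 ≤ L → (∀ d ∈ s, ∀ d' ∈ s, 0 ≤ (8*A^2*d+t)*(8*A^2*d'+t) →
      |(8*A^2*d+t)-(8*A^2*d'+t)| ≤ L) → (s.card:ℝ) ≤ 2*(L/(8*A^2)+1) := by
    intro L hL h
    have hA2 : 0 < 8*A^2 := by positivity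
    have e : ∀ d d' : ℤ, |(8*A^2*d+t)-(8*A^2*d'+t)| = 8*A^2*|(d:ℝ)-d'| := by
      intro d d'
      rw [← abs_of_pos hA2, ← abs_mul, abs_of_pos hA2]; ring_nf
    have h1 : ((s.filter fun d : ℤ => 0 ≤ 8*A^2*d+t).card : ℝ) ≤ L/(8*A^2)+1 := by
      refine card_window (by positivity) fun d hd d' hd' => ?_
      rw [Finset.mem_filter] at hd hd'
      rw [le_div_iff₀' hA2, ← e]
      exact h d hd.1 d' hd'.1 (mul_nonneg hd.2 hd'.2)
    have h2 : ((s.filter fun d : ℤ => ¬ 0 ≤ 8*A^2*d+t).card : ℝ) ≤ L/(8*A^2)+1 := by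
      refine card_window (by positivity) fun d hd d' hd' => ?_
      rw [Finset.mem_filter, not_le] at hd hd'
      rw [le_div_iff₀' hA2, ← e]
      exact h d hd.1 d' hd'.1 (mul_nonneg_of_nonpos_of_nonpos hd.2.le hd'.2.le)
    have h3 := Finset.card_filter_add_card_filter_not (s := s) (fun d : ℤ => 0 ≤ 8*A^2*d+t)
    have h4 : ((s.filter fun d : ℤ => 0 ≤ 8*A^2*d+t).card : ℝ)
      + ((s.filter fun d : ℤ => ¬ 0 ≤ 8*A^2*d+t).card : ℝ) = s.card := by exact_mod_cast h3
    linarith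
  have sq : ∀ R R' : ℝ, |27*R^2+H^3| ≤ Δ → |27*R'^2+H^3| ≤ Δ → 0 ≤ R*R' →
      |R-R'|^2 ≤ Δ ∧ |R - R'| * (|R|+|R'|) ≤ 2*Δ/27 := by
    intro R R' h h' h0
    rw [abs_le] at h h'
    have e : |R - R'| * (|R|+|R'|) ≤ 2*Δ/27 := by
      rw [← abs_of_nonneg (by positivity : 0 ≤ |R|+|R'|), ← abs_mul]
      have : |R|+|R'| = |R+R'| := ((abs_add_eq_add_abs_iff _ _).2 (by
        rcases le_total 0 R with h1 | h1 <;> rcases le_total 0 R' with h2 | h2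
        · exact Or.inl ⟨h1, h2⟩
        · rcases h1.eq_or_lt with h3 | h3
          · exact Or.inr ⟨h3 ▸ le_rfl, h2⟩
          · exact Or.inl ⟨h1, by nlinarith⟩
        · rcases h1.eq_or_lt with h3 | h3
          · exact Or.inl ⟨h3 ▸ le_rfl, h2⟩
          · exact Or.inr ⟨h1, by nlinarith⟩
        · exact Or.inr ⟨h1, h2⟩)).symm
      rw [this, abs_mul, abs_abs, ← abs_mul, abs_le]
      constructor <;> nlinarith
    refine ⟨?_, e⟩
    have : |R-R'| ≤ |R|+|R'| := abs_sub _ _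
    nlinarith [abs_nonneg (R-R')]
  refine ⟨key _ (Real.sqrt_nonneg _) fun d hd d' hd' h0 => ?_, fun hH => key _ (by positivity)
    fun d hd d' hd' h0 => ?_⟩
  · exact Real.le_sqrt_of_sq_le (sq _ _ (hs d hd) (hs d' hd') h0).1
  · obtain ⟨h1, h2⟩ := sq _ _ (hs d hd) (hs d' hd') h0
    have low : ∀ R : ℝ, 2*Δ ≤ h^6 → |27*R^2+H^3| ≤ Δ → h^3 ≤ 8*|R| := by
      intro R hR hs
      rw [abs_le] at hs
      have h6 : h^6 = |H|^3 := by rw [hH]; ring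
      refine le_of_sq_le_sq' ?_ (by positivity)
      have : 0 < h^6 := by positivity
      rw [mul_pow, sq_abs]
      rcases abs_cases H with ⟨h7, _⟩ | ⟨h7, _⟩
      · rw [h7] at h6; nlinarith [sq_nonneg R]
      · rw [h7] at h6; nlinarith [sq_nonneg R]
    rw [le_div_iff₀ (by positivity)]
    have hh3 : 0 < h^3 := by positivity
    have ha := abs_nonneg (8*A^2*d+t-(8*A^2*d'+t))
    rcases le_total (2*Δ) (h^6) with hc | hc
    · have l1 := low _ hc (hs d hd)
      have l2 := low _ hc (hs d' hd')
      nlinarith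
    · refine le_of_sq_le_sq' ?_ hΔ
      have h6 : |8*A^2*d+t-(8*A^2*d'+t)| ^2 ≤ Δ/2 := by
        have : |8*A^2*d+t-(8*A^2*d'+t)| ≤ |8*A^2*d+t|+|8*A^2*d'+t| := abs_sub _ _
        nlinarith
      rw [mul_pow]
      calc _ ≤ Δ/2 * (2*Δ) := by
            refine mul_le_mul h6 (le_of_eq_of_le (by ring) hc) (by positivity) (by positivity)
        _ = Δ^2 := by ring

set_option maxHeartbeats 400000 in
/-- fibre bound -/
theorem fibre_le {C N : ℝ} (hC : 1 ≤ C) (hN : 1 ≤ N) {a b c : ℤ} (ha : a ≠ 0) (s : Finset BQF)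
    (hs : ∀ f ∈ s, f.a = a ∧ f.b = b ∧ f.c = c ∧ |(f.I:ℝ)| ≤ N^2 ∧ |(f.J:ℝ)| ≤ N^2)
    {A H G : ℝ} (hA : A = |(a:ℝ)|) (hH : H = 8*a*c-3*b^2) (hG : G = max |H| A) (hAN : A ≤ C*N)
    (hGN : G ≤ C*N^2) :
    (s.card:ℝ) ≤ (28+2*C)*(1+C) * (N^3/(A*√G)) ∧
    (A ≤ |H| → (s.card:ℝ) ≤ (28+2*C)*(1+C) * (N^4/(G*√G))) := by
  classical
  have hA1 : 1 ≤ A := by rw [hA]; exact_mod_cast Int.one_le_abs ha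
  have hA2 : A^2 = (a:ℝ)^2 := by rw [hA, sq_abs]
  have hAG : A ≤ G := hG ▸ le_max_right _ _
  have hHG : |H| ≤ G := hG ▸ le_max_left _ _
  have hG0 : 0 < G := by linarith
  set g := √G with hg
  have hg0 : 0 < g := Real.sqrt_pos.2 hG0
  have hgG : g^2 = G := Real.sq_sqrt hG0.le
  -- number of e
  have he : ∀ d : ℤ, ((s.filter fun f => f.d = d).card : ℝ) ≤ (1+C)*(N^2/G) := by
    intro d
    have inj : Set.InjOn BQF.e (s.filter fun f => f.d = d : Finset BQF) := by
      intro f hf f' hf' h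
      rw [Finset.mem_coe, Finset.mem_filter] at hf hf'
      obtain ⟨h1, h2, h3, -⟩ := hs f hf.1
      obtain ⟨h1', h2', h3', -⟩ := hs f' hf'.1
      have h4 := hf.2; have h4' := hf'.2
      cases f; cases f'; simp_all
    rw [← Finset.card_image_of_injOn inj]
    have : (((s.filter fun f => f.d = d).image BQF.e).card : ℝ) ≤ N^2/G + 1 := by
      refine card_window (by positivity) ?_
      simp only [Finset.mem_image, Finset.mem_filter]
      rintro _ ⟨f, ⟨hf, hfd⟩, rfl⟩ _ ⟨f', ⟨hf', hfd'⟩, rfl⟩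
      obtain ⟨h1, h2, h3, h4, h5⟩ := hs f hf
      obtain ⟨h1', h2', h3', h4', h5'⟩ := hs f' hf'
      have eI : (f.I:ℝ) - f'.I = 12*a*((f.e:ℝ) - f'.e) := by
        simp only [I, h1, h2, h3, h1', h2', h3', hfd, hfd']; push_cast; ring
      have eJ : (f.J:ℝ) - f'.J = 9*H*((f.e:ℝ) - f'.e) := by
        simp only [J, h1, h2, h3, h1', h2', h3', hfd, hfd', hH]; push_cast; ring
      have dI : |(f.I:ℝ) - f'.I| ≤ 2*N^2 := (abs_sub _ _).trans (by linarith)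
      have dJ : |(f.J:ℝ) - f'.J| ≤ 2*N^2 := (abs_sub _ _).trans (by linarith)
      rw [eI, abs_mul, abs_mul, ← hA, abs_of_pos (by norm_num : (0:ℝ) < 12)] at dI
      rw [eJ, abs_mul, abs_mul, abs_of_pos (by norm_num : (0:ℝ) < 9)] at dJ
      rw [le_div_iff₀ hG0]
      have := abs_nonneg ((f.e:ℝ) - f'.e)
      rcases max_choice |H| A with h | h <;> rw [hG, h] <;> nlinarith
    have : 1 ≤ C*(N^2/G) := by rw [mul_div_assoc', le_div_iff₀ hG0]; linarith
    linarith
  set D := s.image BQF.d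
  have hcard : (s.card:ℝ) ≤ D.card * ((1+C)*(N^2/G)) := by
    have := card_nest (s := s) BQF.d D (fun _ => (1+C)*(N^2/G))
      (fun x hx => Finset.mem_image_of_mem _ hx) (fun k _ => he k)
    rwa [Finset.sum_const, nsmul_eq_mul] at this
  obtain ⟨c1, c2⟩ := dcount (A := A) (t := b^3-4*a*b*c) (H := H) (Δ := 112*N^2*A^2*G) (h := g)
    (by linarith) hg0 (by positivity) D (by
      intro d hd
      obtain ⟨f, hf, rfl⟩ := Finset.mem_image.1 hd
      obtain ⟨h1, h2, h3, h4, h5⟩ := hs f hf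
      have e := syzygy f
      have e' : (27:ℝ) * (f.b^3 + 8*f.a^2*f.d - 4*f.a*f.b*f.c)^2
        = -(f.Hz:ℝ)^3 + 48*f.I*f.a^2*f.Hz - 64*f.J*f.a^3 := by exact_mod_cast e
      have e2 : (f.Hz:ℝ) = H := by rw [hH, Hz, h1, h2, h3]; push_cast; ring
      rw [e2, h1, h2, h3] at e'
      have e3 : 27*(8*A^2*f.d+(b^3-4*a*b*c))^2+H^3 = 48*f.I*a^2*H - 64*f.J*a^3 := by
        rw [hA2]; linear_combination e'
      rw [e3]
      have m1 : |(48*f.I*a^2*H : ℝ)| ≤ 48*(N^2*A^2*G) := by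
        rw [show (48*f.I*a^2*H : ℝ) = 48*(f.I*(a^2*H)) by ring, abs_mul, abs_mul, abs_mul,
          abs_of_pos (by norm_num : (0:ℝ) < 48), abs_of_nonneg (sq_nonneg (a:ℝ)), ← hA2, mul_assoc]
        gcongr
      have m2 : |(64*f.J*a^3 : ℝ)| ≤ 64*(N^2*A^2*G) := by
        rw [show (64*f.J*a^3 : ℝ) = 64*(f.J*(a^2*a)) by ring, abs_mul, abs_mul, abs_mul,
          abs_of_pos (by norm_num : (0:ℝ) < 64), abs_of_nonneg (sq_nonneg (a:ℝ)), ← hA2, mul_assoc,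
          ← hA]
        gcongr
      exact (abs_sub _ _).trans (by linarith))
  have hA0 : 0 < A := by linarith
  have hN0 : 0 < N := by linarith
  constructor
  · have r1 : √(112*N^2*A^2*G) ≤ 11*N*A*g := by
      rw [← hgG]; apply Real.sqrt_le_iff.2
      constructor
      · positivity
      · have : 0 ≤ N^2*A^2*g^2 := by positivity
        nlinarith
    have r2 : 1 ≤ C*(N*g/A) := by
      rw [mul_div_assoc', le_div_iff₀ hA0, one_mul]
      refine le_of_sq_le_sq' ?_ (by positivity)
      calc A^2 ≤ (C*N)*G := by rw [sq]; exact mul_le_mul hAN hAG hA0.le (by positivity)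
        _ ≤ (C*N)^2*G := by
          have : C*N ≤ (C*N)^2 :=
            le_self_pow₀ (one_le_mul_of_one_le_of_one_le hC hN) two_ne_zero
          gcongr
        _ = _ := by rw [← hgG]; ring
    have r3 : √(112*N^2*A^2*G)/(8*A^2) ≤ 2*(N*g/A) := by
      rw [div_le_iff₀ (by positivity)]
      calc _ ≤ _ := r1
        _ ≤ 16 * (N*A*g) := by nlinarith [mul_pos (mul_pos hN0 hA0) hg0]
        _ = _ := by field_simp; ring
    have r4 : (D.card:ℝ) ≤ (28+2*C)*(N*g/A) := by
      have : 0 ≤ N*g/A := by positivity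
      nlinarith
    calc (s.card:ℝ) ≤ _ := hcard
      _ ≤ (28+2*C)*(N*g/A) * ((1+C)*(N^2/G)) := by gcongr
      _ = _ := by rw [← hgG]; field_simp
  · intro hAH
    have hHG' : |H| = G := by rw [hG, max_eq_left hAH]
    have r4 : (D.card:ℝ) ≤ (28+2*C)*(N^2/g) := by
      have h1 := c2 (by rw [hHG', hgG])
      have h2 : 112*N^2*A^2*G/g^3/(8*A^2) = 14*(N^2/g) := by rw [← hgG]; field_simp; ring
      have h3 : 1 ≤ C*(N^2/g) := by
        rw [mul_div_assoc', le_div_iff₀ hg0, one_mul]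
        refine le_of_sq_le_sq' ?_ (by positivity)
        rw [hgG]
        have h5 : 1 ≤ C*N^2 := one_le_mul_of_one_le_of_one_le hC (one_le_pow₀ hN)
        exact hGN.trans (le_self_pow₀ h5 two_ne_zero)
      rw [h2] at h1; linarith
    calc (s.card:ℝ) ≤ _ := hcard
      _ ≤ (28+2*C)*(N^2/g) * ((1+C)*(N^2/G)) := by gcongr
      _ = _ := by field_simp
end BQF
end

section
open Set
namespace BQF

def TailSet (C : ℝ) (N : ℕ) : Set BQF := {f | f.a ≠ 0 ∧ |(f.a:ℝ)| ≤ C*N ∧ |f.b| ≤ 2*|f.a| ∧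
  |(f.Hz:ℝ)| ≤ C*N^2 ∧ |(f.I:ℝ)| ≤ N^2 ∧ |(f.J:ℝ)| ≤ N^2}

theorem kfibre {C : ℝ} {N : ℕ} (hC : 1 ≤ C) (hN : 1 ≤ N) {a b : ℤ} (ha : a ≠ 0) (s : Finset BQF)
    (hs : ∀ f ∈ s, f ∈ TailSet C N ∧ f.a = a ∧ f.b = b) {A K : ℝ} (hA : A = |(a:ℝ)|)
    (hK : K = (28+2*C)*(1+C)) :
    (s.card:ℝ) ≤ 9*K*(N^3*√N/(A*√A)) ∧ ∀ θ, 0 ≤ θ → (∀ f ∈ s, |(f.Hz:ℝ)| ≤ θ*N^2) →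
      (s.card:ℝ) ≤ K*(N^3/(A*√A)*(1+2*√θ*N/√A)) := by
  classical
  have hN' : (1:ℝ) ≤ N := by exact_mod_cast hN
  have hA1 : 1 ≤ A := by rw [hA]; exact_mod_cast Int.one_le_abs ha
  have hA0 : 0 < A := by linarith
  have hK0 : 0 ≤ K := by rw [hK]; positivity
  set c0 : ℤ := round (3*(b:ℝ)^2/(8*a))
  have ha' : (a:ℝ) ≠ 0 := by exact_mod_cast ha
  have hH : ∀ c : ℤ, c ≠ c0 → 4*A*|((c-c0:ℤ):ℝ)| ≤ |8*(a:ℝ)*c-3*b^2| := by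
    intro c hc
    have e : 8*(a:ℝ)*c-3*b^2 = 8*a*(((c-c0:ℤ):ℝ) - (3*(b:ℝ)^2/(8*a) - c0)) := by
      push_cast; field_simp; ring
    rw [e, abs_mul, abs_mul, ← hA, abs_of_pos (by norm_num : (0:ℝ) < 8)]
    have h1 : |3*(b:ℝ)^2/(8*a) - c0| ≤ 1/2 := abs_sub_round _
    have h2 : 1 ≤ |((c-c0:ℤ):ℝ)| := by exact_mod_cast Int.one_le_abs (sub_ne_zero.2 hc)
    have h3 := abs_sub_abs_le_abs_sub ((c-c0:ℤ):ℝ) (3*(b:ℝ)^2/(8*a) - c0)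
    nlinarith
  set B0 := K*(N^3/(A*√A)) with hB0
  have hB00 : 0 ≤ B0 := by positivity
  have fib : ∀ k : ℤ, (k = 0 → ((s.filter fun f => f.c - c0 = k).card:ℝ) ≤ B0) ∧
      (k ≠ 0 → ((s.filter fun f => f.c - c0 = k).card:ℝ) ≤ B0*(1/√|(k:ℝ)|) ∧
       ((s.filter fun f => f.c - c0 = k).card:ℝ) ≤ B0*N*(1/(|(k:ℝ)| *√|(k:ℝ)|))) := by
    intro k
    rcases (s.filter fun f => f.c - c0 = k).eq_empty_or_nonempty with h0 | ⟨f0, hf0⟩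
    · rw [h0]; simp; exact ⟨fun _ => hB00, fun _ => ⟨by positivity, by positivity⟩⟩
    rw [Finset.mem_filter] at hf0
    obtain ⟨⟨-, t1, -, t2, -⟩, t3, t4⟩ := hs f0 hf0.1
    have hf : f0.c = c0 + k := by linarith [hf0.2]
    have main := fibre_le hC hN' (c := c0+k) (b := b) ha (s.filter fun f => f.c - c0 = k) (by
      intro f hf
      rw [Finset.mem_filter] at hf
      obtain ⟨⟨-, -, -, -, h5, h6⟩, h2, h3⟩ := hs f hf.1
      exact ⟨h2, h3, by linarith [hf.2], h5, h6⟩) hA rfl rfl (by rw [hA, ← t3]; exact t1) (by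
      rw [max_le_iff]; constructor
      · have : (f0.Hz:ℝ) = 8*a*((c0+k:ℤ):ℝ)-3*b^2 := by rw [Hz, t3, t4, hf]; push_cast; ring
        rw [← this]; exact t2
      · calc A ≤ C*N := by rw [hA, ← t3]; exact t1
          _ ≤ C*N^2 := by gcongr; exact le_self_pow₀ hN' two_ne_zero)
    rw [← hK] at main
    set G := max |8*(a:ℝ)*((c0+k:ℤ):ℝ)-3*b^2| A
    have hAG : A ≤ G := le_max_right _ _
    have hG0 : 0 < G := by linarith
    constructor
    · intro _
      refine main.1.trans ?_
      rw [hB0]; gcongr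
    · intro hk
      have h1 := hH (c0+k) (by simpa using hk)
      rw [add_sub_cancel_left] at h1
      have hk1 : 1 ≤ |(k:ℝ)| := by exact_mod_cast Int.one_le_abs hk
      have hk0 : 0 < |(k:ℝ)| := by linarith
      have hG1 : A*|(k:ℝ)| ≤ G := by
        refine le_trans ?_ (h1.trans (le_max_left _ _)); nlinarith
      have hG2 : √A*√|(k:ℝ)| ≤ √G := by
        rw [← Real.sqrt_mul hA0.le]; exact Real.sqrt_le_sqrt hG1
      constructor
      · refine main.1.trans ?_
        calc _ ≤ K*(N^3/(A*(√A*√|(k:ℝ)|))) := by gcongr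
          _ = _ := by rw [hB0]; field_simp
      · refine (main.2 (by nlinarith)).trans ?_
        calc _ ≤ K*(N^4/(A*|(k:ℝ)| *(√A*√|(k:ℝ)|))) := by gcongr
          _ = _ := by rw [hB0]; field_simp
  set Ks := s.image fun f => f.c - c0
  have hmem : ∀ f ∈ s, f.c - c0 ∈ Ks := fun f hf => Finset.mem_image_of_mem _ hf
  have split0 : ∀ g : ℤ → ℝ, (∀ k, 0 ≤ g k) →
      ∑ k ∈ Ks, (if k = 0 then B0 else g k) ≤ B0 + ∑ k ∈ Ks.filter (· ≠ 0), g k := by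
    intro g hg
    rw [Finset.sum_ite, Finset.sum_const, nsmul_eq_mul]
    have : ((Ks.filter (· = 0)).card : ℝ) ≤ 1 := by
      exact_mod_cast Finset.card_le_one.2 (by
        intro x hx y hy
        rw [(Finset.mem_filter.1 hx).2, (Finset.mem_filter.1 hy).2])
    gcongr
    nlinarith
  have hsN : √(N:ℝ)*√N = N := Real.mul_self_sqrt (by positivity)
  have hsN1 : 1 ≤ √(N:ℝ) := Real.one_le_sqrt.2 hN'
  constructor
  · have h1 := card_nest (s := s) _ Ks (fun k => if k = 0 then B0 else if |(k:ℝ)| ≤ N then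
      B0*(1/√|(k:ℝ)|) else B0*N*(1/(|(k:ℝ)| *√|(k:ℝ)|))) hmem (by
      intro k _
      split_ifs with h h'
      · exact (fib k).1 h
      · exact ((fib k).2 h).1
      · exact ((fib k).2 h).2)
    have h2 := h1.trans (split0 _ (fun k => by split_ifs <;> positivity))
    rw [Finset.sum_ite, ← Finset.mul_sum, ← Finset.mul_sum] at h2
    have h3 := sum_inv_sqrt N (by positivity) ((Ks.filter (· ≠ 0)).filter fun k : ℤ => |(k:ℝ)| ≤ N)
      (by simp only [Finset.mem_filter]; tauto)
    have h4 := sum_inv_sqrt3 N hN ((Ks.filter (· ≠ 0)).filter fun k : ℤ => ¬ |(k:ℝ)| ≤ N)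
      (by simp only [Finset.mem_filter, not_le]; tauto)
    calc (s.card:ℝ) ≤ _ := h2
      _ ≤ B0 + (B0*(4*√N) + B0*N*(4/√N)) := by gcongr
      _ = B0*(1+8*√N) := by
        have : (N:ℝ)*(4/√N) = 4*√N := by
          rw [mul_div_assoc', div_eq_iff (by positivity)]; linear_combination (-4)*hsN
        linear_combination B0*this
      _ ≤ B0*(9*√N) := by gcongr; linarith
      _ = _ := by rw [hB0]; ring
  · intro θ hθ hH2
    have h1 := card_nest (s := s) _ Ks (fun k => if k = 0 then B0 else B0*(1/√|(k:ℝ)|)) hmem (by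
      intro k _
      split_ifs with h
      · exact (fib k).1 h
      · exact ((fib k).2 h).1)
    have h2 := h1.trans (split0 _ (fun k => by positivity))
    rw [← Finset.mul_sum] at h2
    have h3 := sum_inv_sqrt (θ*N^2/(4*A)) (by positivity) (Ks.filter (· ≠ 0)) (by
      intro k hk
      rw [Finset.mem_filter] at hk
      refine ⟨hk.2, ?_⟩
      obtain ⟨f, hf, rfl⟩ := Finset.mem_image.1 hk.1
      rw [le_div_iff₀' (by positivity)]
      refine (hH f.c (sub_ne_zero.1 hk.2)).trans ?_
      have : 8*(a:ℝ)*f.c-3*b^2 = f.Hz := by rw [Hz, (hs f hf).2.1, (hs f hf).2.2]; push_cast; ring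
      rw [this]; exact hH2 f hf)
    have h5 : √(θ*N^2/(4*A)) = √θ*N/(2*√A) := by
      rw [Real.sqrt_div (by positivity), Real.sqrt_mul hθ, Real.sqrt_sq (by positivity),
        Real.sqrt_mul (by norm_num), show (4:ℝ) = 2^2 by norm_num, Real.sqrt_sq (by norm_num)]
    calc (s.card:ℝ) ≤ _ := h2
      _ ≤ B0 + B0*(4*√(θ*N^2/(4*A))) := by gcongr
      _ = _ := by rw [hB0, h5]; field_simp; ring

theorem bfibre {a : ℤ} (ha : a ≠ 0) (s : Finset BQF) (hs : ∀ f ∈ s, |f.b| ≤ 2*|a|) {B : ℝ}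
    (hB : 0 ≤ B) (h : ∀ b, ((s.filter fun f => f.b = b).card:ℝ) ≤ B) :
    (s.card:ℝ) ≤ 5*|(a:ℝ)| *B := by
  have h1 := card_nest (s := s) BQF.b (Finset.Icc (-(2*|a|)) (2*|a|)) (fun _ => B)
    (fun f hf => by rw [Finset.mem_Icc]; exact abs_le.1 (hs f hf)) (fun b _ => h b)
  rw [Finset.sum_const, nsmul_eq_mul, Int.card_Icc] at h1
  refine h1.trans ?_
  gcongr
  have h2 : 1 ≤ |a| := Int.one_le_abs ha
  have : (((2*|a|+1 - -(2*|a|)).toNat : ℤ)) ≤ 5*|a| := by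
    rw [Int.toNat_of_nonneg (by linarith)]; linarith
  exact_mod_cast this

theorem tail1 {C : ℝ} (hC : 1 ≤ C) : ∃ K : ℝ, 0 < K ∧ ∀ (N : ℕ), 1 ≤ N → ∀ η : ℝ, 0 < η →
    ∀ s : Finset BQF, (∀ f ∈ s, f ∈ TailSet C N ∧ |(f.a:ℝ)| ≤ η*N) → (s.card:ℝ) ≤ K*√η*N^4 := by
  refine ⟨180*((28+2*C)*(1+C)), by positivity, fun N hN η hη s hs => ?_⟩
  set K := (28+2*C)*(1+C) with hK
  have hK0 : 0 ≤ K := by positivity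
  have h1 := card_nest (s := s) BQF.a (s.image BQF.a) (fun a => 45*K*(N^3*√N)*(1/√|(a:ℝ)|))
    (fun f hf => Finset.mem_image_of_mem _ hf) (by
    intro a ha
    obtain ⟨f0, hf0, rfl⟩ := Finset.mem_image.1 ha
    have ha0 := (hs f0 hf0).1.1
    have ha0' : (0:ℝ) < |(f0.a:ℝ)| := abs_pos.2 (by exact_mod_cast ha0)
    refine (bfibre ha0 _ (by
      intro f hf
      rw [Finset.mem_filter] at hf
      rw [← hf.2]; exact (hs f hf.1).1.2.2.1) (B := 9*K*(N^3*√N/(|(f0.a:ℝ)| *√|(f0.a:ℝ)|)))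
      (by positivity) ?_).trans (le_of_eq ?_)
    · intro b
      refine (kfibre (b := b) hC hN ha0 _ ?_ rfl hK).1
      intro f hf
      simp only [Finset.mem_filter] at hf
      exact ⟨(hs f hf.1.1).1, hf.1.2, hf.2⟩
    · field_simp; ring)
  rw [← Finset.mul_sum] at h1
  have h2 := sum_inv_sqrt (η*N) (by positivity) (s.image BQF.a) (by
    intro k hk
    obtain ⟨f, hf, rfl⟩ := Finset.mem_image.1 hk
    exact ⟨(hs f hf).1.1, (hs f hf).2⟩)
  have hsN : √(N:ℝ)*√N = N := Real.mul_self_sqrt (by positivity)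
  calc (s.card:ℝ) ≤ _ := h1
    _ ≤ 45*K*(N^3*√N)*(4*√(η*N)) := by gcongr
    _ = _ := by rw [Real.sqrt_mul hη.le]; linear_combination 180*K*N^3*√η*hsN

theorem tail2 {C : ℝ} (hC : 1 ≤ C) : ∃ K : ℝ, 0 < K ∧ ∀ (N : ℕ), 1 ≤ N → ∀ η θ : ℝ, 0 < η →
    0 ≤ θ → ∀ s : Finset BQF, (∀ f ∈ s, f ∈ TailSet C N ∧ η*N ≤ |(f.a:ℝ)| ∧
      |(f.Hz:ℝ)| ≤ θ*N^2) → (s.card:ℝ) ≤ K*(N^3*√N + √θ/η*N^4) := by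
  refine ⟨30*((28+2*C)*(1+C))*C, by positivity, fun N hN η θ hη hθ s hs => ?_⟩
  set K := (28+2*C)*(1+C) with hK
  have hK0 : 0 ≤ K := by positivity
  have hN' : (1:ℝ) ≤ N := by exact_mod_cast hN
  have h1 := card_nest (s := s) BQF.a (s.image BQF.a)
    (fun a => 5*K*N^3*(1/√|(a:ℝ)|) + 10*K*√θ*N^3/η)
    (fun f hf => Finset.mem_image_of_mem _ hf) (by
    intro a ha
    obtain ⟨f0, hf0, rfl⟩ := Finset.mem_image.1 ha
    have ha0 := (hs f0 hf0).1.1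
    have ha0' : (0:ℝ) < |(f0.a:ℝ)| := abs_pos.2 (by exact_mod_cast ha0)
    have ha1 := (hs f0 hf0).2.1
    generalize hA : |(f0.a:ℝ)| = A at *
    refine (bfibre ha0 _ (by
      intro f hf
      rw [Finset.mem_filter] at hf
      rw [← hf.2]; exact (hs f hf.1).1.2.2.1) (B := K*(N^3/(A*√A)*(1+2*√θ*N/√A)))
      (by positivity) ?_).trans ?_
    · intro b
      refine (kfibre (b := b) hC hN ha0 _ ?_ hA.symm hK).2 θ hθ ?_
      · intro f hf
        simp only [Finset.mem_filter] at hf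
        exact ⟨(hs f hf.1.1).1, hf.1.2, hf.2⟩
      · intro f hf
        simp only [Finset.mem_filter] at hf
        exact (hs f hf.1.1).2.2
    · rw [hA]
      have e1 : √A*√A = A := Real.mul_self_sqrt ha0'.le
      have e2 : 5*A*(K*(N^3/(A*√A)*(1+2*√θ*N/√A)))
        = 5*K*N^3*(1/√A) + 10*K*√θ*N^3*(N/(√A*√A)) := by field_simp; ring
      rw [e2, e1, div_eq_mul_inv (10*K*√θ*(N:ℝ)^3) η]
      have : (N:ℝ)/A ≤ η⁻¹ := by
        rw [div_le_iff₀ ha0', inv_mul_eq_div, le_div_iff₀ hη]; linarith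
      gcongr)
  rw [Finset.sum_add_distrib, ← Finset.mul_sum, Finset.sum_const, nsmul_eq_mul] at h1
  have h2 := sum_inv_sqrt (C*N) (by positivity) (s.image BQF.a) (by
    intro k hk
    obtain ⟨f, hf, rfl⟩ := Finset.mem_image.1 hk
    exact ⟨(hs f hf).1.1, (hs f hf).1.2.1⟩)
  have hCN : 1 ≤ C*N := one_le_mul_of_one_le_of_one_le hC hN'
  have h3 : ((s.image BQF.a).card:ℝ) ≤ 3*(C*N) := by
    refine (card_window (L := 2*(C*N)) (by positivity) ?_).trans (by linarith)
    intro x hx y hy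
    obtain ⟨f, hf, rfl⟩ := Finset.mem_image.1 hx
    obtain ⟨f', hf', rfl⟩ := Finset.mem_image.1 hy
    exact (abs_sub _ _).trans (by linarith [(hs f hf).1.2.1, (hs f' hf').1.2.1])
  have h4 : √(C*N) ≤ C*√N := by
    rw [Real.sqrt_mul (by linarith)]; gcongr
    exact Real.sqrt_le_iff.2 ⟨by linarith, le_self_pow₀ hC two_ne_zero⟩
  calc (s.card:ℝ) ≤ _ := h1
    _ ≤ 5*K*N^3*(4*(C*√N)) + 3*(C*N)*(10*K*√θ*N^3/η) := by gcongr; linarith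
    _ = 20*K*C*(N^3*√N) + 30*K*C*(√θ/η*N^4) := by field_simp; ring
    _ ≤ _ := by
      have : 0 ≤ K*C*(N^3*√N) := by positivity
      linarith
end BQF
end

section
open Set
namespace BQF
noncomputable def ee (x : ℝ) : ℂ := Complex.exp (Complex.I * (2*Real.pi*x : ℝ))
theorem ee_add (x y : ℝ) : ee (x+y) = ee x * ee y := by
  simp only [ee]; rw [← Complex.exp_add]; congr 1; push_cast; ring
theorem ee_norm (x : ℝ) : ‖ee x‖ = 1 := by
  rw [ee, mul_comm, Complex.norm_exp_ofReal_mul_I]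
theorem ee_conj (x : ℝ) : (starRingEnd ℂ) (ee x) = ee (-x) := by
  simp only [ee]; rw [← Complex.exp_conj]; congr 1
  rw [map_mul, Complex.conj_I, Complex.conj_ofReal]; push_cast; ring
theorem geom_le {θ c : ℝ} (h0 : θ ≠ 0) (h1 : |θ| ≤ 1/2) (T : ℕ) :
    ‖∑ t ∈ Finset.range T, ee (θ*t+c)‖ ≤ 1/(2*|θ|) := by
  have hpow : ∀ t : ℕ, ee (θ*t+c) = ee c * (ee θ)^t := by
    intro t
    induction t with
    | zero => simp
    | succ t ih => rw [pow_succ, ← mul_assoc, ← ih, ← ee_add]; congr 1; push_cast; ring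
  simp_rw [hpow]
  rw [← Finset.mul_sum, norm_mul, ee_norm, one_mul]
  have h3 := mul_geom_sum (ee θ) T
  have h4 : 4*|θ| ≤ ‖ee θ - 1‖ := by
    rw [ee, Complex.norm_exp_I_mul_ofReal_sub_one, Real.norm_eq_abs, abs_mul, abs_two,
      show 2*Real.pi*θ/2 = Real.pi*θ by ring]
    have : |Real.sin (Real.pi*θ)| = Real.sin (Real.pi*|θ|) := by
      have hp := Real.pi_pos
      rcases abs_cases θ with ⟨h, h'⟩ | ⟨h, h'⟩
      · rw [h, abs_of_nonneg]
        exact Real.sin_nonneg_of_nonneg_of_le_pi (by positivity) (by nlinarith)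
      · rw [h, mul_neg, Real.sin_neg, abs_of_nonpos]
        exact Real.sin_nonpos_of_nonpos_of_neg_pi_le (by nlinarith) (by nlinarith)
    rw [this]
    have := Real.mul_le_sin (x := Real.pi*|θ|) (by positivity) (by nlinarith [Real.pi_pos])
    have e : 2/Real.pi*(Real.pi*|θ|) = 2*|θ| := by field_simp
    linarith
  have h5 : ‖ee θ^T - 1‖ ≤ 2 := by
    refine (norm_sub_le _ _).trans ?_; rw [norm_pow, ee_norm]; norm_num
  have h6 : 0 < |θ| := abs_pos.2 h0
  rw [le_div_iff₀ (by positivity)]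
  rw [← h3, norm_mul] at h5
  nlinarith [norm_nonneg (∑ i ∈ Finset.range T, ee θ ^ i)]

theorem block_sq {α β γ A : ℝ} {T L : ℕ} (hA : 0 < A) (hα : A ≤ |α|) (hL : 2*|α| *L ≤ 1/2) :
    ∑ t ∈ Finset.range T, ‖∑ j ∈ Finset.range L, ee (α*(t+j:ℝ)^2+β*(t+j:ℝ)+γ)‖^2 ≤
      T*L + L*√L/A := by
  have hA' : 0 < |α| := by linarith
  have key : ((∑ t ∈ Finset.range T, ‖∑ j ∈ Finset.range L, ee (α*(t+j:ℝ)^2+β*(t+j:ℝ)+γ)‖^2 : ℝ):ℂ)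
      = ∑ j ∈ Finset.range L, ∑ i ∈ Finset.range L, ∑ t ∈ Finset.range T,
        ee (2*α*((j:ℝ)-i)*t + (α*((j:ℝ)^2-i^2)+β*((j:ℝ)-i))) := by
    push_cast
    rw [Finset.sum_comm' (t' := Finset.range L) (s' := fun _ => Finset.range L) (by simp)]
    simp_rw [Finset.sum_comm (s := Finset.range L) (t := Finset.range T)]
    refine Finset.sum_congr rfl fun t _ => ?_
    rw [← Complex.mul_conj', map_sum, Finset.sum_mul_sum]
    rw [Finset.sum_comm]
    refine Finset.sum_congr rfl fun j _ => Finset.sum_congr rfl fun i _ => ?_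
    rw [ee_conj, ← ee_add]; congr 1; ring
  have h1 : ∀ j ∈ Finset.range L, ∀ i ∈ Finset.range L, ‖∑ t ∈ Finset.range T,
        ee (2*α*((j:ℝ)-i)*t + (α*((j:ℝ)^2-i^2)+β*((j:ℝ)-i)))‖ ≤
        (if j = i then (T:ℝ) else 0) + (1/(4*A))*(if ((j:ℤ)-i) = 0 then 0 else 1/√|(((j:ℤ)-i : ℤ):ℝ)|) := by
    intro j hj i hi
    rw [Finset.mem_range] at hj hi
    by_cases h : j = i
    · subst h; simp only [sub_self]; simp [ee]
    · have h' : (j:ℤ)-i ≠ 0 := by omega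
      rw [if_neg h, if_neg h', zero_add]
      have h2 : 1 ≤ |(((j:ℤ)-i : ℤ):ℝ)| := by exact_mod_cast Int.one_le_abs h'
      have h3 : |(((j:ℤ)-i : ℤ):ℝ)| ≤ L := by
        have : |(j:ℤ)-i| ≤ L := by rw [abs_le]; omega
        exact_mod_cast this
      have e : ((j:ℝ)-i) = (((j:ℤ)-i : ℤ):ℝ) := by push_cast; ring
      rw [e]
      generalize (((j:ℤ)-i : ℤ):ℝ) = u at *
      have h4 : |2*α*u| = 2*|α| *|u| := by rw [abs_mul, abs_mul, abs_two]
      refine (geom_le (by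
        have : |2*α*u| ≠ 0 := by rw [h4]; positivity
        exact abs_ne_zero.1 this) (by rw [h4]; refine le_trans ?_ hL; gcongr) T).trans ?_
      rw [h4, one_div_mul_one_div]
      have h5 : √|u| ≤ |u| := Real.sqrt_le_iff.2 ⟨by positivity, by nlinarith⟩
      have h6 : 0 < √|u| := Real.sqrt_pos.2 (by linarith)
      refine one_div_le_one_div_of_le (by positivity) ?_
      calc _ ≤ 4*|α| * |u| := by gcongr
        _ = _ := by ring
  have h2 := congrArg norm key
  rw [Complex.norm_real, Real.norm_of_nonneg (by positivity)] at h2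
  rw [h2]
  refine (norm_sum_le_of_le _ fun j hj => norm_sum_le_of_le _ fun i hi => h1 j hj i hi).trans ?_
  have h3 : ∀ j ∈ Finset.range L, ∑ i ∈ Finset.range L, ((if j = i then (T:ℝ) else 0) +
      (1/(4*A))*(if ((j:ℤ)-i) = 0 then 0 else 1/√|(((j:ℤ)-i : ℤ):ℝ)|)) ≤ T + 1/(4*A)*(4*√L) := by
    intro j hj
    rw [Finset.sum_add_distrib, ← Finset.mul_sum, Finset.sum_ite_eq, if_pos hj]
    gcongr
    have h4 := sum_inv_sqrt L (by positivity) (((Finset.range L).image fun i : ℕ => (j:ℤ)-i).filter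
      (· ≠ 0)) (by
        intro k hk
        simp only [Finset.mem_filter, Finset.mem_image, Finset.mem_range] at hk hj
        obtain ⟨⟨i, hi, rfl⟩, h⟩ := hk
        refine ⟨h, ?_⟩
        have : |(j:ℤ)-i| ≤ L := by rw [abs_le]; omega
        exact_mod_cast this)
    refine le_trans (le_of_eq ?_) h4
    rw [Finset.sum_filter, Finset.sum_image (by intro x _ y _ h; simpa using h)]
    refine Finset.sum_congr rfl fun i _ => ?_
    by_cases h : (j:ℤ)-i = 0 <;> simp [h]
  refine (Finset.sum_le_sum h3).trans ?_
  rw [Finset.sum_const, Finset.card_range, nsmul_eq_mul]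
  apply le_of_eq; field_simp
end BQF
end

section
open Set
namespace BQF
def Adm (R : ℕ) (κ : ℝ) (n : ℕ) (h : ℤ → ℝ) : Prop :=
  (∀ d, 0 ≤ h d ∧ h d ≤ 1) ∧ (∀ d, (R*n:ℤ) < |d| → h d = 0) ∧ ∀ d, |h (d+1) - h d| ≤ κ

theorem char_good (R : ℕ) {c₁ c₂ ε : ℝ} (h1 : 0 < c₁) (hε : 0 < ε) : ∃ κ > 0, ∃ N₀ : ℕ, ∀ n ≥ N₀,
    ∀ h, Adm R κ n h → ∀ α β γ : ℝ, c₁/n ≤ |α| → |α| ≤ c₂/n →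
      ‖∑ d ∈ Finset.Icc (-(R*n:ℤ)) (R*n), (h d:ℂ) * ee (α*d^2+β*d+γ)‖ ≤ ε*n := by
  set R' : ℝ := 2*R+2 with hR'
  have hR0 : 0 < R' := by positivity
  set C := √(R'^2+R'/c₁)
  obtain ⟨m, hm⟩ := exists_nat_gt (2*C/ε)
  have hm0 : 0 < (m:ℝ) := lt_of_le_of_lt (by positivity) hm
  have hm1 : (1:ℝ) ≤ m := by exact_mod_cast (by exact_mod_cast hm0 : 0 < m)
  set L : ℕ := m^4 with hL
  have hLr : (L:ℝ) = m^4 := by rw [hL]; push_cast; ring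
  have hL0 : 0 < (L:ℝ) := by rw [hLr]; positivity
  obtain ⟨N₁, hN₁⟩ := exists_nat_gt (4*c₂*L)
  refine ⟨ε/(2*R'*L), by positivity, max (L+1) (N₁+1), fun n hn h ⟨hh1, hh2, hh3⟩ α β γ ha hb => ?_⟩
  set κ := ε/(2*R'*L) with hκ
  have hn1 : (L:ℝ)+1 ≤ n := by exact_mod_cast (le_max_left _ _).trans hn
  have hn2 : 4*c₂*L < n := hN₁.trans (by exact_mod_cast (le_max_right _ _).trans hn)
  have hn0 : 0 < (n:ℝ) := by linarith
  set T : ℕ := 2*R*n+L+1 with hT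
  have hTr : (T:ℝ) ≤ R'*n := by rw [hT, hR']; push_cast; linarith
  set s : ℤ → ℂ := fun d => ee (α*d^2+β*d+γ) with hs
  set m0 : ℤ := -(R*n)-L with hm0'
  have shift : ∀ j ∈ Finset.range L, ∑ d ∈ Finset.Icc (-(R*n:ℤ)) (R*n), (h d:ℂ) * s d =
      ∑ t ∈ Finset.range T, (h (m0+t+j):ℂ) * s (m0+t+j) := by
    intro j hj
    rw [Finset.mem_range] at hj
    rw [← Finset.sum_image (s := Finset.range T) (g := fun t : ℕ => m0+t+j)
      (f := fun d => (h d:ℂ) * s d) (by intro x _ y _ h; simpa using h)]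
    refine Finset.sum_subset ?_ ?_
    · intro d hd
      rw [Finset.mem_Icc] at hd
      rw [Finset.mem_image]
      refine ⟨(d-m0-j).toNat, ?_, ?_⟩
      · rw [Finset.mem_range, hT]; zify; rw [Int.toNat_of_nonneg (by omega), hm0']
        linarith
      · rw [Int.toNat_of_nonneg (by omega)]; ring
    · intro d _ hd
      rw [Finset.mem_Icc, ← abs_le, not_le] at hd
      rw [hh2 d hd]; simp
  have tel : ∀ d : ℤ, ∀ j : ℕ, |h (d+j) - h d| ≤ κ*j := by
    intro d j
    induction j with
    | zero => simp
    | succ j ih =>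
      have := abs_add_le (h (d+j+1) - h (d+j)) (h (d+j) - h d)
      have h2 := hh3 (d+j)
      push_cast
      rw [← add_assoc]
      calc _ = |(h (d+j+1) - h (d+j)) + (h (d+j) - h d)| := by ring_nf
        _ ≤ _ := by linarith
  have hS2 := block_sq (α := α) (β := 2*α*m0+β) (γ := α*m0^2+β*m0+γ) (T := T) (L := L)
    (A := c₁/n) (by positivity) ha (by
      have : 2*|α| *L ≤ 2*(c₂/n)*L := by gcongr
      refine this.trans ?_
      rw [mul_div_assoc', div_mul_eq_mul_div, div_le_iff₀ hn0]; linarith)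
  set S : ℕ → ℝ := fun t => ‖∑ j ∈ Finset.range L, s (m0+t+j)‖ with hSdef
  have hS3 : ∑ t ∈ Finset.range T, S t^2 ≤ T*L + L*√L/(c₁/n) := by
    refine le_trans (le_of_eq ?_) hS2
    refine Finset.sum_congr rfl fun t _ => ?_
    simp only [hSdef, hs]
    congr 2
    refine Finset.sum_congr rfl fun j _ => ?_
    congr 1; push_cast; ring
  have hS4 : ∑ t ∈ Finset.range T, S t ≤ n*(m^3*C) := by
    refine le_of_sq_le_sq' ?_ (by positivity)
    have := sq_sum_le_card_mul_sum_sq (s := Finset.range T) (f := S)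
    rw [Finset.card_range] at this
    refine this.trans ?_
    have hsq : √(L:ℝ) = m^2 := by rw [hLr, show (m:ℝ)^4 = (m^2)^2 by ring]; exact Real.sqrt_sq (by positivity)
    have hC2 : C^2 = R'^2+R'/c₁ := Real.sq_sqrt (by positivity)
    calc _ ≤ R'*n*(R'*n*L + L*√L/(c₁/n)) := by
          refine mul_le_mul hTr (hS3.trans (by gcongr)) (by positivity) (by positivity)
      _ ≤ R'*n*(R'*n*m^6 + m^6/(c₁/n)) := by
          rw [hsq, hLr]
          have : (m:ℝ)^4 ≤ m^6 := pow_le_pow_right₀ hm1 (by norm_num)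
          rw [show (m:ℝ)^4*m^2 = m^6 by ring]; gcongr
      _ = n^2*m^6*(R'^2+R'/c₁) := by field_simp
      _ = _ := by rw [← hC2]; ring
  have main : (L:ℝ)*‖∑ d ∈ Finset.Icc (-(R*n:ℤ)) (R*n), (h d:ℂ) * s d‖ ≤
      ∑ t ∈ Finset.range T, (S t + L*(κ*L)) := by
    have e : (L:ℂ) * ∑ d ∈ Finset.Icc (-(R*n:ℤ)) (R*n), (h d:ℂ) * s d =
        ∑ t ∈ Finset.range T, ∑ j ∈ Finset.range L, (h (m0+t+j):ℂ) * s (m0+t+j) := by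
      rw [Finset.sum_comm, ← Finset.sum_congr rfl shift, Finset.sum_const, Finset.card_range, nsmul_eq_mul]
    rw [← Complex.norm_natCast L, ← norm_mul, e]
    refine norm_sum_le_of_le _ fun t _ => ?_
    have e2 : ∑ j ∈ Finset.range L, (h (m0+t+j):ℂ) * s (m0+t+j) =
        (h (m0+t):ℂ) * ∑ j ∈ Finset.range L, s (m0+t+j) +
        ∑ j ∈ Finset.range L, ((h (m0+t+j) - h (m0+t) : ℝ):ℂ) * s (m0+t+j) := by
      rw [Finset.mul_sum, ← Finset.sum_add_distrib]
      refine Finset.sum_congr rfl fun j _ => ?_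
      push_cast; ring
    rw [e2]
    refine (norm_add_le _ _).trans (add_le_add ?_ ?_)
    · rw [norm_mul, Complex.norm_real, Real.norm_of_nonneg (hh1 _).1]
      exact mul_le_of_le_one_left (norm_nonneg _) (hh1 _).2
    · rw [Complex.norm_natCast]
      refine (norm_sum_le_of_le (f := _) (n := fun _ => κ*L) _ fun j hj => ?_).trans (by simp)
      rw [norm_mul, ee_norm, mul_one, Complex.norm_real]
      refine (tel _ _).trans ?_
      rw [Finset.mem_range] at hj
      gcongr
  rw [Finset.sum_add_distrib, Finset.sum_const, Finset.card_range, nsmul_eq_mul] at main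
  have h7 : (L:ℝ)*‖∑ d ∈ Finset.Icc (-(R*n:ℤ)) (R*n), (h d:ℂ) * s d‖ ≤ L*(ε*n) := by
    calc _ ≤ _ := main
      _ ≤ n*(m^3*C) + R'*n*(L*(κ*L)) := by gcongr
      _ ≤ n*(m^3*(m*ε/2)) + R'*n*(L*(κ*L)) := by
          gcongr
          rw [div_lt_iff₀ hε] at hm; linarith
      _ = _ := by rw [hκ, hLr]; field_simp; ring
  exact le_of_mul_le_mul_left h7 hL0
end BQF
end

section
open Set
namespace BQF
noncomputable def cInt (F : C(AddCircle (1:ℝ), ℂ)) : ℂ := ∫ x in (0:ℝ)..1, F (x : AddCircle (1:ℝ))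
theorem cInt_int (F : C(AddCircle (1:ℝ), ℂ)) : IntervalIntegrable (fun x : ℝ => F (x : AddCircle (1:ℝ)))
    MeasureTheory.volume 0 1 :=
  (F.continuous.comp (AddCircle.continuous_mk' 1)).intervalIntegrable _ _

def Good (R : ℕ) (c₁ c₂ : ℝ) (F : C(AddCircle (1:ℝ), ℂ)) : Prop :=
  ∀ ε > 0, ∃ κ > 0, ∃ N₀ : ℕ, ∀ n ≥ N₀,
    ∀ h, Adm R κ n h → ∀ α β γ : ℝ, c₁/n ≤ |α| → |α| ≤ c₂/n →
      ‖∑ d ∈ Finset.Icc (-(R*n:ℤ)) (R*n), (h d:ℂ) *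
        (F ((α*d^2+β*d+γ : ℝ) : AddCircle (1:ℝ)) - cInt F)‖ ≤ ε*n

theorem Adm.mono {R : ℕ} {κ κ' : ℝ} {n : ℕ} {h : ℤ → ℝ} (H : Adm R κ n h) (hk : κ ≤ κ') : Adm R κ' n h :=
  ⟨H.1, H.2.1, fun d => (H.2.2 d).trans hk⟩

theorem good_four (R : ℕ) {c₁ c₂ : ℝ} (h1 : 0 < c₁) (k : ℤ) : Good R c₁ c₂ (fourier k) := by
  intro ε hε
  by_cases hk : k = 0
  · subst hk
    refine ⟨1, one_pos, 0, fun n _ h _ α β γ _ _ => ?_⟩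
    have : cInt (fourier 0) = 1 := by simp [cInt]
    simp [this]; positivity
  have h0 : cInt (fourier k) = 0 := by
    have := congrFun (fourierCoeff_fourier (T := (1:ℝ)) k) 0
    rw [Pi.single_apply, if_neg (Ne.symm hk), fourierCoeff_eq_intervalIntegral _ _ 0] at this
    simpa [cInt] using this
  have hk' : 0 < |(k:ℝ)| := abs_pos.2 (by exact_mod_cast hk)
  obtain ⟨κ, hκ, N₀, H⟩ := char_good R (c₁ := |(k:ℝ)| *c₁) (c₂ := |(k:ℝ)| *c₂) (by positivity) hε
  refine ⟨κ, hκ, N₀, fun n hn h hh α β γ ha hb => ?_⟩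
  have := H n hn h hh (k*α) (k*β) (k*γ) (by rw [abs_mul, mul_div_assoc]; gcongr)
    (by rw [abs_mul, mul_div_assoc]; gcongr)
  refine le_trans (le_of_eq ?_) this
  congr 1
  refine Finset.sum_congr rfl fun d _ => ?_
  rw [h0, sub_zero, fourier_coe_apply, ee]
  congr 2; push_cast; ring

theorem hsum_le {R : ℕ} {κ : ℝ} {n : ℕ} {h : ℤ → ℝ} (H : Adm R κ n h) :
    ∑ d ∈ Finset.Icc (-(R*n:ℤ)) (R*n), h d ≤ (2*R*n+1) := by
  refine (Finset.sum_le_sum fun d _ => (H.1 d).2).trans ?_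
  rw [Finset.sum_const, Int.card_Icc, nsmul_eq_mul, mul_one]
  apply le_of_eq
  have : (((R*n:ℤ) + 1 - -(R*n:ℤ)).toNat : ℤ) = 2*R*n+1 := by
    have : (0:ℤ) ≤ R*n := by positivity
    rw [Int.toNat_of_nonneg (by linarith)]; ring
  exact_mod_cast this

theorem good_all (R : ℕ) {c₁ c₂ : ℝ} (h1 : 0 < c₁) (F : C(AddCircle (1:ℝ), ℂ)) : Good R c₁ c₂ F := by
  have hsp : ∀ P ∈ Submodule.span ℂ (range (@fourier (1:ℝ))), Good R c₁ c₂ P := by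
    intro P hP
    induction hP using Submodule.span_induction with
    | mem x hx => obtain ⟨k, rfl⟩ := hx; exact good_four R h1 k
    | zero =>
      intro ε hε
      refine ⟨1, one_pos, 0, fun n _ h _ α β γ _ _ => ?_⟩
      have : cInt 0 = 0 := by simp [cInt]
      simp [this]; positivity
    | add P Q _ _ hP hQ =>
      intro ε hε
      obtain ⟨κ, hκ, N, H⟩ := hP (ε/2) (by positivity)
      obtain ⟨κ', hκ', N', H'⟩ := hQ (ε/2) (by positivity)
      refine ⟨min κ κ', lt_min hκ hκ', max N N', fun n hn h hh α β γ ha hb => ?_⟩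
      have a1 := H n ((le_max_left _ _).trans hn) h (hh.mono (min_le_left _ _)) α β γ ha hb
      have a2 := H' n ((le_max_right _ _).trans hn) h (hh.mono (min_le_right _ _)) α β γ ha hb
      have e : cInt (P+Q) = cInt P + cInt Q := by
        simp only [cInt, ContinuousMap.add_apply]
        exact intervalIntegral.integral_add (cInt_int P) (cInt_int Q)
      refine le_trans (le_of_eq ?_) ((norm_add_le _ _).trans ((add_le_add a1 a2).trans (by linarith)))
      rw [← Finset.sum_add_distrib]; congr 1
      refine Finset.sum_congr rfl fun d _ => ?_
      rw [e, ContinuousMap.add_apply]; ring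
    | smul c P _ hP =>
      intro ε hε
      obtain ⟨κ, hκ, N, H⟩ := hP (ε/(‖c‖+1)) (by positivity)
      refine ⟨κ, hκ, N, fun n hn h hh α β γ ha hb => ?_⟩
      have a1 := H n hn h hh α β γ ha hb
      have e : cInt (c•P) = c * cInt P := by
        simp only [cInt, ContinuousMap.smul_apply, smul_eq_mul]
        exact intervalIntegral.integral_const_mul _ _
      calc _ = ‖c‖ * ‖∑ d ∈ Finset.Icc (-(R*n:ℤ)) (R*n), (h d:ℂ) *
            (P ((α*d^2+β*d+γ : ℝ) : AddCircle (1:ℝ)) - cInt P)‖ := by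
            rw [← norm_mul, Finset.mul_sum]; congr 1
            refine Finset.sum_congr rfl fun d _ => ?_
            rw [e, ContinuousMap.smul_apply, smul_eq_mul]; ring
        _ ≤ ‖c‖*(ε/(‖c‖+1)*n) := by gcongr
        _ = (‖c‖/(‖c‖+1))*(ε*n) := by ring
        _ ≤ 1*(ε*n) := by
          gcongr; rw [div_le_one (by positivity)]; linarith
        _ = _ := one_mul _
  intro ε hε
  have hF : F ∈ (Submodule.span ℂ (range (@fourier (1:ℝ)))).topologicalClosure := by
    rw [span_fourier_closure_eq_top]; trivial
  set δ := ε/(4*(2*R+1)) with hδ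
  have hδ0 : 0 < δ := by positivity
  obtain ⟨P, hP, hd⟩ := Metric.mem_closure_iff.1 hF δ hδ0
  obtain ⟨κ, hκ, N, H⟩ := hsp P hP (ε/2) (by positivity)
  refine ⟨κ, hκ, max N 1, fun n hn h hh α β γ ha hb => ?_⟩
  have a1 := H n ((le_max_left _ _).trans hn) h hh α β γ ha hb
  have hn1 : (1:ℝ) ≤ n := by exact_mod_cast (le_max_right _ _).trans hn
  have d1 : ∀ x, ‖F x - P x‖ ≤ δ := fun x => by
    rw [← dist_eq_norm]; exact (ContinuousMap.dist_apply_le_dist x).trans hd.le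
  have d2 : ‖cInt F - cInt P‖ ≤ δ := by
    rw [cInt, cInt, ← intervalIntegral.integral_sub (cInt_int F) (cInt_int P)]
    refine (intervalIntegral.norm_integral_le_of_norm_le_const (C := δ) fun x _ => d1 _).trans ?_
    simp
  have e : ∑ d ∈ Finset.Icc (-(R*n:ℤ)) (R*n), (h d:ℂ) *
        (F ((α*d^2+β*d+γ : ℝ) : AddCircle (1:ℝ)) - cInt F) =
      ∑ d ∈ Finset.Icc (-(R*n:ℤ)) (R*n), (h d:ℂ) *
        (P ((α*d^2+β*d+γ : ℝ) : AddCircle (1:ℝ)) - cInt P) +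
      ∑ d ∈ Finset.Icc (-(R*n:ℤ)) (R*n), (h d:ℂ) *
        ((F ((α*d^2+β*d+γ : ℝ) : AddCircle (1:ℝ)) - P ((α*d^2+β*d+γ : ℝ) : AddCircle (1:ℝ)))
          - (cInt F - cInt P)) := by
    rw [← Finset.sum_add_distrib]
    refine Finset.sum_congr rfl fun d _ => ?_
    ring
  rw [e]
  refine (norm_add_le _ _).trans ?_
  have a2 : ‖∑ d ∈ Finset.Icc (-(R*n:ℤ)) (R*n), (h d:ℂ) *
        ((F ((α*d^2+β*d+γ : ℝ) : AddCircle (1:ℝ)) - P ((α*d^2+β*d+γ : ℝ) : AddCircle (1:ℝ)))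
          - (cInt F - cInt P))‖ ≤ ∑ d ∈ Finset.Icc (-(R*n:ℤ)) (R*n), h d * (2*δ) := by
    refine norm_sum_le_of_le _ fun d _ => ?_
    rw [norm_mul, Complex.norm_real, Real.norm_of_nonneg (hh.1 d).1]
    refine mul_le_mul_of_nonneg_left ((norm_sub_le _ _).trans ?_) (hh.1 d).1
    linarith [d1 ((α*d^2+β*d+γ : ℝ) : AddCircle (1:ℝ))]
  rw [← Finset.sum_mul] at a2
  have a3 := hsum_le hh
  calc _ ≤ ε/2*n + (2*R*n+1)*(2*δ) := add_le_add a1 (a2.trans (by gcongr))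
    _ ≤ ε/2*n + (2*R*n+n)*(2*δ) := by gcongr
    _ = _ := by rw [hδ]; field_simp; ring

theorem fract_up (R : ℕ) {c₁ c₂ ε : ℝ} (h1 : 0 < c₁) (hε : 0 < ε) : ∃ κ > 0, ∃ N₀ : ℕ, ∀ n ≥ N₀,
    ∀ h, Adm R κ n h → ∀ α β γ : ℝ, c₁/n ≤ |α| → |α| ≤ c₂/n →
      ∑ d ∈ Finset.Icc (-(R*n:ℤ)) (R*n), h d * ((if Int.fract (α*d^2+β*d+γ) = 0 then 1 else
        Int.fract (α*d^2+β*d+γ)) - 1/2) ≤ ε*n := by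
  set δ := min (1/2) (ε/(2*(2*R+1))) with hδ
  have hδ0 : 0 < δ := by positivity
  set f : ℝ → ℝ := fun x => max x (1-x/δ) with hf
  have f0 : f 0 = 1 := by simp [hf]
  have f1 : f 1 = 1 := by
    simp only [hf]; refine max_eq_left ?_
    have : 0 ≤ 1/δ := by positivity
    linarith
  set F : C(AddCircle (1:ℝ), ℂ) := ⟨AddCircle.liftIco 1 0 (fun x => (f x:ℂ)),
    AddCircle.liftIco_zero_continuous (by rw [f0, f1]) (by fun_prop)⟩ with hF
  have Fx : ∀ x : ℝ, F (x : AddCircle (1:ℝ)) = f (Int.fract x) := by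
    intro x
    have : (x : AddCircle (1:ℝ)) = ((Int.fract x : ℝ) : AddCircle (1:ℝ)) := by
      rw [← sub_eq_zero, ← AddCircle.coe_sub, AddCircle.coe_eq_zero_iff]
      exact ⟨⌊x⌋, by simp⟩
    rw [this]
    have h2 : Int.fract x ∈ Ico (0:ℝ) 1 := ⟨Int.fract_nonneg x, Int.fract_lt_one x⟩
    exact AddCircle.liftIco_zero_coe_apply (p := (1:ℝ)) (f := fun x => (f x:ℂ)) h2
  have hfc : Continuous f := by fun_prop
  have hI : cInt F = ((∫ x in (0:ℝ)..1, f x : ℝ) : ℂ) := by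
    rw [cInt, ← intervalIntegral.integral_ofReal]
    refine intervalIntegral.integral_congr fun x hx => ?_
    rw [uIcc_of_le zero_le_one] at hx
    simp only [Fx]
    congr 1
    rcases hx.2.lt_or_eq with h | rfl
    · rw [Int.fract_eq_self.2 ⟨hx.1, h⟩]
    · rw [Int.fract_one, f0, f1]
  have hδ2 : δ ≤ 1/2 := min_le_left _ _
  have hr : ∫ x in (0:ℝ)..1, f x ≤ 1/2+δ := by
    rw [← intervalIntegral.integral_add_adjacent_intervals (b := δ) (hfc.intervalIntegrable _ _)
      (hfc.intervalIntegrable _ _)]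
    have i1 : ∫ x in (0:ℝ)..δ, f x ≤ ∫ x in (0:ℝ)..δ, (1:ℝ) := by
      refine intervalIntegral.integral_mono_on hδ0.le (hfc.intervalIntegrable _ _) (by simp) fun x hx => ?_
      refine max_le (by linarith [hx.2]) ?_
      have : 0 ≤ x/δ := div_nonneg hx.1 hδ0.le
      linarith
    have i2 : ∫ x in δ..1, f x ≤ ∫ x in δ..1, x := by
      refine intervalIntegral.integral_mono_on (by linarith) (hfc.intervalIntegrable _ _) (by simp) fun x hx => ?_
      refine max_le le_rfl ?_
      have : 1 ≤ x/δ := by rw [one_le_div hδ0]; exact hx.1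
      linarith [hx.1]
    rw [integral_id] at i2
    simp at i1
    nlinarith [sq_nonneg δ]
  set r := ∫ x in (0:ℝ)..1, f x
  obtain ⟨κ, hκ, N, H⟩ := good_all R (c₂ := c₂) h1 F (ε/2) (by positivity)
  refine ⟨κ, hκ, max N 1, fun n hn h hh α β γ ha hb => ?_⟩
  have a1 := H n ((le_max_left _ _).trans hn) h hh α β γ ha hb
  have hn1 : (1:ℝ) ≤ n := by exact_mod_cast (le_max_right _ _).trans hn
  simp_rw [Fx, hI] at a1
  have a2 : ∑ d ∈ Finset.Icc (-(R*n:ℤ)) (R*n), h d * (f (Int.fract (α*d^2+β*d+γ)) - r) ≤ ε/2*n := by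
    refine le_trans (le_abs_self _) (le_trans (le_of_eq ?_) a1)
    rw [← Real.norm_eq_abs, ← Complex.norm_real]; push_cast; rfl
  have a3 := hsum_le hh
  calc _ ≤ ∑ d ∈ Finset.Icc (-(R*n:ℤ)) (R*n), (h d * (f (Int.fract (α*d^2+β*d+γ)) - r) + h d * δ) := by
        refine Finset.sum_le_sum fun d _ => ?_
        rw [← mul_add]
        refine mul_le_mul_of_nonneg_left ?_ (hh.1 d).1
        have : (if Int.fract (α*d^2+β*d+γ) = 0 then 1 else Int.fract (α*d^2+β*d+γ)) ≤
            f (Int.fract (α*d^2+β*d+γ)) := by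
          split_ifs with h
          · rw [h, f0]
          · exact le_max_left _ _
        linarith
    _ ≤ ε/2*n + (2*R*n+1)*δ := by
        rw [Finset.sum_add_distrib, ← Finset.sum_mul]; gcongr
    _ ≤ ε/2*n + (2*R*n+n)*(ε/(2*(2*R+1))) := by gcongr; exact min_le_right _ _
    _ = _ := by field_simp; ring

/-- sawtooth equidistribution -/
theorem fract_good (R : ℕ) {c₁ c₂ ε : ℝ} (h1 : 0 < c₁) (hε : 0 < ε) : ∃ κ > 0, ∃ N₀ : ℕ, ∀ n ≥ N₀,
    ∀ h, Adm R κ n h → ∀ α β γ : ℝ, c₁/n ≤ |α| → |α| ≤ c₂/n →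
      |∑ d ∈ Finset.Icc (-(R*n:ℤ)) (R*n), h d * (Int.fract (α*d^2+β*d+γ) - 1/2)| ≤ ε*n := by
  obtain ⟨κ, hκ, N, H⟩ := fract_up R (c₂ := c₂) h1 hε
  refine ⟨κ, hκ, N, fun n hn h hh α β γ ha hb => abs_le.2 ⟨?_, ?_⟩⟩
  · have := H n hn h hh (-α) (-β) (-γ) (by rwa [abs_neg]) (by rwa [abs_neg])
    rw [neg_le, ← Finset.sum_neg_distrib]
    refine le_trans (Finset.sum_le_sum fun d _ => ?_) this
    rw [← mul_neg]
    refine mul_le_mul_of_nonneg_left ?_ (hh.1 d).1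
    rw [show -α*d^2+ -β*d+ -γ = -(α*d^2+β*d+γ) by ring]
    generalize α*d^2+β*d+γ = x
    by_cases hx : Int.fract x = 0
    · rw [if_pos (Int.fract_neg_eq_zero.2 hx), hx]; norm_num
    · rw [if_neg (fun h => hx (Int.fract_neg_eq_zero.1 h)), Int.fract_neg hx]; linarith
  · refine le_trans (Finset.sum_le_sum fun d _ => ?_) (H n hn h hh α β γ ha hb)
    refine mul_le_mul_of_nonneg_left ?_ (hh.1 d).1
    split_ifs with h
    · rw [h]; norm_num
    · exact le_rfl
end BQF
end

section
open Set MeasureTheory Filter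
open scoped Pointwise
namespace BQF
abbrev E4 := Fin 4 → ℝ
noncomputable def vc (n : ℕ) (a b c d : ℤ) : E4 := ![a/n, b/n, c/n, d/n]
noncomputable def Hr (x : E4) : ℝ := 8*x 0*x 2 - 3*x 1^2
noncomputable abbrev QQ (R n : ℕ) : Finset ℤ := Finset.Icc (-(R*n:ℤ)) (R*n)
noncomputable def sum4 (Q : Finset ℤ) (F : ℤ → ℤ → ℤ → ℤ → ℝ) : ℝ := ∑ a ∈ Q, ∑ b ∈ Q, ∑ c ∈ Q, ∑ d ∈ Q, F a b c d

theorem riemann4 {F : E4 → ℝ} (hF : Continuous F) (R : ℕ) (hR : ∀ x, F x ≠ 0 → ∀ i, |x i| ≤ R) :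
    Tendsto (fun n : ℕ => sum4 (QQ R n) (fun a b c d => F (vc n a b c d)) / n^4) atTop
      (nhds (∫ x, F x)) := by
  set s : Set E4 := Set.pi univ fun _ => Icc (-(R:ℝ)) R with hs
  have hsc : Convex ℝ s := convex_pi fun _ _ => convex_Icc _ _
  have hsK : IsCompact s := isCompact_univ_pi fun _ => isCompact_Icc
  have h := tendsto_tsum_div_pow_atTop_integral s F hF hsK.isBounded hsK.measurableSet
    (hsc.addHaar_frontier volume)
  rw [setIntegral_eq_integral_of_forall_compl_eq_zero (s := s)] at h
  swap
  · intro x hx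
    by_contra h0
    exact hx fun i _ => abs_le.1 (hR x h0 i)
  refine h.congr' ?_
  filter_upwards [eventually_ge_atTop 1] with n hn
  have hn0 : (0:ℝ) < n := by exact_mod_cast hn
  simp only [Fintype.card_fin]
  congr 1
  set G : Finset E4 := ((QQ R n) ×ˢ (QQ R n) ×ˢ (QQ R n) ×ˢ (QQ R n)).image
    (fun q => vc n q.1 q.2.1 q.2.2.1 q.2.2.2) with hG
  have hmemQ : ∀ z : ℤ, z ∈ QQ R n ↔ |(z:ℝ)/n| ≤ R := by
    intro z
    rw [Finset.mem_Icc, ← abs_le, abs_div, abs_of_pos hn0, div_le_iff₀ hn0]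
    exact_mod_cast Iff.rfl
  have hS : s ∩ (n:ℝ)⁻¹ • (Submodule.span ℤ (range (Pi.basisFun ℝ (Fin 4))) : Set E4) = ↑G := by
    ext x
    simp only [hG, Finset.coe_image, mem_inter_iff, mem_image, Finset.mem_coe, Finset.mem_product]
    rw [Set.mem_inv_smul_set_iff₀ hn0.ne', SetLike.mem_coe, Module.Basis.mem_span_iff_repr_mem]
    simp only [Pi.basisFun_repr, Pi.smul_apply, smul_eq_mul, algebraMap_int_eq, eq_intCast, mem_range,
      hs, Set.mem_pi, mem_univ, true_implies]
    constructor
    · rintro ⟨h1, h2⟩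
      choose z hz using h2
      have hx : ∀ i, x i = (z i:ℝ)/n := fun i => by rw [hz]; field_simp
      have hQ : ∀ i, z i ∈ QQ R n := fun i => by rw [hmemQ, ← hx]; exact abs_le.2 (h1 i)
      refine ⟨(z 0, z 1, z 2, z 3), ⟨hQ 0, hQ 1, hQ 2, hQ 3⟩, ?_⟩
      ext i; fin_cases i <;> simp [vc, hx]
    · rintro ⟨⟨a, b, c, d⟩, ⟨h1, h2, h3, h4⟩, rfl⟩
      rw [hmemQ] at h1 h2 h3 h4
      constructor
      · intro i; rw [mem_Icc, ← abs_le]; fin_cases i <;> simpa [vc]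
      · intro i; fin_cases i
        · exact ⟨a, by simp [vc]; field_simp⟩
        · exact ⟨b, by simp [vc]; field_simp⟩
        · exact ⟨c, by simp [vc]; field_simp⟩
        · exact ⟨d, by simp [vc]; field_simp⟩
  rw [hS, Finset.tsum_subtype' G F, hG, Finset.sum_image]
  · simp only [Finset.sum_product, sum4]
  · rintro ⟨a, b, c, d⟩ _ ⟨a', b', c', d'⟩ _ h
    have h0 := congrFun h 0; have h1 := congrFun h 1; have h2 := congrFun h 2; have h3 := congrFun h 3
    simp [vc, div_left_inj' hn0.ne'] at h0 h1 h2 h3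
    simp [*]
end BQF
end

section
open Set MeasureTheory Filter
namespace BQF
noncomputable def cntE (n : ℕ) (a b c d : ℤ) : ℕ := {e : ℤ | |((J ⟨a,b,c,d,e⟩ : ℤ):ℝ)| < n^2}.ncard

theorem cntE_eq {n : ℕ} (hn : 1 ≤ n) (a b c d : ℤ) {H g w : ℝ} (hH : H = 8*a*c-3*b^2) (h0 : H ≠ 0)
    (hg : g = (27*a*d^2-9*b*c*d+2*c^3)/(9*H)) (hw : w = n^2/(9*|H|)) :
    {e : ℤ | |((J ⟨a,b,c,d,e⟩ : ℤ):ℝ)| < n^2} = ↑(Finset.Ioo ⌊g-w⌋ ⌈g+w⌉) ∧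
    (cntE n a b c d : ℝ) = 2*w + (Int.fract (-g-w) - 1/2) + (Int.fract (g-w) - 1/2) := by
  have hn0 : (0:ℝ) < n := by exact_mod_cast hn
  have hw0 : 0 < w := by rw [hw]; positivity
  have e1 : {e : ℤ | |((J ⟨a,b,c,d,e⟩ : ℤ):ℝ)| < n^2} = ↑(Finset.Ioo ⌊g-w⌋ ⌈g+w⌉) := by
    ext e
    rw [mem_ofPred_eq, Finset.coe_Ioo, mem_Ioo, Int.floor_lt, Int.lt_ceil, sub_lt_comm, ← sub_lt_iff_lt_add']
    have : ((J ⟨a,b,c,d,e⟩ : ℤ):ℝ) = 9*H*(e-g) := by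
      rw [hg]; simp only [J]; push_cast; field_simp; rw [hH]; ring
    rw [this, abs_mul, abs_mul, abs_of_pos (by norm_num : (0:ℝ) < 9), ← lt_div_iff₀' (by positivity), ← hw,
      abs_lt, neg_lt, neg_sub]
  refine ⟨e1, ?_⟩
  rw [cntE, e1, ncard_coe_finset, Int.card_Ioo]
  have h2 : ⌊g-w⌋ < ⌈g+w⌉ := by
    rw [Int.floor_lt]; exact lt_of_lt_of_le (by linarith) (Int.le_ceil _)
  have h3 : ((⌈g+w⌉-⌊g-w⌋-1).toNat : ℤ) = ⌈g+w⌉-⌊g-w⌋-1 := Int.toNat_of_nonneg (by omega)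
  have h4 : (((⌈g+w⌉-⌊g-w⌋-1).toNat : ℕ):ℝ) = ⌈g+w⌉-⌊g-w⌋-1 := by exact_mod_cast h3
  have h5 : ⌈g+w⌉ = -⌊-g-w⌋ := by rw [← neg_neg (g+w), Int.ceil_neg]; congr 2; ring
  rw [h4, h5, ← Int.self_sub_floor, ← Int.self_sub_floor]; push_cast; ring

theorem weyl4 {φ : E4 → ℝ} (hc : Continuous φ) (hK : HasCompactSupport φ)
    (hs : ∀ x ∈ tsupport φ, x 0 ≠ 0 ∧ Hr x ≠ 0) (h01 : ∀ x, 0 ≤ φ x ∧ φ x ≤ 1) :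
    ∃ R : ℕ, (∀ x, φ x ≠ 0 → ∀ i, |x i| ≤ R) ∧
    Tendsto (fun n : ℕ => sum4 (QQ R n) (fun a b c d => φ (vc n a b c d) * cntE n a b c d) / n^4) atTop
      (nhds (∫ x, φ x * (2/(9*|Hr x|)))) := by
  have hHc : Continuous Hr := by unfold Hr; fun_prop
  obtain ⟨R₀, hR₀⟩ := hK.isCompact.isBounded.exists_norm_le
  obtain ⟨R, hR1⟩ := exists_nat_gt (max R₀ 1)
  have hRx : ∀ x ∈ tsupport φ, ∀ i, |x i| ≤ R := fun x hx i =>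
    (norm_le_pi_norm x i).trans ((hR₀ x hx).trans ((le_max_left _ _).trans hR1.le))
  have hR : ∀ x, φ x ≠ 0 → ∀ i, |x i| ≤ R := fun x hx => hRx x (subset_tsupport _ hx)
  have hR1' : (1:ℝ) ≤ R := (le_max_right _ _).trans hR1.le
  refine ⟨R, hR, ?_⟩
  set ψ : E4 → ℝ := fun x => φ x * (2/(9*|Hr x|)) with hψ
  have hψc : Continuous ψ := by
    refine continuous_of_tsupport fun x hx => ?_
    have hx' : x ∈ tsupport φ := closure_mono (by
      intro y hy; simp only [hψ, Function.mem_support] at hy ⊢; exact left_ne_zero_of_mul hy) hx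
    refine hc.continuousAt.mul (continuousAt_const.div (by fun_prop) ?_)
    have := (hs x hx').2
    positivity
  have T1 := riemann4 hψc R (fun x hx => hR x (left_ne_zero_of_mul hx))
  -- lower bounds
  obtain ⟨η, hη, hηx⟩ : ∃ η > 0, ∀ x ∈ tsupport φ, η ≤ |x 0| ∧ η ≤ |Hr x| := by
    rcases (tsupport φ).eq_empty_or_nonempty with h | h
    · exact ⟨1, one_pos, by simp [h]⟩
    · obtain ⟨x₁, h₁, m₁⟩ := hK.isCompact.exists_isMinOn h (f := fun x => min |x 0| |Hr x|)
        (by fun_prop)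
      refine ⟨min |x₁ 0| |Hr x₁|, lt_min (abs_pos.2 (hs _ h₁).1) (abs_pos.2 (hs _ h₁).2), fun x hx => ?_⟩
      exact le_min_iff.1 (m₁ hx)
  have hu := hK.uniformContinuous_of_continuous hc
  suffices h : Tendsto (fun n : ℕ => (sum4 (QQ R n) (fun a b c d => φ (vc n a b c d) * cntE n a b c d) / n^4 -
      sum4 (QQ R n) (fun a b c d => ψ (vc n a b c d)) / n^4)) atTop (nhds 0) by
    simpa using h.add T1
  rw [Metric.tendsto_atTop]
  intro ε hε
  set ε₁ := ε/(4*(3*R)^3) with hε₁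
  obtain ⟨κ, hκ, N, H⟩ := fract_good R (c₁ := 3*η/(11*R^2)) (c₂ := 3*R/η) (ε := ε₁) (by positivity)
    (by positivity)
  obtain ⟨δ, hδ, hδu⟩ := Metric.uniformContinuous_iff.1 hu κ hκ
  obtain ⟨N₂, hN₂⟩ := exists_nat_gt (1/δ)
  refine ⟨max (max N N₂) 1, fun n hn => ?_⟩
  have hn1 : 1 ≤ n := (le_max_right _ _).trans hn
  have hn0 : (0:ℝ) < n := by exact_mod_cast hn1
  have hn1' : (1:ℝ) ≤ n := by exact_mod_cast hn1
  have hnN : N ≤ n := (le_max_left _ _).trans ((le_max_left _ _).trans hn)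
  have hnN2 : (N₂:ℝ) ≤ n := by exact_mod_cast (le_max_right _ _).trans ((le_max_left _ _).trans hn)
  have inner : ∀ a b c : ℤ, |∑ d ∈ QQ R n, (φ (vc n a b c d) * cntE n a b c d - ψ (vc n a b c d))| ≤ 2*ε₁*n := by
    intro a b c
    by_cases hall : ∀ d, φ (vc n a b c d) = 0
    · simp only [hψ, hall]; simp; positivity
    push Not at hall
    obtain ⟨d₀, hd₀⟩ := hall
    have hts := subset_tsupport _ (Function.mem_support.2 hd₀ : vc n a b c d₀ ∈ Function.support φ)
    obtain ⟨e1, e2⟩ := hηx _ hts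
    have r0 := hRx _ hts 0
    have r1 := hRx _ hts 1
    have r2 := hRx _ hts 2
    set Hk : ℝ := 8*a*c-3*b^2 with hHk
    have hHr : ∀ d, Hr (vc n a b c d) = Hk/n^2 := by
      intro d; simp [Hr, vc, hHk]; field_simp
    rw [hHr, abs_div, abs_of_pos (by positivity : (0:ℝ) < n^2), le_div_iff₀ (by positivity)] at e2
    have v0 : vc n a b c d₀ 0 = a/n := by simp [vc]
    have v1 : vc n a b c d₀ 1 = b/n := by simp [vc]
    have v2 : vc n a b c d₀ 2 = c/n := by simp [vc]
    rw [v0, abs_div, abs_of_pos hn0] at r0 e1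
    rw [v1, abs_div, abs_of_pos hn0, div_le_iff₀ hn0] at r1
    rw [v2, abs_div, abs_of_pos hn0, div_le_iff₀ hn0] at r2
    rw [div_le_iff₀ hn0] at r0
    rw [le_div_iff₀ hn0] at e1
    have hHpos : 0 < |Hk| := lt_of_lt_of_le (by positivity) e2
    have hH0 : Hk ≠ 0 := abs_pos.1 hHpos
    have hHup : |Hk| ≤ 11*R^2*n^2 := by
      calc |Hk| ≤ |8*(a:ℝ)*c| + |3*(b:ℝ)^2| := abs_sub _ _
        _ = 8*(|(a:ℝ)| * |(c:ℝ)|) + 3*|(b:ℝ)|^2 := by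
          rw [abs_mul, abs_mul, abs_mul, abs_pow, abs_of_pos (by norm_num : (0:ℝ)<8),
            abs_of_pos (by norm_num : (0:ℝ)<3)]; ring
        _ ≤ 8*((R*n)*(R*n)) + 3*(R*n)^2 := by gcongr
        _ = _ := by ring
    set α := 3*(a:ℝ)/Hk with hα
    have hα1 : 3*η/(11*R^2)/n ≤ |α| := by
      rw [hα, abs_div, abs_mul, abs_of_pos (by norm_num : (0:ℝ)<3), div_div, div_le_div_iff₀ (by positivity) hHpos]
      calc 3*η*|Hk| ≤ 3*η*(11*R^2*n^2) := by gcongr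
        _ = 3*(η*n)*(11*R^2*n) := by ring
        _ ≤ _ := by gcongr
    have hα2 : |α| ≤ 3*R/η/n := by
      rw [hα, abs_div, abs_mul, abs_of_pos (by norm_num : (0:ℝ)<3), div_div, div_le_div_iff₀ hHpos (by positivity)]
      calc 3*|(a:ℝ)| *(η*n) ≤ 3*(R*n)*(η*n) := by gcongr
        _ = 3*R*(η*n^2) := by ring
        _ ≤ _ := by gcongr
    have hadm : Adm R κ n (fun d => φ (vc n a b c d)) := by
      refine ⟨fun d => h01 _, fun d hd => ?_, fun d => ?_⟩
      · by_contra h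
        have := hR _ h 3
        simp only [vc, Matrix.cons_val] at this
        rw [abs_div, abs_of_pos hn0, div_le_iff₀ hn0] at this
        have h' : |d| ≤ R*n := by exact_mod_cast this
        omega
      · rw [← Real.dist_eq]
        refine (hδu ?_).le
        rw [dist_pi_lt_iff hδ]
        have h1n : (1:ℝ)/n < δ := by
          rw [div_lt_iff₀ hn0, ← div_lt_iff₀' hδ]; linarith
        intro i; fin_cases i <;> simp [vc, hδ]
        rw [Real.dist_eq, ← sub_div, add_sub_cancel_left, abs_of_pos (by positivity)]
        exact h1n
    set w : ℝ := n^2/(9*|Hk|) with hw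
    set β := -(b:ℝ)*c/Hk with hβ
    set γ := 2*(c:ℝ)^3/(9*Hk) with hγ
    have b1 := H n hnN _ hadm (-α) (-β) (-γ-w) (by rwa [abs_neg]) (by rwa [abs_neg])
    have b2 := H n hnN _ hadm α β (γ-w) hα1 hα2
    have : ∑ d ∈ QQ R n, (φ (vc n a b c d) * cntE n a b c d - ψ (vc n a b c d)) =
      ∑ d ∈ QQ R n, φ (vc n a b c d) * (Int.fract (-α*d^2+ -β*d+(-γ-w)) - 1/2) +
      ∑ d ∈ QQ R n, φ (vc n a b c d) * (Int.fract (α*d^2+β*d+(γ-w)) - 1/2) := by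
      rw [← Finset.sum_add_distrib]
      refine Finset.sum_congr rfl fun d _ => ?_
      have g1 : α*d^2+β*d+γ = (27*a*d^2-9*b*c*d+2*c^3)/(9*Hk) := by
        rw [hα, hβ, hγ]; field_simp; ring
      rw [(cntE_eq hn1 a b c d hHk hH0 g1 hw).2]
      simp only [hψ, hHr]
      have : 2/(9*|Hk/n^2|) = 2*w := by
        rw [abs_div, abs_of_pos (by positivity : (0:ℝ) < n^2), hw]; field_simp
      rw [this, show -(α*d^2+β*d+γ)-w = -α*d^2+ -β*d+(-γ-w) by ring,
        show (α*d^2+β*d+γ)-w = α*d^2+β*d+(γ-w) by ring]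
      ring
    rw [this]
    exact (abs_add_le _ _).trans (by linarith)
  rw [Real.dist_eq, sub_zero, ← sub_div, abs_div, abs_of_pos (by positivity : (0:ℝ) < n^4),
    div_lt_iff₀ (by positivity)]
  have hcard : ((QQ R n).card : ℝ) ≤ 3*R*n := by
    have : (((R*n:ℤ) + 1 - -(R*n:ℤ)).toNat : ℤ) = 2*R*n+1 := by
      have : (0:ℤ) ≤ R*n := by positivity
      rw [Int.toNat_of_nonneg (by linarith)]; ring
    have h2 : ((QQ R n).card : ℝ) = 2*R*n+1 := by rw [Int.card_Icc]; exact_mod_cast this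
    rw [h2]; nlinarith
  calc |_| ≤ ∑ a ∈ QQ R n, ∑ b ∈ QQ R n, ∑ c ∈ QQ R n, 2*ε₁*n := by
        simp only [sum4, ← Finset.sum_sub_distrib]
        refine (Finset.abs_sum_le_sum_abs _ _).trans (Finset.sum_le_sum fun a _ => ?_)
        refine (Finset.abs_sum_le_sum_abs _ _).trans (Finset.sum_le_sum fun b _ => ?_)
        refine (Finset.abs_sum_le_sum_abs _ _).trans (Finset.sum_le_sum fun c _ => ?_)
        exact inner a b c
    _ = ((QQ R n).card:ℝ)*(((QQ R n).card:ℝ)*(((QQ R n).card:ℝ)*(2*ε₁*n))) := by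
        simp only [Finset.sum_const, nsmul_eq_mul]
    _ ≤ (3*R*n)*((3*R*n)*((3*R*n)*(2*ε₁*n))) := by gcongr
    _ = ε/2*n^4 := by rw [hε₁]; field_simp; ring
    _ < ε*n^4 := by
      have : 0 < ε*n^4 := by positivity
      linarith
end BQF
end

section
open Set MeasureTheory Filter
open scoped ENNReal
namespace BQF
noncomputable def vf (n : ℕ) (f : BQF) : E4 := vc n f.a f.b f.c f.d
noncomputable def dens (x : E4) : ℝ≥0∞ := ENNReal.ofReal (2/(9*|Hr x|))
def Om : Set E4 := {x | x 0 ≠ 0 ∧ Hr x ≠ 0}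

open Classical in
theorem count_fin {n R : ℕ} (hn : 1 ≤ n) (P : E4 → Prop) (hP : ∀ x, P x → Hr x ≠ 0 ∧ ∀ i, |x i| ≤ R) :
    ∃ T : Finset BQF, (∀ f, f ∈ T ↔ P (vf n f) ∧ |(f.J:ℝ)| < n^2) ∧
      (T.card:ℝ) = sum4 (QQ R n) (fun a b c d => if P (vc n a b c d) then (cntE n a b c d : ℝ) else 0) := by
  have hn0 : (0:ℝ) < n := by exact_mod_cast hn
  have hfin : ∀ a b c d, P (vc n a b c d) → {e : ℤ | |((J ⟨a,b,c,d,e⟩ : ℤ):ℝ)| < n^2}.Finite := by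
    intro a b c d h
    have h0 : (8*a*c-3*b^2 : ℝ) ≠ 0 := by
      have := (hP _ h).1
      intro h'; apply this; simp [Hr, vc]; field_simp; linarith
    rw [(cntE_eq hn a b c d rfl h0 rfl rfl).1]; exact Finset.finite_toSet _
  set F : ℤ × ℤ × ℤ × ℤ → Finset ℤ := fun q => if h : P (vc n q.1 q.2.1 q.2.2.1 q.2.2.2) then
    (hfin _ _ _ _ h).toFinset else ∅ with hF
  set T0 := ((QQ R n) ×ˢ (QQ R n) ×ˢ (QQ R n) ×ˢ (QQ R n)).sigma F with hT0
  set m : (Σ _ : ℤ × ℤ × ℤ × ℤ, ℤ) → BQF := fun q => ⟨q.1.1, q.1.2.1, q.1.2.2.1, q.1.2.2.2, q.2⟩ with hm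
  have hinj : Function.Injective m := by
    rintro ⟨⟨a, b, c, d⟩, e⟩ ⟨⟨a', b', c', d'⟩, e'⟩ h
    simp only [hm, BQF.mk.injEq] at h
    obtain ⟨rfl, rfl, rfl, rfl, rfl⟩ := h; rfl
  refine ⟨T0.image m, fun f => ?_, ?_⟩
  · rw [Finset.mem_image]
    constructor
    · rintro ⟨⟨⟨a, b, c, d⟩, e⟩, hq, rfl⟩
      rw [hT0, Finset.mem_sigma] at hq
      have h2 := hq.2
      simp only [hF] at h2
      split_ifs at h2 with h
      · exact ⟨h, by simpa using h2⟩
      · simp at h2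
    · rintro ⟨h1, h2⟩
      refine ⟨⟨(f.a, f.b, f.c, f.d), f.e⟩, ?_, rfl⟩
      rw [hT0, Finset.mem_sigma]
      have hmemQ : ∀ z : ℤ, |(z:ℝ)/n| ≤ R → z ∈ QQ R n := by
        intro z
        rw [Finset.mem_Icc, ← abs_le, abs_div, abs_of_pos hn0, div_le_iff₀ hn0]
        exact_mod_cast id
      have h3 := (hP _ h1).2
      constructor
      · simp only [Finset.mem_product]
        exact ⟨hmemQ _ (h3 0), hmemQ _ (h3 1), hmemQ _ (h3 2), hmemQ _ (h3 3)⟩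
      · have h1' : P (vc n f.a f.b f.c f.d) := h1
        simp only [hF]; rw [dif_pos h1']; simpa using h2
  · rw [Finset.card_image_of_injective _ hinj, Finset.card_sigma]
    push_cast
    simp only [Finset.sum_product, sum4]
    refine Finset.sum_congr rfl fun a _ => Finset.sum_congr rfl fun b _ => Finset.sum_congr rfl fun c _ =>
      Finset.sum_congr rfl fun d _ => ?_
    simp only [hF]
    split_ifs with h
    · rw [cntE, ncard_eq_toFinset_card _ (hfin a b c d h)]
    · simp

theorem sum4_mono {Q : Finset ℤ} {F G : ℤ → ℤ → ℤ → ℤ → ℝ} (h : ∀ a b c d, F a b c d ≤ G a b c d) :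
    sum4 Q F ≤ sum4 Q G :=
  Finset.sum_le_sum fun _ _ => Finset.sum_le_sum fun _ _ => Finset.sum_le_sum fun _ _ =>
    Finset.sum_le_sum fun _ _ => h _ _ _ _

theorem Hr_cont : Continuous Hr := by unfold Hr; fun_prop
theorem Om_open : IsOpen Om :=
  (isOpen_ne_fun (continuous_apply 0) continuous_const).inter (isOpen_ne_fun Hr_cont continuous_const)
theorem dens_meas : Measurable dens := by
  have := Hr_cont.measurable
  unfold dens; fun_prop

/-- integral of test function against density, as lintegral -/
theorem phi_int {φ : E4 → ℝ} (h01 : ∀ x, 0 ≤ φ x ∧ φ x ≤ 1) (hm : Measurable φ) :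
    ∫ x, φ x * (2/(9*|Hr x|)) = (∫⁻ x, ENNReal.ofReal (φ x) * dens x).toReal := by
  have := Hr_cont.measurable
  rw [integral_eq_lintegral_of_nonneg_ae]
  · congr 1; refine lintegral_congr fun x => ?_
    rw [ENNReal.ofReal_mul (h01 x).1, dens]
  · exact Eventually.of_forall fun x => mul_nonneg (h01 x).1 (by positivity)
  · exact (by fun_prop : Measurable fun x => φ x * (2/(9*|Hr x|))).aestronglyMeasurable

theorem D_up {K : Set E4} (hK : IsCompact K) (hKO : K ⊆ Om) {V : ℝ}
    (hV : ∫⁻ x in K, dens x < ENNReal.ofReal V) :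
    ∃ U, IsOpen U ∧ K ⊆ U ∧ ∀ᶠ n : ℕ in atTop, ∀ s : Finset BQF,
      (∀ f ∈ s, vf n f ∈ U ∧ |(f.J:ℝ)| < n^2) → (s.card:ℝ) ≤ V*n^4 := by
  classical
  obtain ⟨K', hK', hKK', hK'O⟩ := exists_compact_between hK Om_open hKO
  have hbd : ∃ C : ℝ, ∀ x ∈ K', 2/(9*|Hr x|) ≤ C := by
    obtain ⟨C, hC⟩ := hK'.exists_bound_of_continuousOn (f := fun x => 2/(9*|Hr x|)) (by
      refine continuousOn_const.div ?_ ?_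
      · exact (continuous_const.mul Hr_cont.abs).continuousOn
      · intro x hx; have := (hK'O hx).2; positivity)
    exact ⟨C, fun x hx => (le_abs_self _).trans (hC x hx)⟩
  obtain ⟨C, hC⟩ := hbd
  set ν := (volume.restrict K').withDensity dens with hν
  have hfin : IsFiniteMeasure ν := by
    refine ⟨?_⟩
    rw [hν, withDensity_apply _ MeasurableSet.univ, Measure.restrict_univ]
    calc _ ≤ ∫⁻ x in K', ENNReal.ofReal C := by
          refine setLIntegral_mono measurable_const fun x hx => ENNReal.ofReal_le_ofReal (hC x hx)
      _ < ⊤ := by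
        rw [setLIntegral_const]
        exact ENNReal.mul_lt_top ENNReal.ofReal_lt_top hK'.measure_lt_top
  have hsubK : K ⊆ K' := hKK'.trans interior_subset
  have hνK : ν K < ENNReal.ofReal V := by
    rw [hν, withDensity_apply _ hK.measurableSet, Measure.restrict_restrict hK.measurableSet,
      inter_eq_left.2 hsubK]; exact hV
  obtain ⟨U, hKU, hU, hUV⟩ := K.exists_isOpen_lt_of_lt _ hνK
  obtain ⟨K2, hK2, hKK2, hK2U⟩ := exists_compact_between hK (hU.inter isOpen_interior)
    (subset_inter hKU hKK')
  refine ⟨interior K2, isOpen_interior, hKK2, ?_⟩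
  obtain ⟨φ, φ1, φ0, φK, φr⟩ := exists_continuous_one_zero_of_isCompact hK2
    (hU.inter isOpen_interior).isClosed_compl (disjoint_compl_right_iff_subset.2 hK2U)
  have hφS : ∀ x, φ x ≠ 0 → x ∈ U ∧ x ∈ K' := by
    intro x hx
    by_contra h
    refine hx (φ0 fun h' => h ⟨h'.1, interior_subset h'.2⟩)
  have hts : tsupport φ ⊆ K' := closure_minimal (fun x hx => (hφS x hx).2) hK'.isClosed
  obtain ⟨R, hR, hT⟩ := weyl4 φ.continuous φK (fun x hx => hK'O (hts hx)) (fun x => φr x)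
  have hlt : ∫ x, φ x * (2/(9*|Hr x|)) < V := by
    rw [phi_int φr φ.continuous.measurable]
    refine (ENNReal.toReal_lt_of_lt_ofReal (lt_of_le_of_lt ?_ hUV))
    rw [hν, withDensity_apply _ hU.measurableSet, Measure.restrict_restrict hU.measurableSet,
      ← lintegral_indicator (hU.measurableSet.inter hK'.measurableSet)]
    refine lintegral_mono fun x => ?_
    by_cases hx : φ x = 0
    · simp [hx]
    · rw [indicator_of_mem (show x ∈ U ∩ K' from hφS x hx)]
      exact mul_le_of_le_one_left (zero_le) (ENNReal.ofReal_le_one.2 (φr x).2)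
  filter_upwards [hT.eventually_lt_const hlt, eventually_ge_atTop 1] with n h1 hn s hs
  have hn0 : (0:ℝ) < n := by exact_mod_cast hn
  rw [div_lt_iff₀ (by positivity)] at h1
  obtain ⟨T, hTm, hTc⟩ := count_fin (n := n) (R := R) hn (fun x => x ∈ K2) (fun x hx =>
    ⟨(hK'O (interior_subset (hK2U hx).2)).2, hR x (by rw [φ1 hx]; exact one_ne_zero)⟩)
  have : s.card ≤ T.card := Finset.card_le_card fun f hf =>
    (hTm f).2 ⟨interior_subset (hs f hf).1, (hs f hf).2⟩
  refine le_trans (by exact_mod_cast this : (s.card:ℝ) ≤ T.card) (le_trans ?_ h1.le)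
  rw [hTc]
  refine sum4_mono fun a b c d => ?_
  split_ifs with h
  · rw [φ1 h]; simp
  · exact mul_nonneg (φr _).1 (Nat.cast_nonneg _)

theorem D_low {W : Set E4} (hW : IsOpen W) (hWO : W ⊆ Om) {V : ℝ} 
    (hV : ENNReal.ofReal V < ∫⁻ x in W, dens x) :
    ∃ K, IsCompact K ∧ K ⊆ W ∧ ∀ᶠ n : ℕ in atTop, ∃ s : Finset BQF,
      (∀ f ∈ s, vf n f ∈ K ∧ |(f.J:ℝ)| < n^2) ∧ V*n^4 ≤ s.card := by
  classical
  obtain ⟨F, hFc, hFW, hFU, hFm⟩ := hW.exists_iUnion_isClosed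
  set G : ℕ → Set E4 := fun k => F k ∩ Metric.closedBall 0 k with hG
  have hGm : Monotone G := fun i j hij => inter_subset_inter (hFm hij)
    (Metric.closedBall_subset_closedBall (by exact_mod_cast hij))
  have hGc : ∀ k, IsCompact (G k) := fun k => (isCompact_closedBall _ _).inter_left (hFc k)
  have hGU : ⋃ k, G k = W := by
    rw [← hFU]
    refine subset_antisymm (iUnion_mono fun k => inter_subset_left) fun x hx => ?_
    obtain ⟨i, hi⟩ := mem_iUnion.1 hx
    obtain ⟨j, hj⟩ := exists_nat_ge ‖x‖
    refine mem_iUnion.2 ⟨max i j, hFm (le_max_left _ _) hi, ?_⟩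
    rw [mem_closedBall_zero_iff]
    exact hj.trans (by exact_mod_cast le_max_right _ _)
  have hlim : ∃ k, ENNReal.ofReal V < ∫⁻ x in G k, dens x := by
    by_contra! hcon
    have h := tendsto_measure_iUnion_atTop (μ := volume.withDensity dens) hGm
    rw [hGU, withDensity_apply _ hW.measurableSet] at h
    refine absurd (le_of_tendsto h (Eventually.of_forall fun k => ?_)) (not_le.2 hV)
    simp only [Function.comp]
    rw [withDensity_apply _ (hGc k).measurableSet]; exact hcon k
  obtain ⟨k, hk⟩ := hlim
  have hKW : G k ⊆ W := by rw [← hGU]; exact subset_iUnion _ _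
  obtain ⟨K', hK', hKK', hK'O⟩ := exists_compact_between (hGc k) hW hKW
  obtain ⟨φ, φ1, φ0, φK, φr⟩ := exists_continuous_one_zero_of_isCompact (hGc k)
    isOpen_interior.isClosed_compl (disjoint_compl_right_iff_subset.2 hKK')
  have hφS : ∀ x, φ x ≠ 0 → x ∈ K' := by
    intro x hx
    by_contra h
    exact hx (φ0 fun h' => h (interior_subset h'))
  have hts : tsupport φ ⊆ K' := closure_minimal (fun x hx => hφS x hx) hK'.isClosed
  have hint : Integrable (fun x => φ x * (2/(9*|Hr x|))) := by
    refine Continuous.integrable_of_hasCompactSupport ?_ (φK.mul_right)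
    refine continuous_of_tsupport fun x hx => ?_
    have hx' : x ∈ tsupport φ := closure_mono (by
      intro y hy; simp only [Function.mem_support] at hy ⊢; exact left_ne_zero_of_mul hy) hx
    have h0 := (hWO (hK'O (hts hx'))).2
    refine φ.continuous.continuousAt.mul (continuousAt_const.div
      (continuous_const.mul Hr_cont.abs).continuousAt ?_)
    positivity
  obtain ⟨R, hR, hT⟩ := weyl4 φ.continuous φK (fun x hx => hWO (hK'O (hts hx))) (fun x => φr x)
  have hlt : V < ∫ x, φ x * (2/(9*|Hr x|)) := by
    have h2 : ∫⁻ x in G k, dens x ≤ ∫⁻ x, ENNReal.ofReal (φ x) * dens x := by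
      rw [← lintegral_indicator (hGc k).measurableSet]
      refine lintegral_mono fun x => ?_
      by_cases hx : x ∈ G k
      · rw [indicator_of_mem hx, φ1 hx]; simp
      · rw [indicator_of_notMem hx]; exact zero_le
    have h3 : ∫⁻ x, ENNReal.ofReal (φ x) * dens x ≠ ⊤ := by
      have := hint.lintegral_lt_top
      refine ne_of_lt (lt_of_le_of_lt (le_of_eq (lintegral_congr fun x => ?_)) this)
      rw [ENNReal.ofReal_mul (φr x).1, dens]
    rw [phi_int φr φ.continuous.measurable]
    by_contra hcon
    have := ENNReal.ofReal_le_ofReal (not_lt.1 hcon)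
    rw [ENNReal.ofReal_toReal h3] at this
    exact absurd (lt_of_lt_of_le hk h2) (not_lt.2 this)
  refine ⟨K', hK', hK'O, ?_⟩
  filter_upwards [hT.eventually_const_lt hlt, eventually_ge_atTop 1] with n h1 hn
  have hn0 : (0:ℝ) < n := by exact_mod_cast hn
  rw [lt_div_iff₀ (by positivity)] at h1
  obtain ⟨T, hTm, hTc⟩ := count_fin (n := n) (R := R) hn (fun x => φ x ≠ 0) (fun x hx =>
    ⟨(hWO (hK'O (hφS x hx))).2, hR x hx⟩)
  refine ⟨T, fun f hf => ⟨hφS _ ((hTm f).1 hf).1, ((hTm f).1 hf).2⟩, h1.le.trans ?_⟩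
  rw [hTc]
  refine sum4_mono fun a b c d => ?_
  split_ifs with h
  · exact mul_le_of_le_one_left (Nat.cast_nonneg _) (φr _).2
  · push Not at h; rw [h]; simp
end BQF
end

section
open Set MeasureTheory Filter
open scoped ENNReal
namespace BQF
open Real in
noncomputable def A0 (u v w t : ℝ) : ℝ := u*cos t^4 + v*cos t^2*sin t^2 + w*sin t^4
open Real in
noncomputable def A1 (u v w t : ℝ) : ℝ :=
  -4*u*cos t^3*sin t + v*(2*cos t^3*sin t - 2*cos t*sin t^3) + 4*w*sin t^3*cos t
open Real in
noncomputable def A2 (u v w t : ℝ) : ℝ :=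
  6*u*cos t^2*sin t^2 + v*(cos t^4-4*cos t^2*sin t^2+sin t^4) + 6*w*sin t^2*cos t^2
open Real in
noncomputable def A3 (u v w t : ℝ) : ℝ :=
  -4*u*cos t*sin t^3 + v*(-2*cos t^3*sin t + 2*cos t*sin t^3) + 4*w*sin t*cos t^3
open Real in
noncomputable def A4 (u v w t : ℝ) : ℝ := u*sin t^4 + v*cos t^2*sin t^2 + w*cos t^4

/-- real forms: a, b, c, d, e in coordinates `z = (δ, θ, x, y)` -/
noncomputable def kk (z : E4) : ℝ := z 0^2 * ((z 3)⁻¹)^2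
noncomputable def Pa (u v w : ℝ) (z : E4) : ℝ := kk z * A0 u v w (z 1)
noncomputable def Pb (u v w : ℝ) (z : E4) : ℝ := kk z * (4*z 2*A0 u v w (z 1) + z 3*A1 u v w (z 1))
noncomputable def Pc (u v w : ℝ) (z : E4) : ℝ := kk z * (6*z 2^2*A0 u v w (z 1)
  + 3*z 2*z 3*A1 u v w (z 1) + z 3^2*A2 u v w (z 1))
noncomputable def Pd (u v w : ℝ) (z : E4) : ℝ := kk z * (4*z 2^3*A0 u v w (z 1)
  + 3*z 2^2*z 3*A1 u v w (z 1) + 2*z 2*z 3^2*A2 u v w (z 1) + z 3^3*A3 u v w (z 1))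
noncomputable def Pe (u v w : ℝ) (z : E4) : ℝ := kk z * (z 2^4*A0 u v w (z 1)
  + z 2^3*z 3*A1 u v w (z 1) + z 2^2*z 3^2*A2 u v w (z 1) + z 2*z 3^3*A3 u v w (z 1)
  + z 3^4*A4 u v w (z 1))
noncomputable def PP (u v w : ℝ) (z : E4) : E4 := ![Pa u v w z, Pb u v w z, Pc u v w z, Pd u v w z]

noncomputable def HA (u v w t : ℝ) : ℝ := 8*A0 u v w t*A2 u v w t - 3*A1 u v w t^2

section
variable (u v w t : ℝ)
open Real
theorem dA0 : HasDerivAt (A0 u v w) (A1 u v w t) t := by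
  have hc := hasDerivAt_cos t; have hs := hasDerivAt_sin t
  refine HasDerivAt.congr_deriv (f := _) ((((hc.pow 4).const_mul u).add (((hc.pow 2).const_mul v).mul (hs.pow 2))).add
    ((hs.pow 4).const_mul w)) ?_
  simp only [A1, Pi.pow_apply]; push_cast; ring
theorem dA1 : HasDerivAt (A1 u v w) (2*A2 u v w t - 4*A0 u v w t) t := by
  have hc := hasDerivAt_cos t; have hs := hasDerivAt_sin t
  refine HasDerivAt.congr_deriv (f := _) (((((hc.pow 3).const_mul (-4*u)).mul hs).add (((((hc.pow 3).const_mul 2).mul hs).sub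
    ((hc.const_mul 2).mul (hs.pow 3))).const_mul v)).add (((hs.pow 3).const_mul (4*w)).mul hc)) ?_
  simp only [A2, A0, Pi.pow_apply]; push_cast; ring
theorem dA2 : HasDerivAt (A2 u v w) (3*A3 u v w t - 3*A1 u v w t) t := by
  have hc := hasDerivAt_cos t; have hs := hasDerivAt_sin t
  refine HasDerivAt.congr_deriv (f := _) (((((hc.pow 2).const_mul (6*u)).mul (hs.pow 2)).add ((((hc.pow 4).sub
    (((hc.pow 2).const_mul 4).mul (hs.pow 2))).add (hs.pow 4)).const_mul v)).add
    (((hs.pow 2).const_mul (6*w)).mul (hc.pow 2))) ?_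
  simp only [A3, A1, Pi.pow_apply]; push_cast; ring
theorem dA3 : HasDerivAt (A3 u v w) (4*A4 u v w t - 2*A2 u v w t) t := by
  have hc := hasDerivAt_cos t; have hs := hasDerivAt_sin t
  refine HasDerivAt.congr_deriv (f := _) ((((hc.const_mul (-4*u)).mul (hs.pow 3)).add (((((hc.pow 3).const_mul (-2)).mul hs).add
    ((hc.const_mul 2).mul (hs.pow 3))).const_mul v)).add ((hs.const_mul (4*w)).mul (hc.pow 3))) ?_
  simp only [A4, A2, Pi.pow_apply]; push_cast; ring
theorem IA : 12*A0 u v w t*A4 u v w t - 3*A1 u v w t*A3 u v w t + A2 u v w t^2 = 12*u*w+v^2 := by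
  have h : (cos t^2 + sin t^2)^4 = 1 := by rw [cos_sq_add_sin_sq]; norm_num
  rw [← mul_one (12*u*w+v^2), ← h]; simp only [A0, A1, A2, A3, A4]; ring
theorem JA : 72*A0 u v w t*A2 u v w t*A4 u v w t + 9*A1 u v w t*A2 u v w t*A3 u v w t
    - 27*A0 u v w t*A3 u v w t^2 - 27*A4 u v w t*A1 u v w t^2 - 2*A2 u v w t^3
    = 2*v*(36*u*w-v^2) := by
  have h : (cos t^2 + sin t^2)^6 = 1 := by rw [cos_sq_add_sin_sq]; norm_num
  rw [← mul_one (2*v*(36*u*w-v^2)), ← h]; simp only [A0, A1, A2, A3, A4]; ring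
theorem HA_eq : HA u v w t = 8*v*A0 u v w t + (48*u*w-12*v^2)*(cos t*sin t)^2 := by
  have h := cos_sq_add_sin_sq t
  have h2 : (8*v*A0 u v w t + (48*u*w-12*v^2)*(cos t*sin t)^2)*(cos t^2+sin t^2)^2
    = 8*v*A0 u v w t + (48*u*w-12*v^2)*(cos t*sin t)^2 := by rw [h]; ring
  rw [← h2]; simp only [HA, A0, A1, A2]; ring
end

section
variable (u v w : ℝ) (z : E4)
theorem Hr_PP (hy : z 3 ≠ 0) : Hr (PP u v w z) = z 0^4 * ((z 3)⁻¹)^2 * HA u v w (z 1) := by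
  simp only [Hr, PP, Pa, Pb, Pc, kk, HA, Matrix.cons_val]
  field_simp; ring
theorem I_PP (hy : z 3 ≠ 0) : 12*Pa u v w z*Pe u v w z - 3*Pb u v w z*Pd u v w z + Pc u v w z^2
    = z 0^4 * (12*u*w+v^2) := by
  rw [← IA u v w (z 1)]
  simp only [Pa, Pb, Pc, Pd, Pe, kk]; field_simp; ring
theorem J_PP (hy : z 3 ≠ 0) : 72*Pa u v w z*Pc u v w z*Pe u v w z + 9*Pb u v w z*Pc u v w z*Pd u v w z
    - 27*Pa u v w z*Pd u v w z^2 - 27*Pe u v w z*Pb u v w z^2 - 2*Pc u v w z^3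
    = z 0^6 * (2*v*(36*u*w-v^2)) := by
  rw [← JA u v w (z 1)]
  simp only [Pa, Pb, Pc, Pd, Pe, kk]; field_simp; ring

noncomputable def PM : Matrix (Fin 4) (Fin 4) ℝ :=
  let D := z 0; let x := z 2; let y := z 3
  let k := D^2*(y⁻¹)^2; let kd := 2*D*(y⁻¹)^2; let ky := -2*D^2*(y⁻¹)^3
  let a0 := A0 u v w (z 1); let a1 := A1 u v w (z 1); let a2 := A2 u v w (z 1)
  let a3 := A3 u v w (z 1); let a4 := A4 u v w (z 1)
  let b0 := a1; let b1 := 2*a2-4*a0; let b2 := 3*a3-3*a1; let b3 := 4*a4-2*a2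
  !![kd*a0, k*b0, 0, ky*a0;
     kd*(4*x*a0+y*a1), k*(4*x*b0+y*b1), k*(4*a0), ky*(4*x*a0+y*a1)+k*a1;
     kd*(6*x^2*a0+3*x*y*a1+y^2*a2), k*(6*x^2*b0+3*x*y*b1+y^2*b2), k*(12*x*a0+3*y*a1),
       ky*(6*x^2*a0+3*x*y*a1+y^2*a2)+k*(3*x*a1+2*y*a2);
     kd*(4*x^3*a0+3*x^2*y*a1+2*x*y^2*a2+y^3*a3), k*(4*x^3*b0+3*x^2*y*b1+2*x*y^2*b2+y^3*b3),
       k*(12*x^2*a0+6*x*y*a1+2*y^2*a2),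
       ky*(4*x^3*a0+3*x^2*y*a1+2*x*y^2*a2+y^3*a3)+k*(3*x^2*a1+4*x*y*a2+3*y^2*a3)]
noncomputable def PD : E4 →L[ℝ] E4 := LinearMap.toContinuousLinearMap (Matrix.toLin' (PM u v w z))

theorem PD_det (hy : z 3 ≠ 0) (hJ : v*(36*u*w-v^2) = 0) :
    (PD u v w z).det = -(4/3)*(12*u*w+v^2)*HA u v w (z 1)*z 0^7*((z 3)⁻¹)^4 := by
  have h1 := IA u v w (z 1)
  have h2 := JA u v w (z 1)
  rw [PD, LinearMap.det_toContinuousLinearMap, LinearMap.det_toLin']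
  rw [mul_assoc 2, hJ] at h2
  rw [← h1]
  have : ∀ D : ℝ, D = D + -(8/3)*A0 u v w (z 1)*z 0^7*((z 3)⁻¹)^4*(2*0) := by intro D; ring
  rw [this (Matrix.det _), ← h2, PM, Matrix.det_succ_row_zero]
  simp only [Fin.sum_univ_four, Matrix.det_fin_three, HA]
  simp [Fin.succAbove, Matrix.submatrix]
  field_simp
  ring

theorem PP_deriv (hy : z 3 ≠ 0) : HasFDerivAt (PP u v w) (PD u v w z) z := by
  have h (i : Fin 4) : HasFDerivAt (fun z : E4 => z i) (ContinuousLinearMap.proj i : E4 →L[ℝ] ℝ) z :=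
    hasFDerivAt_apply i z
  have hA0 := (dA0 u v w (z 1)).comp_hasFDerivAt z (h 1)
  have hA1 := (dA1 u v w (z 1)).comp_hasFDerivAt z (h 1)
  have hA2 := (dA2 u v w (z 1)).comp_hasFDerivAt z (h 1)
  have hA3 := (dA3 u v w (z 1)).comp_hasFDerivAt z (h 1)
  have hi := (hasDerivAt_inv hy).comp_hasFDerivAt z (h 3)
  have hk := ((h 0).pow 2).mul (hi.pow 2)
  have hx := h 2
  have hy' := h 3
  refine hasFDerivAt_pi'.2 fun i => ?_
  fin_cases i
  · refine (hk.mul hA0).congr_fderiv ?_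
    ext p
    simp [PD, PM, dotProduct, Fin.sum_univ_four, Function.comp]
    field_simp; ring
  · refine (hk.mul (((hx.const_mul 4).mul hA0).add (hy'.mul hA1))).congr_fderiv ?_
    ext p
    simp [PD, PM, dotProduct, Fin.sum_univ_four, Function.comp]
    field_simp; ring
  · refine (hk.mul (((((hx.pow 2).const_mul 6).mul hA0).add (((hx.const_mul 3).mul hy').mul hA1)).add
      ((hy'.pow 2).mul hA2))).congr_fderiv ?_
    ext p
    simp [PD, PM, dotProduct, Fin.sum_univ_four, Function.comp]
    field_simp; ring
  · refine (hk.mul ((((((hx.pow 3).const_mul 4).mul hA0).add ((((hx.pow 2).const_mul 3).mul hy').mul hA1)).add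
      (((hx.const_mul 2).mul (hy'.pow 2)).mul hA2)).add ((hy'.pow 3).mul hA3))).congr_fderiv ?_
    ext p
    simp [PD, PM, dotProduct, Fin.sum_univ_four, Function.comp]
    field_simp; ring
end
end BQF
end

section
open Set MeasureTheory Filter
open scoped ENNReal
namespace BQF
/-- the four families -/
def TT (u v w T : ℝ) : Prop := (u = 1 ∧ v = -6 ∧ w = 1 ∧ T = Real.pi/2) ∨
  (u = 1 ∧ v = 0 ∧ w = -1 ∧ T = Real.pi) ∨ (u = 1 ∧ v = 0 ∧ w = 1 ∧ T = Real.pi/2) ∨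
  (u = -1 ∧ v = 0 ∧ w = -1 ∧ T = Real.pi/2)
def SS (u v w x y : ℝ) : ℝ := u*x^4 + v*x^2*y^2 + w*y^4
noncomputable def FR (u v w : ℝ) (z : E4) (x y : ℝ) : ℝ :=
  Pa u v w z*x^4 + Pb u v w z*x^3*y + Pc u v w z*x^2*y^2 + Pd u v w z*x*y^3 + Pe u v w z*y^4

theorem coef_eq {a b c d e a' b' c' d' e' : ℝ} (h : ∀ x y : ℝ,
    a*x^4+b*x^3*y+c*x^2*y^2+d*x*y^3+e*y^4 = a'*x^4+b'*x^3*y+c'*x^2*y^2+d'*x*y^3+e'*y^4) :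
    a = a' ∧ b = b' ∧ c = c' ∧ d = d' ∧ e = e' := by
  have h1 := h 1 0; have h2 := h 0 1; have h3 := h 1 1; have h4 := h 1 (-1); have h5 := h 2 1
  norm_num at *
  refine ⟨?_, ?_, ?_, ?_, ?_⟩ <;> linarith

theorem sq_one {x : ℝ} (h : x^4 = 1) : x = 1 ∨ x = -1 := by
  have : (x^2-1)*(x^2+1) = 0 := by linear_combination h
  rcases mul_eq_zero.1 this with h' | h'
  · have : (x-1)*(x+1) = 0 := by linear_combination h'
    rcases mul_eq_zero.1 this with h | h
    · left; linarith
    · right; linarith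
  · nlinarith [sq_nonneg x]

theorem stab0 {u v w m k l o : ℝ} (hu : u^2 = 1) (hw : w^2 = 1) (hv : 4*u*w ≠ v^2)
    (hd : (m*o-k*l)^2 = 1) (h : ∀ X Y, SS u v w (m*X+k*Y) (l*X+o*Y) = SS u v w X Y) :
    ((m = 1 ∨ m = -1) ∧ (o = 1 ∨ o = -1) ∧ k = 0 ∧ l = 0) ∨
    (u = w ∧ (k = 1 ∨ k = -1) ∧ (l = 1 ∨ l = -1) ∧ m = 0 ∧ o = 0) := by
  obtain ⟨c0, c1, c2, c3, c4⟩ := coef_eq (a := u*m^4+v*m^2*l^2+w*l^4)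
    (b := 4*u*m^3*k+v*(2*m*k*l^2+2*m^2*l*o)+4*w*l^3*o)
    (c := 6*u*m^2*k^2 + v*(k^2*l^2+4*m*k*l*o+m^2*o^2) + 6*w*l^2*o^2)
    (d := 4*u*m*k^3 + v*(2*k^2*l*o+2*m*k*o^2) + 4*w*l*o^3)
    (e := u*k^4+v*k^2*o^2+w*o^4) (a' := u) (b' := 0) (c' := v) (d' := 0) (e' := w) (by
      intro x y; have := h x y; simp only [SS] at this; linear_combination this)
  have hne : 48*u*w-12*v^2 ≠ 0 := fun h => hv (by linarith)
  have hml : (48*u*w-12*v^2)*(m*l)^2 = 0 := by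
    have e1 : 8*(u*m^4+v*m^2*l^2+w*l^4)*(6*u*m^2*k^2 + v*(k^2*l^2+4*m*k*l*o+m^2*o^2) + 6*w*l^2*o^2)
      - 3*(4*u*m^3*k+v*(2*m*k*l^2+2*m^2*l*o)+4*w*l^3*o)^2
      = (m*o-k*l)^2*(8*v*(u*m^4+v*m^2*l^2+w*l^4)+(48*u*w-12*v^2)*(m*l)^2) := by ring
    rw [c0, c1, c2, hd] at e1; linear_combination -e1
  have hko : (48*u*w-12*v^2)*(k*o)^2 = 0 := by
    have e1 : 8*(u*k^4+v*k^2*o^2+w*o^4)*(6*u*m^2*k^2 + v*(k^2*l^2+4*m*k*l*o+m^2*o^2) + 6*w*l^2*o^2)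
      - 3*(4*u*m*k^3 + v*(2*k^2*l*o+2*m*k*o^2) + 4*w*l*o^3)^2
      = (m*o-k*l)^2*(8*v*(u*k^4+v*k^2*o^2+w*o^4)+(48*u*w-12*v^2)*(k*o)^2) := by ring
    rw [c4, c3, c2, hd] at e1; linear_combination -e1
  have hml' : m*l = 0 := by simpa [hne] using hml
  have hko' : k*o = 0 := by simpa [hne] using hko
  have h1 : ∀ x : ℝ, u*x^4 = u → x^4 = 1 := fun x hx => by linear_combination u*hx+(1-x^4)*hu
  have h2 : ∀ x : ℝ, w*x^4 = w → x^4 = 1 := fun x hx => by linear_combination w*hx+(1-x^4)*hw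
  rcases mul_eq_zero.1 hml' with rfl | rfl
  · right
    rcases mul_eq_zero.1 hko' with rfl | rfl
    · norm_num at hd
    · have h3 : w*l^4 = u := by linear_combination c0
      have h4 : l^4*l^4 = 1 := by linear_combination (w*l^4+u)*h3+hu-l^8*hw
      have h5 : l^4 = 1 := by nlinarith [sq_nonneg (l^2), sq_nonneg (l^4)]
      rw [h5] at h3
      refine ⟨by linarith, sq_one (h1 _ ?_), sq_one h5, rfl, rfl⟩
      linear_combination c4+h3
  · left
    rcases mul_eq_zero.1 hko' with rfl | rfl
    · exact ⟨sq_one (h1 _ (by linear_combination c0)), sq_one (h2 _ (by linear_combination c4)), rfl, rfl⟩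
    · norm_num at hd

theorem stab {u v w p q r t p' q' r' t' : ℝ} (hu : u^2 = 1) (hw : w^2 = 1) (hv : 4*u*w ≠ v^2)
    (hd : p*t-q*r ≠ 0) (hdd : (p'*t'-q'*r')^2 = (p*t-q*r)^2)
    (h : ∀ X Y, SS u v w (p'*X+q'*Y) (r'*X+t'*Y) = SS u v w (p*X+q*Y) (r*X+t*Y)) :
    ∃ ε η : ℝ, (ε = 1 ∨ ε = -1) ∧ (η = 1 ∨ η = -1) ∧
    ((p' = ε*p ∧ q' = ε*q ∧ r' = η*r ∧ t' = η*t) ∨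
     (u = w ∧ p' = ε*r ∧ q' = ε*t ∧ r' = η*p ∧ t' = η*q)) := by
  set D := p*t-q*r with hD
  have := stab0 (u := u) (v := v) (w := w) (m := (p'*t-q'*r)/D) (k := (-p'*q+q'*p)/D)
    (l := (r'*t-t'*r)/D) (o := (-r'*q+t'*p)/D) hu hw hv (by
      have : (p'*t-q'*r)/D*((-r'*q+t'*p)/D)-(-p'*q+q'*p)/D*((r'*t-t'*r)/D) = (p'*t'-q'*r')/D := by
        field_simp; rw [hD]; ring
      rw [this, div_pow, hdd, div_self (pow_ne_zero _ hd)]) (by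
      intro X Y
      have := h ((t*X-q*Y)/D) ((-r*X+p*Y)/D)
      convert this using 2
      · field_simp; ring
      · field_simp; ring
      · field_simp; rw [hD]; ring
      · field_simp; rw [hD]; ring)
  have ep : p' = (p'*t-q'*r)/D*p + (-p'*q+q'*p)/D*r := by field_simp; rw [hD]; ring
  have eq : q' = (p'*t-q'*r)/D*q + (-p'*q+q'*p)/D*t := by field_simp; rw [hD]; ring
  have er : r' = (r'*t-t'*r)/D*p + (-r'*q+t'*p)/D*r := by field_simp; rw [hD]; ring
  have et : t' = (r'*t-t'*r)/D*q + (-r'*q+t'*p)/D*t := by field_simp; rw [hD]; ring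
  rcases this with ⟨h1, h2, h3, h4⟩ | ⟨h0, h1, h2, h3, h4⟩
  · rw [h3] at ep eq; rw [h4] at er et
    exact ⟨_, _, h1, h2, Or.inl ⟨by linarith, by linarith, by linarith, by linarith⟩⟩
  · rw [h3] at ep eq; rw [h4] at er et
    exact ⟨_, _, h1, h2, Or.inr ⟨h0, by linarith, by linarith, by linarith, by linarith⟩⟩

/-- the matrix attached to `z` -/
noncomputable def mu (z : E4) : ℝ := √(z 0 / z 3)
noncomputable def mp (z : E4) : ℝ := mu z * Real.cos (z 1)
noncomputable def mq (z : E4) : ℝ := mu z * (Real.cos (z 1)*z 2 - Real.sin (z 1)*z 3)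
noncomputable def mr (z : E4) : ℝ := mu z * Real.sin (z 1)
noncomputable def mt (z : E4) : ℝ := mu z * (Real.sin (z 1)*z 2 + Real.cos (z 1)*z 3)

theorem mu_sq {z : E4} (h0 : 0 < z 0) (h3 : 0 < z 3) : mu z^2 = z 0 / z 3 :=
  Real.sq_sqrt (by positivity)
theorem mu_pos {z : E4} (h0 : 0 < z 0) (h3 : 0 < z 3) : 0 < mu z := Real.sqrt_pos.2 (by positivity)
theorem det_M {z : E4} (h0 : 0 < z 0) (h3 : 0 < z 3) : mp z*mt z - mq z*mr z = z 0 := by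
  have h : z 0 = mu z^2*z 3*(Real.cos (z 1)^2 + Real.sin (z 1)^2) := by
    rw [mu_sq h0 h3, Real.cos_sq_add_sin_sq]; field_simp
  rw [h]; simp only [mp, mt, mq, mr]; ring
theorem FR_eq {u v w : ℝ} {z : E4} (h0 : 0 < z 0) (h3 : 0 < z 3) (X Y : ℝ) :
    FR u v w z X Y = SS u v w (mp z*X+mq z*Y) (mr z*X+mt z*Y) := by
  have h : kk z = (mu z^2)^2 := by rw [mu_sq h0 h3, kk]; field_simp
  simp only [FR, Pa, Pb, Pc, Pd, Pe, A0, A1, A2, A3, A4, h, SS, mp, mq, mr, mt]; ring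

theorem mxy (z : E4) :
    (mp z^2+mr z^2)*z 2 = mp z*mq z+mr z*mt z ∧ (mp z^2+mr z^2)*z 3 = mp z*mt z-mq z*mr z ∧
     mp z^2+mr z^2 = mu z^2 := by
  have h := Real.cos_sq_add_sin_sq (z 1)
  simp only [mp, mq, mr, mt]
  refine ⟨by ring, by ring, by linear_combination (mu z)^2*h⟩

theorem FR_inj {u v w T : ℝ} {z z' : E4} (hu : u^2 = 1) (hw : w^2 = 1) (hv : 4*u*w ≠ v^2)
    (hT : T ≤ Real.pi) (hT' : u = w → T ≤ Real.pi/2) (h3 : 0 < z 3) (h3' : 0 < z' 3)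
    (h0 : 0 < z 0) (h00 : z' 0 = z 0) (h1 : z 1 ∈ Ico 0 T) (h1' : z' 1 ∈ Ico 0 T)
    (h : ∀ X Y, FR u v w z' X Y = FR u v w z X Y) : z' = z := by
  have h0' : 0 < z' 0 := h00 ▸ h0
  have hd := det_M h0 h3
  have hd' := det_M h0' h3'
  have hmu := mu_pos h0 h3
  have hmu' := mu_pos h0' h3'
  obtain ⟨ε, η, hε, hη, hh⟩ := stab (p' := mp z') (q' := mq z') (r' := mr z') (t' := mt z') hu hw hv (by rw [hd]; exact h0.ne') (by rw [hd, hd', h00])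
    (fun X Y => by rw [← FR_eq h0' h3', ← FR_eq h0 h3, h])
  obtain ⟨x1, y1, n1⟩ := mxy z
  obtain ⟨x2, y2, n2⟩ := mxy z'
  have hs0 : 0 ≤ Real.sin (z 1) := Real.sin_nonneg_of_nonneg_of_le_pi h1.1 (by linarith [h1.2])
  have hs0' : 0 ≤ Real.sin (z' 1) := Real.sin_nonneg_of_nonneg_of_le_pi h1'.1 (by linarith [h1'.2])
  have hε2 : ε^2 = 1 := by rcases hε with rfl | rfl <;> norm_num
  have hη2 : η^2 = 1 := by rcases hη with rfl | rfl <;> norm_num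
  rcases hh with ⟨e1, e2, e3, e4⟩ | ⟨huw, e1, e2, e3, e4⟩
  · have hεη : ε*η = 1 := by
      have : ε*η*z 0 = 1*z 0 := by rw [e1, e2, e3, e4, h00] at hd'; rw [one_mul]; nth_rewrite 1 [← hd]; linarith
      exact mul_right_cancel₀ h0.ne' this
    have hηε : η = ε := by linear_combination ε*hεη - η*hε2
    subst hηε
    have hn : mp z'^2 + mr z'^2 = mp z^2+mr z^2 := by rw [e1, e3]; linear_combination (mp z^2+mr z^2)*hη2
    have hmm : mu z' = mu z := by
      rw [n1, n2] at hn; exact (pow_left_inj₀ hmu'.le hmu.le two_ne_zero).1 hn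
    have hpos : mp z^2+mr z^2 ≠ 0 := by rw [n1]; positivity
    have hx : z' 2 = z 2 := by
      apply mul_left_cancel₀ hpos; rw [x1, ← hn, x2, e1, e2, e3, e4]
      linear_combination (mp z*mq z+mr z*mt z)*hη2
    have hy : z' 3 = z 3 := by
      apply mul_left_cancel₀ hpos; rw [y1, ← hn, y2, e1, e2, e3, e4]
      linear_combination (mp z*mt z-mq z*mr z)*hη2
    have hc : Real.cos (z' 1) = η*Real.cos (z 1) := by
      apply mul_left_cancel₀ hmu.ne'; simp only [mp, hmm] at e1; linarith
    have hs : Real.sin (z' 1) = η*Real.sin (z 1) := by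
      apply mul_left_cancel₀ hmu.ne'; simp only [mr, hmm] at e3; linarith
    have ht : z' 1 = z 1 := by
      rcases hη with rfl | rfl
      · exact Real.injOn_cos ⟨h1'.1, by linarith [h1'.2]⟩ ⟨h1.1, by linarith [h1.2]⟩ (by linarith)
      · have a1 : Real.sin (z 1) = 0 := by linarith
        have a2 : Real.sin (z' 1) = 0 := by linarith
        have : ∀ t ∈ Ico 0 T, Real.sin t = 0 → t = 0 := by
          intro t ht h
          by_contra hne
          exact absurd h (Real.sin_pos_of_pos_of_lt_pi (lt_of_le_of_ne ht.1 (Ne.symm hne)) (by linarith [ht.2])).ne'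
        rw [this _ h1 a1, this _ h1' a2]
    ext i; fin_cases i
    · exact h00
    · exact ht
    · exact hx
    · exact hy
  · exfalso
    have hT2 := hT' huw
    have hcp : ∀ t ∈ Ico 0 T, 0 < Real.cos t := fun t ht =>
      Real.cos_pos_of_mem_Ioo ⟨by linarith [ht.1, Real.pi_pos], by linarith [ht.2]⟩
    have c1 := hcp _ h1
    have c2 := hcp _ h1'
    have hεη : ε*η = -1 := by
      have : ε*η*z 0 = -1*z 0 := by rw [e1, e2, e3, e4, h00] at hd'; nth_rewrite 1 [← hd]; linarith
      exact mul_right_cancel₀ h0.ne' this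
    have p1 : 0 < mp z' := mul_pos hmu' c2
    have p2 : 0 < mp z := mul_pos hmu c1
    have p3 : 0 ≤ mr z := mul_nonneg hmu.le hs0
    have p4 : 0 ≤ mr z' := mul_nonneg hmu'.le hs0'
    rcases hε with rfl | rfl
    · have : η = -1 := by linarith
      rw [this] at e3; linarith
    · rw [e1] at p1; linarith

theorem TT.facts {u v w T : ℝ} (h : TT u v w T) : u^2 = 1 ∧ w^2 = 1 ∧ 4*u*w ≠ v^2 ∧ T ≤ Real.pi ∧
    (u = w → T ≤ Real.pi/2) ∧ v*(36*u*w-v^2) = 0 ∧ 12*u*w+v^2 ≠ 0 ∧ 0 < T ∧ 72*u*w-6*v^2 ≠ 0 := by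
  have := Real.pi_pos
  rcases h with ⟨rfl, rfl, rfl, rfl⟩ | ⟨rfl, rfl, rfl, rfl⟩ | ⟨rfl, rfl, rfl, rfl⟩ | ⟨rfl, rfl, rfl, rfl⟩ <;>
  (refine ⟨by norm_num, by norm_num, by norm_num, by linarith, fun h => by linarith, by norm_num, by norm_num,
    by linarith, by norm_num⟩)

theorem PP_inj {u v w T : ℝ} (hTT : TT u v w T) : InjOn (PP u v w)
    {z | 0 < z 0 ∧ z 1 ∈ Ico 0 T ∧ 0 < z 3 ∧ HA u v w (z 1) ≠ 0} := by
  obtain ⟨hu, hw, hv, hT, hT', hJ, hI, -⟩ := hTT.facts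
  rintro z ⟨h0, h1, h3, hH⟩ z' ⟨h0', h1', h3', hH'⟩ h
  have ha : Pa u v w z = Pa u v w z' := congrFun h 0
  have hb : Pb u v w z = Pb u v w z' := congrFun h 1
  have hc : Pc u v w z = Pc u v w z' := congrFun h 2
  have hd : Pd u v w z = Pd u v w z' := congrFun h 3
  have j1 := J_PP u v w z h3.ne'
  have j2 := J_PP u v w z' h3'.ne'
  have hH1 := Hr_PP u v w z h3.ne'
  have hHne : 8*Pa u v w z*Pc u v w z - 3*Pb u v w z^2 ≠ 0 := by
    have : Hr (PP u v w z) ≠ 0 := by rw [hH1]; positivity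
    simpa [Hr, PP] using this
  have he : Pe u v w z = Pe u v w z' := by
    apply mul_left_cancel₀ hHne
    rw [← ha, ← hb, ← hc, ← hd] at j2
    rw [mul_assoc 2, hJ] at j1 j2
    linear_combination (1/9)*(j1-j2)
  have i1 := I_PP u v w z h3.ne'
  have i2 := I_PP u v w z' h3'.ne'
  rw [← ha, ← hb, ← hc, ← hd, ← he, i1] at i2
  have h00 : z' 0 = z 0 := ((pow_left_inj₀ h0.le h0'.le four_ne_zero).1 (mul_right_cancel₀ hI i2)).symm
  exact (FR_inj hu hw hv hT hT' h3 h3' h0 h00 h1 h1' fun X Y => by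
    simp only [FR, ha, hb, hc, hd, he]).symm
end BQF
end

section
open Set MeasureTheory Filter
open scoped ENNReal
namespace BQF
noncomputable def Qm (ζ : E4) : E4 := ![√√(ζ 0), ζ 1, Real.sin (ζ 2), Real.cos (ζ 2)*(ζ 3)⁻¹]
noncomputable def QM (ζ : E4) : Matrix (Fin 4) (Fin 4) ℝ :=
  !![1/(2*√√(ζ 0))*(1/(2*√(ζ 0))), 0, 0, 0; 0, 1, 0, 0; 0, 0, Real.cos (ζ 2), 0;
    0, 0, -Real.sin (ζ 2)*(ζ 3)⁻¹, -Real.cos (ζ 2)*((ζ 3)⁻¹)^2]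
noncomputable def QD (ζ : E4) : E4 →L[ℝ] E4 := LinearMap.toContinuousLinearMap (Matrix.toLin' (QM ζ))
def Qdom : Set E4 := {ζ | 0 < ζ 0 ∧ ζ 2 ∈ Ioo (-(Real.pi/2)) (Real.pi/2) ∧ 0 < ζ 3}

theorem QD_det (ζ : E4) : (QD ζ).det =
    -(1/(2*√√(ζ 0))*(1/(2*√(ζ 0))))*(Real.cos (ζ 2))^2*((ζ 3)⁻¹)^2 := by
  rw [QD, LinearMap.det_toContinuousLinearMap, LinearMap.det_toLin', QM, Matrix.det_succ_row_zero]
  simp only [Fin.sum_univ_four, Matrix.det_fin_three]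
  simp [Fin.succAbove, Matrix.submatrix]
  ring

theorem Q_deriv {ζ : E4} (h : ζ ∈ Qdom) : HasFDerivAt Qm (QD ζ) ζ := by
  obtain ⟨h0, -, h3⟩ := h
  have h (i : Fin 4) : HasFDerivAt (fun z : E4 => z i) (ContinuousLinearMap.proj i : E4 →L[ℝ] ℝ) ζ :=
    hasFDerivAt_apply i ζ
  refine hasFDerivAt_pi'.2 fun i => ?_
  fin_cases i
  · refine (((Real.hasDerivAt_sqrt (Real.sqrt_pos.2 h0).ne').comp (ζ 0)
      (Real.hasDerivAt_sqrt h0.ne')).comp_hasFDerivAt ζ (h 0)).congr_fderiv ?_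
    ext p; simp [QD, QM, dotProduct, Fin.sum_univ_four]
  · refine (h 1).congr_fderiv ?_
    ext p; simp [QD, QM, dotProduct, Fin.sum_univ_four]
  · refine ((Real.hasDerivAt_sin _).comp_hasFDerivAt ζ (h 2)).congr_fderiv ?_
    ext p; simp [QD, QM, dotProduct, Fin.sum_univ_four]
  · refine (((Real.hasDerivAt_cos _).comp_hasFDerivAt ζ (h 2)).mul
      ((hasDerivAt_inv h3.ne').comp_hasFDerivAt ζ (h 3))).congr_fderiv ?_
    ext p; simp [QD, QM, dotProduct, Fin.sum_univ_four, Function.comp]; ring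

theorem Q_pos {ζ : E4} (h : ζ ∈ Qdom) : 0 < Qm ζ 0 ∧ 0 < Qm ζ 3 :=
  ⟨Real.sqrt_pos.2 (Real.sqrt_pos.2 h.1), mul_pos (Real.cos_pos_of_mem_Ioo h.2.1) (inv_pos.2 h.2.2)⟩

theorem Q_inj : InjOn Qm Qdom := by
  rintro ζ ⟨h0, h2, h3⟩ ζ' ⟨h0', h2', h3'⟩ h
  have e0 : √√(ζ 0) = √√(ζ' 0) := congrFun h 0
  have e1 : ζ 1 = ζ' 1 := congrFun h 1
  have e2 : Real.sin (ζ 2) = Real.sin (ζ' 2) := congrFun h 2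
  have e3 : Real.cos (ζ 2)*(ζ 3)⁻¹ = Real.cos (ζ' 2)*(ζ' 3)⁻¹ := congrFun h 3
  have e2' := Real.injOn_sin (Ioo_subset_Icc_self h2) (Ioo_subset_Icc_self h2') e2
  rw [e2'] at e3
  have e3' := inv_injective (mul_left_cancel₀ (Real.cos_pos_of_mem_Ioo h2').ne' e3)
  have e0' : ζ 0 = ζ' 0 := (Real.sqrt_inj h0.le h0'.le).1 ((Real.sqrt_inj (Real.sqrt_nonneg _)
    (Real.sqrt_nonneg _)).1 e0)
  ext i; fin_cases i
  exacts [e0', e1, e2', e3']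

theorem E_int {u v w T : ℝ} (hTT : TT u v w T) {B : Set E4} (hB : MeasurableSet B) (hQ : B ⊆ Qdom)
    (h1 : ∀ ζ ∈ B, ζ 1 ∈ Ico 0 T ∧ HA u v w (ζ 1) ≠ 0) :
    ∫⁻ x in (PP u v w) '' (Qm '' B), dens x = ENNReal.ofReal (2/27*|12*u*w+v^2|) * volume B := by
  have hJ := hTT.facts.2.2.2.2.2.1
  have hder : ∀ ζ ∈ B, HasFDerivWithinAt (PP u v w ∘ Qm) ((PD u v w (Qm ζ)).comp (QD ζ)) B ζ :=
    fun ζ hζ => ((PP_deriv u v w _ (Q_pos (hQ hζ)).2.ne').comp ζ (Q_deriv (hQ hζ))).hasFDerivWithinAt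
  have hinj : InjOn (PP u v w ∘ Qm) B := (PP_inj hTT).comp (Q_inj.mono hQ) fun ζ hζ =>
    ⟨(Q_pos (hQ hζ)).1, (h1 ζ hζ).1, (Q_pos (hQ hζ)).2, (h1 ζ hζ).2⟩
  rw [← image_comp, lintegral_image_eq_lintegral_abs_det_fderiv_mul volume hB hder hinj,
    ← setLIntegral_const]
  refine setLIntegral_congr_fun hB fun ζ hζ => ?_
  obtain ⟨p0, p3⟩ := Q_pos (hQ hζ)
  obtain ⟨h0, h2, h3⟩ := hQ hζ
  have hH := (h1 ζ hζ).2
  have hdet : ((PD u v w (Qm ζ)).comp (QD ζ)).det = (PD u v w (Qm ζ)).det * (QD ζ).det := by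
    simp [ContinuousLinearMap.det, LinearMap.det_comp]
  have hc := Real.cos_pos_of_mem_Ioo h2
  simp only [Function.comp]
  rw [dens, ← ENNReal.ofReal_mul (abs_nonneg _), hdet, PD_det _ _ _ _ p3.ne' hJ, QD_det,
    Hr_PP _ _ _ _ p3.ne']
  congr 1
  have hr : √√(ζ 0) ^ 2 = √(ζ 0) := Real.sq_sqrt (Real.sqrt_nonneg _)
  have hp : 0 < √√(ζ 0) := p0
  have e0 : Qm ζ 0 = √√(ζ 0) := rfl
  have e1 : Qm ζ 1 = ζ 1 := rfl
  have e3 : Qm ζ 3 = Real.cos (ζ 2)*(ζ 3)⁻¹ := rfl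
  rw [e0, e1, e3, ← hr]
  generalize √√(ζ 0) = r at *
  simp only [abs_mul, abs_neg, abs_pow, abs_div, abs_inv, abs_of_pos hp, abs_of_pos hc, abs_of_pos h3]
  have hH' := abs_pos.2 hH
  norm_num [abs_of_pos]
  field_simp
  simp only [Real.sqrt_sq hp.le, abs_of_pos hp]; ring
end BQF
end

section
open Set MeasureTheory Filter
open scoped ENNReal
namespace BQF
open Polynomial in
theorem roots_fin {f : BQF} (ha : f.a ≠ 0) : f.realRoots.Finite := by
  have ha' : (f.a:ℝ) ≠ 0 := by exact_mod_cast ha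
  have hp : (C (f.a:ℝ)*X^4 + C (f.b:ℝ)*X^3 + C (f.c:ℝ)*X^2 + C (f.d:ℝ)*X + C (f.e:ℝ)) ≠ 0 := by
    intro h
    have : natDegree (C (f.a:ℝ)*X^4 + C (f.b:ℝ)*X^3 + C (f.c:ℝ)*X^2 + C (f.d:ℝ)*X + C (f.e:ℝ)) = 4 := by
      compute_degree!
    rw [h] at this; simp at this
  refine (Polynomial.finite_setOfPred_isRoot hp).subset fun x hx => ?_
  have : f.evalR x 1 = 0 := hx
  simp [evalR] at this
  simpa [IsRoot] using this

theorem four_roots {f : BQF} (h4 : f.realRoots.ncard = 4) : ∃ r1 r2 r3 r4 : ℝ,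
    r1 < r2 ∧ r2 < r3 ∧ r3 < r4 ∧ ∀ x y, f.evalR x y = f.a*((x-r1*y)*(x-r2*y))*((x-r3*y)*(x-r4*y)) := by
  have hfin := finite_of_ncard_ne_zero (s := f.realRoots) (by omega)
  have hc : hfin.toFinset.card = 4 := by rw [← ncard_eq_toFinset_card _ hfin, h4]
  set r := hfin.toFinset.orderEmbOfFin hc with hr
  have hroot : ∀ j, f.evalR (r j) 1 = 0 := fun j =>
    hfin.mem_toFinset.1 (Finset.orderEmbOfFin_mem _ hc j)
  refine ⟨r 0, r 1, r 2, r 3, r.strictMono (by decide), r.strictMono (by decide),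
    r.strictMono (by decide), ?_⟩
  have hV : (Matrix.vandermonde r).mulVec ![(f.e:ℝ) - f.a*(r 0*r 1*r 2*r 3),
    f.d + f.a*(r 0*r 1*r 2+r 0*r 1*r 3+r 0*r 2*r 3+r 1*r 2*r 3),
    f.c - f.a*(r 0*r 1+r 0*r 2+r 0*r 3+r 1*r 2+r 1*r 3+r 2*r 3), f.b + f.a*(r 0+r 1+r 2+r 3)] = 0 := by
    ext j
    have := hroot j
    have hz : (r j-r 0)*(r j-r 1)*(r j-r 2)*(r j-r 3) = 0 := by
      fin_cases j <;> simp
    simp only [evalR] at this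
    simp [Matrix.mulVec, dotProduct, Fin.sum_univ_four, Matrix.vandermonde]
    linear_combination this - f.a*hz
  have h0 := Matrix.eq_zero_of_mulVec_eq_zero (Matrix.det_vandermonde_ne_zero_iff.2 r.injective) hV
  have e0 := congrFun h0 0; have e1 := congrFun h0 1; have e2 := congrFun h0 2; have e3 := congrFun h0 3
  simp at e0 e1 e2 e3
  intro x y
  simp only [evalR]
  linear_combination y^4*e0 + x*y^3*e1+x^2*y^2*e2+x^3*y*e3

open Polynomial in
/-- a form with at most 2 real roots splits off a definite quadratic -/
theorem nonreal {f : BQF} (hf : f.Irred) (h : f.realRoots.ncard ≤ 2) : ∃ s t A B D : ℝ, 0 < t ∧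
    ∀ x y, f.evalR x y = ((x-s*y)^2+(t*y)^2)*(A*x^2+B*x*y+D*y^2) := by
  obtain ⟨ha, hirr⟩ := hf
  set p := C (f.a : ℚ) * X ^ 4 + C (f.b : ℚ) * X ^ 3 + C (f.c : ℚ) * X ^ 2 + C (f.d : ℚ) * X + C (f.e : ℚ) with hp
  have ha' : (f.a:ℚ) ≠ 0 := by exact_mod_cast ha
  have hdeg : p.natDegree = 4 := by rw [hp]; compute_degree!
  have hsep := (hirr.separable).map (f := algebraMap ℚ ℂ)
  have hnd := nodup_roots hsep
  have hcard : (p.map (algebraMap ℚ ℂ)).roots.card = 4 := by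
    rw [← (IsAlgClosed.splits _).natDegree_eq_card_roots, natDegree_map, hdeg]
  have hmem : ∀ z ∈ (p.map (algebraMap ℚ ℂ)).roots,
      (f.a:ℂ)*z^4+f.b*z^3+f.c*z^2+f.d*z+f.e = 0 := by
    intro z hz
    have := isRoot_of_mem_roots hz
    simpa [IsRoot, hp] using this
  have hex : ∃ z ∈ (p.map (algebraMap ℚ ℂ)).roots, z.im ≠ 0 := by
    by_contra! hcon
    have hsub : (((p.map (algebraMap ℚ ℂ)).roots.toFinset.image Complex.re : Finset ℝ) : Set ℝ) ⊆ f.realRoots := by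
      intro x hx
      obtain ⟨z, hz, rfl⟩ := Finset.mem_image.1 (Finset.mem_coe.1 hx)
      have hz' := Multiset.mem_toFinset.1 hz
      have hzz : z = (z.re:ℂ) := Complex.ext rfl (by simpa using hcon z hz')
      have h1 := hmem z hz'
      rw [hzz] at h1
      show f.evalR z.re 1 = 0
      simp only [evalR]
      have h2 : (((f.a:ℝ)*z.re^4+f.b*z.re^3+f.c*z.re^2+f.d*z.re+f.e : ℝ):ℂ) = 0 := by
        push_cast; exact h1
      have h3 := Complex.ofReal_eq_zero.1 h2
      linear_combination h3
    have := ncard_le_ncard hsub (roots_fin ha)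
    rw [ncard_coe_finset, Finset.card_image_of_injOn, Multiset.toFinset_card_of_nodup hnd, hcard] at this
    · omega
    · intro z hz z' hz' hre
      refine Complex.ext hre ?_
      rw [hcon z (Multiset.mem_toFinset.1 hz), hcon z' (Multiset.mem_toFinset.1 hz')]
  obtain ⟨z, hz, him⟩ := hex
  have hzr := hmem z hz
  set pr : ℝ[X] := C (f.a:ℝ)*X^4 + C (f.b:ℝ)*X^3 + C (f.c:ℝ)*X^2 + C (f.d:ℝ)*X + C (f.e:ℝ) with hpr
  obtain ⟨q, hq⟩ := pr.quadratic_dvd_of_aeval_eq_zero_im_ne_zero (z := z) (by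
    rw [hpr]; simp only [map_add, map_mul, map_pow, aeval_X, aeval_C]; simpa using hzr) him
  have ha'' : (f.a:ℝ) ≠ 0 := by exact_mod_cast ha
  have hprd : pr.natDegree = 4 := by rw [hpr]; compute_degree!
  set m : ℝ[X] := X ^ 2 - C (2 * z.re) * X + C (‖z‖ ^ 2) with hm
  have hmd : m.natDegree = 2 := by rw [hm]; compute_degree!
  have hm0 : m ≠ 0 := by intro h; rw [h] at hmd; simp at hmd
  have hq0 : q ≠ 0 := by rintro rfl; rw [mul_zero] at hq; rw [hq] at hprd; simp at hprd
  have hqd : q.natDegree = 2 := by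
    have := natDegree_mul hm0 hq0
    rw [← hq, hprd, hmd] at this; omega
  have hqe : q = C (q.coeff 2)*X^2 + C (q.coeff 1)*X + C (q.coeff 0) := by
    conv_lhs => rw [q.as_sum_range_C_mul_X_pow, hqd]
    simp [Finset.sum_range_succ]; ring
  refine ⟨z.re, |z.im|, q.coeff 2, q.coeff 1, q.coeff 0, abs_pos.2 him, ?_⟩
  have hn : ‖z‖^2 = z.re^2+z.im^2 := by rw [Complex.sq_norm, Complex.normSq_apply]; ring
  rw [hqe, hm, hn] at hq
  have e4 := congrArg (fun P => coeff P 4) hq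
  have e3 := congrArg (fun P => coeff P 3) hq
  have e2 := congrArg (fun P => coeff P 2) hq
  have e1 := congrArg (fun P => coeff P 1) hq
  have e0 := congrArg (fun P => coeff P 0) hq
  have hexp : ∀ r n q2 q1 q0 : ℝ, (X ^ 2 - C r * X + C n)*(C q2*X^2 + C q1*X + C q0) =
    C q2*X^4 + C (q1-r*q2)*X^3 + C (q0-r*q1+n*q2)*X^2+C (n*q1-r*q0)*X + C (n*q0) := by
    intros; simp only [C_sub, C_add, C_mul]; ring
  simp only [hexp, hpr, coeff_add, coeff_C_mul, coeff_X_pow, coeff_X, coeff_C] at e4 e3 e2 e1 e0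
  norm_num at e4 e3 e2 e1 e0
  intro x y
  rw [mul_pow, sq_abs]
  simp only [evalR]
  rw [e4, e3, e2, e1, e0]; ring
end BQF
end

section
open Set MeasureTheory Filter
open scoped ENNReal
namespace BQF
def Rep (F : ℝ → ℝ → ℝ) (α β γ : ℝ) : Prop := ∃ p q r t : ℝ, p*t-q*r ≠ 0 ∧
  ∀ x y, F x y = SS α β γ (p*x+q*y) (r*x+t*y)
variable {F : ℝ → ℝ → ℝ} {A B C u v w : ℝ}
theorem Rep.swap (h : Rep F A B C) : Rep F C B A := by
  obtain ⟨p, q, r, t, hd, h⟩ := h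
  exact ⟨r, t, p, q, fun h' => hd (by linarith), fun x y => by rw [h]; simp only [SS]; ring⟩
theorem Rep.scale {s t : ℝ} (h : Rep F (A*s^4) (B*s^2*t^2) (C*t^4)) (hs : s ≠ 0) (ht : t ≠ 0) :
    Rep F A B C := by
  obtain ⟨p, q, r, t', hd, h⟩ := h
  refine ⟨s*p, s*q, t*r, t*t', fun h' => ?_, fun x y => by rw [h]; simp only [SS]; ring⟩
  have : (s*t)*(p*t'-q*r) = 0 := by linear_combination h'
  simp_all
theorem Rep.norm (h : Rep F A B C) (hu : u^2 = 1) (hw : w^2 = 1) (hA : 0 < u*A) (hC : 0 < w*C) :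
    Rep F u (B/√(u*A*(w*C))) w := by
  have e1 : √√(u*A)^2 = √(u*A) := Real.sq_sqrt (by positivity)
  have e2 : √√(w*C)^2 = √(w*C) := Real.sq_sqrt (by positivity)
  have e3 : √(u*A)^2 = u*A := Real.sq_sqrt hA.le
  have e4 : √(w*C)^2 = w*C := Real.sq_sqrt hC.le
  have p1 := Real.sqrt_pos.2 hA
  have p2 := Real.sqrt_pos.2 hC
  refine Rep.scale (s := √√(u*A)) (t := √√(w*C)) ?_ (by positivity) (by positivity)
  convert h using 1
  · rw [show √√(u*A)^4 = (√√(u*A)^2)^2 by ring, e1, e3]; linear_combination A*hu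
  · rw [e1, e2, Real.sqrt_mul hA.le]; field_simp
  · rw [show √√(w*C)^4 = (√√(w*C)^2)^2 by ring, e2, e4]; linear_combination C*hw
theorem Rep.rot (h : Rep F u v u) : Rep F ((2*u+v)/16) ((12*u-2*v)/16) ((2*u+v)/16) := by
  obtain ⟨p, q, r, t, hd, h⟩ := h
  refine ⟨p+r, q+t, p-r, q-t, fun h' => hd (by linarith), fun x y => by rw [h]; simp only [SS]; ring⟩
theorem Rep.rotn {s : ℝ} (h : Rep F u (u*v) u) (hu : u^2 = 1) (hs : s^2 = 1) (hv : 0 < s*(2+v)) :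
    Rep F (s*u) (s*u*((12-2*v)/(2+v))) (s*u) := by
  have hk : s*u*((2*u+u*v)/16) = s*(2+v)/16 := by linear_combination s*(2+v)/16*hu
  have := h.rot.norm (u := s*u) (w := s*u) (by rw [mul_pow, hu, hs]; norm_num) (by rw [mul_pow, hu, hs]; norm_num)
    (by rw [hk]; positivity) (by rw [hk]; positivity)
  rw [hk, Real.sqrt_mul_self (by positivity)] at this
  convert this using 1
  have h2 : 2+v ≠ 0 := fun h => by rw [h] at hv; simp at hv
  have h3 : s ≠ 0 := by rintro rfl; norm_num at hs
  field_simp; linear_combination u*(12-2*v)*hs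

theorem nf0 {f : BQF} (h4 : f.realRoots.ncard = 4) (ha : f.a ≠ 0) :
    ∃ u v : ℝ, u^2 = 1 ∧ -6 ≤ v ∧ v < -2 ∧ Rep f.evalR u (u*v) u := by
  suffices ∃ u v : ℝ, u^2 = 1 ∧ v < -2 ∧ Rep f.evalR u (u*v) u by
    obtain ⟨u, v, hu, hv, h⟩ := this
    by_cases h6 : -6 ≤ v
    · exact ⟨u, v, hu, h6, hv, h⟩
    push Not at h6
    refine ⟨_, _, ?_, ?_, ?_, h.rotn (s := -1) hu (by norm_num) (by linarith)⟩
    · rw [mul_pow, hu]; norm_num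
    · rw [le_div_iff_of_neg (by linarith)]; linarith
    · rw [div_lt_iff_of_neg (by linarith)]; linarith
  obtain ⟨r1, r2, r3, r4, h12, h23, h34, h⟩ := four_roots h4
  set A := (r3-r1)*(r4-r1) with hA
  set C := (r3-r2)*(r4-r2) with hC
  set B := (r3-r1)*(r4-r2)+(r3-r2)*(r4-r1) with hB
  have hA0 : 0 < A := mul_pos (by linarith) (by linarith)
  have hC0 : 0 < C := mul_pos (by linarith) (by linarith)
  have hB0 : 0 < B := add_pos (mul_pos (by linarith) (by linarith)) (mul_pos (by linarith) (by linarith))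
  have hdisc : 4*(A*C) < B^2 := by
    have : B^2 - 4*(A*C) = ((r2-r1)*(r4-r3))^2 := by rw [hA, hB, hC]; ring
    have : 0 < ((r2-r1)*(r4-r3))^2 := pow_pos (mul_pos (by linarith) (by linarith)) 2
    linarith
  have hAs := Real.sq_sqrt hA0.le
  have hCs := Real.sq_sqrt hC0.le
  set σ := √C; set τ := √A
  have hσ : 0 < σ := Real.sqrt_pos.2 hC0
  have hτ : 0 < τ := Real.sqrt_pos.2 hA0
  set ρ := σ*τ with hρ
  have hρ0 : 0 < ρ := by positivity
  have hρ2 : ρ^2 = A*C := by rw [hρ, mul_pow, hAs, hCs]; ring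
  clear_value A B C σ τ ρ
  have hb2 : 2*ρ < B := lt_of_pow_lt_pow_left₀ 2 hB0.le (by rw [mul_pow, hρ2]; linarith)
  -- s = σ(U+V), t = τ(U-V)
  set k : ℝ := -f.a*(r2-r1)^2*ρ^2 with hk
  have hk0 : k ≠ 0 := by
    have : (f.a:ℝ) ≠ 0 := by exact_mod_cast ha
    have : r2-r1 ≠ 0 := by linarith
    exact mul_ne_zero (mul_ne_zero (neg_ne_zero.2 ‹_›) (pow_ne_zero _ ‹_›)) (pow_ne_zero _ hρ0.ne')
  clear_value k
  have hrep : Rep f.evalR (k*(B+2*ρ)) (k*(-2*B)) (k*(B-2*ρ)) := by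
    have hr : r2 - r1 ≠ 0 := by linarith
    refine ⟨(-1/σ+1/τ)/(2*(r2-r1)), (r2/σ-r1/τ)/(2*(r2-r1)), (-1/σ-1/τ)/(2*(r2-r1)), (r2/σ+r1/τ)/(2*(r2-r1)), ?_, ?_⟩
    · have : (-1/σ+1/τ)/(2*(r2-r1))*((r2/σ+r1/τ)/(2*(r2-r1))) - (r2/σ-r1/τ)/(2*(r2-r1))*((-1/σ-1/τ)/(2*(r2-r1)))
        = 1/(2*σ*τ*(r2-r1)) := by field_simp; ring
      rw [this]; positivity
    · intro x y
      rw [h]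
      obtain ⟨s, hs⟩ : ∃ s, s = (r2*y-x)/(r2-r1) := ⟨_, rfl⟩
      obtain ⟨t, ht⟩ : ∃ t, t = (x-r1*y)/(r2-r1) := ⟨_, rfl⟩
      have ex : x = r1*s+r2*t := by rw [hs, ht]; field_simp; ring
      have ey : y = s+t := by rw [hs, ht]; field_simp; ring
      have e1 : (-1/σ+1/τ)/(2*(r2-r1))*x + (r2/σ-r1/τ)/(2*(r2-r1))*y = (s/σ+t/τ)/2 := by
        rw [hs, ht]; field_simp; ring
      have e2 : (-1/σ-1/τ)/(2*(r2-r1))*x + (r2/σ+r1/τ)/(2*(r2-r1))*y = (s/σ-t/τ)/2 := by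
        rw [hs, ht]; field_simp; ring
      rw [e1, e2]
      obtain ⟨s', hs'⟩ : ∃ s', s' = s/σ := ⟨_, rfl⟩
      obtain ⟨t', ht'⟩ : ∃ t', t' = t/τ := ⟨_, rfl⟩
      rw [← hs', ← ht']
      have es : s = σ*s' := by rw [hs']; field_simp
      have et : t = τ*t' := by rw [ht']; field_simp
      have l1 : f.a*((x-r1*y)*(x-r2*y))*((x-r3*y)*(x-r4*y)) = -f.a*(r2-r1)^2*(s*t)*(A*s^2+B*s*t+C*t^2) := by
        rw [ex, ey, hA, hB, hC]; ring
      rw [l1, es, et, show A*(σ*s')^2+B*(σ*s')*(τ*t')+C*(τ*t')^2 = ρ*(ρ*s'^2+B*s'*t'+ρ*t'^2) by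
        rw [hρ]; linear_combination (-s'^2*σ^2)*hAs - t'^2*τ^2*hCs]
      simp only [SS]; rw [hk, hρ]; ring
  have hq : (0:ℝ) < (B+2*ρ)*(B-2*ρ) := mul_pos (by linarith) (by linarith)
  obtain ⟨u, hu, huk⟩ : ∃ u : ℝ, u^2 = 1 ∧ 0 < u*k := by
    rcases lt_or_gt_of_ne hk0 with h | h
    · exact ⟨-1, by norm_num, by linarith⟩
    · exact ⟨1, by norm_num, by linarith⟩
  have := hrep.norm hu hu (by rw [← mul_assoc]; exact mul_pos huk (by linarith))
    (by rw [← mul_assoc]; exact mul_pos huk (by linarith))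
  refine ⟨u, -2*B/√((B+2*ρ)*(B-2*ρ)), hu, ?_, ?_⟩
  · have hs := Real.sqrt_pos.2 hq
    rw [div_lt_iff₀ hs]
    have : √((B+2*ρ)*(B-2*ρ)) < B := by
      rw [Real.sqrt_lt' hB0]; have := pow_pos hρ0 2; linarith
    linarith
  · convert this using 1
    rw [show u*(k*(B+2*ρ))*(u*(k*(B-2*ρ))) = (u*k)^2*((B+2*ρ)*(B-2*ρ)) by ring,
      Real.sqrt_mul (sq_nonneg (u*k)), Real.sqrt_sq huk.le]
    have hs := (Real.sqrt_pos.2 hq).ne'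
    have : k ≠ 0 := hk0
    have : u ≠ 0 := by rintro rfl; norm_num at hu
    field_simp; linear_combination -hu

theorem nf12 {f : BQF} (hf : f.Irred) (h : f.realRoots.ncard ≤ 2) :
    ∃ α β : ℝ, Rep f.evalR α (α+β) β ∧ (f.realRoots.ncard = 2 → α*β < 0) ∧
      (f.realRoots.ncard = 0 → 0 < α*β) := by
  obtain ⟨s, t, A, B, D, ht, hF⟩ := nonreal hf h
  have ha : (f.a:ℝ) ≠ 0 := by exact_mod_cast hf.1
  set B' := (2*A*s+B)/t with hB'
  set D' := (A*s^2+B*s+D)/t^2 with hD'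
  set z : ℂ := ⟨A-D', B'⟩
  obtain ⟨θ, hθ⟩ : ∃ θ, θ = z.arg/2 := ⟨_, rfl⟩
  have h1 : ‖z‖*Real.cos z.arg = A-D' := Complex.norm_mul_cos_arg z
  have h2 : ‖z‖*Real.sin z.arg = B' := Complex.norm_mul_sin_arg z
  rw [show z.arg = 2*θ by linarith] at h1 h2
  rw [Real.cos_two_mul] at h1; rw [Real.sin_two_mul] at h2
  have hcs := Real.sin_sq_add_cos_sq θ
  set c := Real.cos θ; set S := Real.sin θ
  have hXY : -2*A*c*S + B'*(c^2-S^2) + 2*D'*c*S = 0 := by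
    rw [← h2]; linear_combination (2*c*S)*h1 - 2*‖z‖*S*c*hcs
  set α := A*c^2+B'*c*S+D'*S^2 with hα
  set β := A*S^2-B'*c*S+D'*c^2 with hβ
  clear h1 h2 hθ
  clear_value α β c S B' D'
  have hd : c*(S*s+c*t) - (-(c*s)+S*t)*(-S) ≠ 0 := by
    have : c*(S*s+c*t) - (-(c*s)+S*t)*(-S) = t := by linear_combination t*hcs
    rw [this]; exact ht.ne'
  have key : ∀ x y, f.evalR x y = SS α (α+β) β (c*x+(-(c*s)+S*t)*y) (-S*x+(S*s+c*t)*y) := by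
    intro x y
    set X := c*x+(-(c*s)+S*t)*y with hX
    set Y := -S*x+(S*s+c*t)*y with hY
    have eU : x - s*y = c*X-S*Y := by rw [hX, hY]; linear_combination (-(x-s*y))*hcs
    have eV : t*y = S*X+c*Y := by rw [hX, hY]; linear_combination (-(t*y))*hcs
    have hq : A*x^2+B*x*y+D*y^2 = A*(x-s*y)^2+B'*(x-s*y)*(t*y)+D'*(t*y)^2 := by
      rw [hB', hD']; field_simp; ring
    rw [hF, hq, eU, eV]
    have q1 : A*(c*X-S*Y)^2+B'*(c*X-S*Y)*(S*X+c*Y)+D'*(S*X+c*Y)^2 = α*X^2+β*Y^2 := by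
      rw [hα, hβ]; linear_combination X*Y*hXY
    have q2 : (c*X-S*Y)^2+(S*X+c*Y)^2 = X^2+Y^2 := by linear_combination (X^2+Y^2)*hcs
    rw [q1, q2]; simp only [SS]; ring
  generalize -(c*s)+S*t = q at key hd
  generalize S*s+c*t = t' at key hd
  generalize -S = r at key hd
  have hSS : ∀ X Y, SS α (α+β) β X Y = (X^2+Y^2)*(α*X^2+β*Y^2) := fun X Y => by simp only [SS]; ring
  simp only [hSS] at key
  refine ⟨α, β, ⟨c, q, r, t', hd, by simp only [hSS]; exact key⟩, fun h2 => ?_, fun h0 => ?_⟩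
  · obtain ⟨x1, x2, hne, hr⟩ := ncard_eq_two.1 h2
    have k1 : f.evalR x1 1 = 0 := (hr ▸ (by simp : x1 ∈ ({x1, x2}:Set ℝ)) : x1 ∈ f.realRoots)
    have k2 : f.evalR x2 1 = 0 := (hr ▸ (by simp : x2 ∈ ({x1, x2}:Set ℝ)) : x2 ∈ f.realRoots)
    have hz : ∀ x, c*x+q*1 = 0 → r*x+t'*1 = 0 → False := fun x e1 e2 => hd (by
      linear_combination c*e2 - r*e1)
    have hpos : ∀ x, 0 < (c*x+q*1)^2+(r*x+t'*1)^2 := fun x => by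
      rcases eq_or_ne (c*x+q*1) 0 with e | e
      · have : r*x+t'*1 ≠ 0 := hz x e
        positivity
      · positivity
    rw [key] at k1 k2
    have k1' := (mul_eq_zero.1 k1).resolve_left (hpos x1).ne'
    have k2' := (mul_eq_zero.1 k2).resolve_left (hpos x2).ne'
    by_contra! hcon
    rcases eq_or_ne α 0 with e | e
    · rcases eq_or_ne β 0 with e' | e'
      · have := key 1 0; rw [e, e'] at this; simp [evalR] at this; exact ha (by exact_mod_cast this)
      · simp [e, e'] at k1' k2'
        have : r*(x1-x2) = 0 := by linear_combination k1'-k2'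
        have hr0 : r = 0 := by simpa [sub_ne_zero.2 hne] using this
        rw [hr0] at k1'; simp at k1'; rw [hr0, k1'] at hd; simp at hd
    · rcases eq_or_ne β 0 with e' | e'
      · simp [e, e'] at k1' k2'
        have : c*(x1-x2) = 0 := by linear_combination k1'-k2'
        have hr0 : c = 0 := by simpa [sub_ne_zero.2 hne] using this
        rw [hr0] at k1'; simp at k1'; rw [hr0, k1'] at hd; simp at hd
      · have h3 : α^2*(c*x1+q*1)^2 + (α*β)*(r*x1+t'*1)^2 = 0 := by linear_combination α*k1'
        have h4 : 0 < α*β := lt_of_le_of_ne hcon (mul_ne_zero e e').symm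
        have h5 : (c*x1+q*1) = 0 := by
          by_contra hh
          have : 0 < α^2*(c*x1+q*1)^2 := by positivity
          have : 0 ≤ (α*β)*(r*x1+t'*1)^2 := by positivity
          linarith
        have h6 : (r*x1+t'*1) = 0 := by
          by_contra hh
          have : 0 ≤ α^2*(c*x1+q*1)^2 := by positivity
          have : 0 < (α*β)*(r*x1+t'*1)^2 := by positivity
          linarith
        exact hz _ h5 h6
  · have hemp : f.realRoots = ∅ := (ncard_eq_zero (roots_fin hf.1)).1 h0
    by_contra! hcon
    obtain ⟨X, Y, hXY0, hz⟩ : ∃ X Y : ℝ, (X ≠ 0 ∨ Y ≠ 0) ∧ α*X^2+β*Y^2 = 0 := by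
      rcases eq_or_ne α 0 with e | e
      · exact ⟨1, 0, by simp, by rw [e]; ring⟩
      · refine ⟨√(-(α*β)), α, Or.inr e, ?_⟩
        rw [Real.sq_sqrt (by linarith)]; ring
    set Δ := c*t'-q*r with hΔ
    have h1 := key ((t'*X-q*Y)/Δ) ((c*Y-r*X)/Δ)
    have e1 : c*((t'*X-q*Y)/Δ)+q*((c*Y-r*X)/Δ) = X := by field_simp; rw [hΔ]; ring
    have e2 : r*((t'*X-q*Y)/Δ)+t'*((c*Y-r*X)/Δ) = Y := by field_simp; rw [hΔ]; ring
    rw [e1, e2, hz, mul_zero] at h1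
    rcases eq_or_ne ((c*Y-r*X)/Δ) 0 with e | e
    · rw [e] at h1 e1 e2; simp [evalR, ha] at h1
      rcases h1 with h1 | h1
      · rw [h1] at e1 e2; simp at e1 e2; simp [← e1, ← e2] at hXY0
      · exact hd h1
    · have : ((t'*X-q*Y)/Δ)/((c*Y-r*X)/Δ) ∈ f.realRoots := by
        show f.evalR _ _ = 0
        generalize (t'*X-q*Y)/Δ = x at *
        generalize (c*Y-r*X)/Δ = y at *
        have : f.evalR x y = y^4*f.evalR (x/y) 1 := by simp only [evalR]; field_simp
        rw [this] at h1; simpa [e] using h1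
      rw [hemp] at this; exact this

/-- families with index -/
def TI (i : ℕ) (u v w T : ℝ) : Prop := (i = 0 ∧ u = 1 ∧ v = -6 ∧ w = 1 ∧ T = Real.pi/2) ∨
  (i = 1 ∧ u = 1 ∧ v = 0 ∧ w = -1 ∧ T = Real.pi) ∨ (i = 2 ∧ u = 1 ∧ v = 0 ∧ w = 1 ∧ T = Real.pi/2) ∨
  (i = 2 ∧ u = -1 ∧ v = 0 ∧ w = -1 ∧ T = Real.pi/2)
theorem TI.tt {i : ℕ} {T : ℝ} (h : TI i u v w T) : TT u v w T := by
  unfold TT; rcases h with h | h | h | h <;> tauto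

theorem NF {κ : ℝ} (hκ : 0 < κ) (hκ1 : κ ≤ 1) {i : ℕ} (hi : i ≤ 2) {f : BQF} (hf : f.Irred)
    (hn : f.realRoots.ncard = 4-2*i) : ∃ α β γ : ℝ, |α| ≤ 7 ∧ |β| ≤ 7 ∧ |γ| ≤ 7 ∧ Rep f.evalR α β γ ∧
      (κ ≤ |β*(36*α*γ-β^2)| ∨ ∃ u v w T, TI i u v w T ∧ α = u ∧ γ = w ∧ |β-v| ≤ κ) := by
  have one : ∀ u : ℝ, u^2 = 1 → |u| = 1 := fun u hu => by rcases sq_one (by rw [show (4:ℕ) = 2*2 from rfl, pow_mul, hu]; norm_num) with h | h <;> simp [h]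
  interval_cases i
  · obtain ⟨u, v, hu, h1, h2, h⟩ := nf0 hn hf.1
    by_cases h6 : v ≤ -6+κ/2
    · have hc : u = 1 ∨ u = -1 := sq_one (by rw [show (4:ℕ) = 2*2 from rfl, pow_mul, hu]; norm_num)
      rcases hc with rfl | rfl
      · refine ⟨1, 1*v, 1, by norm_num, by rw [abs_le]; constructor <;> linarith, by norm_num, h,
          Or.inr ⟨1, -6, 1, _, Or.inl ⟨rfl, rfl, rfl, rfl, rfl⟩, rfl, rfl, by rw [abs_le]; constructor <;> linarith⟩⟩
      · have h' := h.rotn (s := -1) hu (by norm_num) (by linarith)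
        norm_num at h'
        have e1 : -6-κ ≤ (12-2*v)/(2+v) := by
          rw [le_div_iff_of_neg (by linarith)]; nlinarith
        have e2 : (12-2*v)/(2+v) ≤ -6 := by
          rw [div_le_iff_of_neg (by linarith)]; linarith
        refine ⟨1, _, 1, by norm_num, by rw [abs_le]; constructor <;> linarith, by norm_num, h',
          Or.inr ⟨1, -6, 1, _, Or.inl ⟨rfl, rfl, rfl, rfl, rfl⟩, rfl, rfl, by rw [abs_le]; constructor <;> linarith⟩⟩
    · push Not at h6
      refine ⟨u, u*v, u, by rw [one u hu]; norm_num, ?_, by rw [one u hu]; norm_num, h, Or.inl ?_⟩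
      · rw [abs_mul, one u hu, one_mul, abs_le]; constructor <;> linarith
      · have : u*v*(36*u*u-(u*v)^2) = u*(v*(36-v^2)) := by linear_combination (36*u*v-u*v^3)*hu
        rw [this, abs_mul, one u hu, one_mul, abs_mul, abs_of_neg (by linarith : v < 0),
          show 36-v^2 = (6+v)*(6-v) by ring, abs_of_pos (mul_pos (by linarith) (by linarith))]
        have : κ/2 * 8 ≤ (6+v)*(6-v) := mul_le_mul (by linarith) (by linarith) (by norm_num) (by linarith)
        have := mul_le_mul (by linarith : (1:ℝ) ≤ -v) this (by positivity) (by linarith)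
        linarith
  · obtain ⟨α, β, h, h', -⟩ := nf12 hf (by omega)
    have hs := h' hn
    obtain ⟨v, hv⟩ : ∃ v, Rep f.evalR 1 v (-1) := by
      rcases lt_or_ge α 0 with e | e
      · exact ⟨_, h.swap.norm (u := 1) (w := -1) (by norm_num) (by norm_num)
          (by rw [one_mul]; exact pos_of_mul_neg_right hs e.le) (by linarith)⟩
      · exact ⟨_, h.norm (u := 1) (w := -1) (by norm_num) (by norm_num) (by
          have : α ≠ 0 := by rintro rfl; simp at hs
          have := lt_of_le_of_ne e this.symm; linarith) (by have := neg_of_mul_neg_right hs e; linarith)⟩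
    by_cases e1 : |v| ≤ κ
    · exact ⟨1, v, -1, by norm_num, by linarith, by norm_num, hv, Or.inr
        ⟨1, 0, -1, _, Or.inr (Or.inl ⟨rfl, rfl, rfl, rfl, rfl⟩), rfl, rfl, by simpa using e1⟩⟩
    push Not at e1
    by_cases e2 : |v| ≤ 1
    · refine ⟨1, v, -1, by norm_num, by linarith, by norm_num, hv, Or.inl ?_⟩
      rw [abs_mul, abs_of_neg (by linarith [sq_nonneg v] : 36*1*(-1)-v^2 < 0)]
      have := mul_le_mul e1.le (by linarith [sq_nonneg v] : 1 ≤ -(36*1*(-1)-v^2)) (by norm_num) (abs_nonneg v)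
      linarith
    · push Not at e2
      have hv0 : 0 < |v| := by linarith
      refine ⟨1/|v|, v/|v|, -1/|v|, ?_, ?_, ?_, Rep.scale (s := √√|v|) (t := √√|v|) ?_ (by positivity) (by positivity), Or.inl ?_⟩
      · rw [abs_div, abs_abs, abs_one, div_le_iff₀ hv0]; linarith
      · rw [abs_div, abs_abs, div_le_iff₀ hv0]; linarith
      · rw [abs_div, abs_abs, abs_neg, abs_one, div_le_iff₀ hv0]; linarith
      · obtain ⟨K, hK⟩ : ∃ K, K = |v| := ⟨_, rfl⟩
        rw [← hK] at hv0 ⊢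
        have h1 : √√K^2 = √K := Real.sq_sqrt (by positivity)
        have h4 : √√K^4 = K := by
          rw [show √√K^4 = (√√K^2)^2 by ring, h1, Real.sq_sqrt hv0.le]
        convert hv using 1
        · rw [h4]; field_simp
        · rw [mul_assoc, show √√K^2*√√K^2 = √√K^4 by ring, h4]; field_simp
        · rw [h4]; field_simp
      · obtain ⟨K, hK⟩ : ∃ K, K = |v| := ⟨_, rfl⟩
        have hK2 : v^2 = K^2 := by rw [hK, sq_abs]
        rw [← hK] at hv0 e2
        have h1 : v/K*(36*(1/K)*(-1/K)-(v/K)^2) = v/K*(-(36/K^2+1)) := by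
          rw [div_pow, hK2]; field_simp; ring
        rw [← hK, h1, abs_mul, abs_neg, abs_div, ← hK, abs_of_pos hv0, div_self hv0.ne', one_mul,
          abs_of_pos (by positivity)]
        have : 0 < 36/K^2 := by positivity
        linarith
  · obtain ⟨α, β, h, -, h'⟩ := nf12 hf (by omega)
    have hs := h' hn
    obtain ⟨u, hu, hα, hβ⟩ : ∃ u : ℝ, (u = 1 ∨ u = -1) ∧ 0 < u*α ∧ 0 < u*β := by
      rcases lt_or_ge α 0 with e | e
      · exact ⟨-1, Or.inr rfl, by linarith, by have := neg_of_mul_pos_right hs e.le; linarith⟩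
      · have h0 : α ≠ 0 := by rintro rfl; simp at hs
        have := lt_of_le_of_ne e h0.symm
        exact ⟨1, Or.inl rfl, by linarith, by have := pos_of_mul_pos_right hs e; linarith⟩
    have hu2 : u^2 = 1 := by rcases hu with rfl | rfl <;> norm_num
    have k := h.norm hu2 hu2 hα hβ
    set R := √(u*α*(u*β)) with hR
    have hR0 : 0 < R := Real.sqrt_pos.2 (by positivity)
    have hR2 : R^2 = u*α*(u*β) := Real.sq_sqrt (by positivity)
    set v := u*(α+β)/R with hv
    have hv2 : 2 ≤ v := by
      rw [hv, le_div_iff₀ hR0]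
      refine le_of_sq_le_sq' ?_ (by linarith)
      have := sq_nonneg (u*α-u*β)
      rw [mul_pow, hR2]; linarith
    have k' : Rep f.evalR u (u*v) u := by
      convert k using 1; rw [hv]; field_simp; rw [hu2]; ring
    have k2 := k'.rotn (s := 1) hu2 (by norm_num) (by linarith)
    rw [one_mul] at k2
    have e1 : (12-2*v)/(2+v) ≤ 2 := by rw [div_le_iff₀ (by linarith)]; linarith
    have e2 : -2 ≤ (12-2*v)/(2+v) := by rw [le_div_iff₀ (by linarith)]; linarith
    obtain ⟨m, hm⟩ : ∃ m, m = (12-2*v)/(2+v) := ⟨_, rfl⟩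
    rw [← hm] at e1 e2 k2
    clear hv2 k' hv k hR2 hR0 hR
    have hum : |u*m| = |m| := by rw [abs_mul, one u hu2, one_mul]
    have hm2 : |m| ≤ 2 := abs_le.2 ⟨e2, e1⟩
    refine ⟨u, u*m, u, by rw [one u hu2]; norm_num, by rw [hum]; linarith, by rw [one u hu2]; norm_num, k2, ?_⟩
    by_cases e3 : |m| ≤ κ
    · right
      refine ⟨u, 0, u, Real.pi/2, ?_, rfl, rfl, by rw [sub_zero, hum]; exact e3⟩
      rcases hu with rfl | rfl
      · exact Or.inr (Or.inr (Or.inl ⟨rfl, rfl, rfl, rfl, rfl⟩))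
      · exact Or.inr (Or.inr (Or.inr ⟨rfl, rfl, rfl, rfl, rfl⟩))
    · left
      push Not at e3
      have : u*m*(36*u*u-(u*m)^2) = u*m*(36-m^2) := by linear_combination (36*u*m-u*m^3)*hu2
      have hmm : m^2 ≤ 4 := by have := pow_le_pow_left₀ (abs_nonneg m) hm2 2; rw [sq_abs] at this; linarith
      rw [this, abs_mul, hum, abs_of_pos (by linarith : 0 < 36-m^2)]
      have := mul_le_mul e3.le (by linarith : 1 ≤ 36-m^2) (by norm_num) (abs_nonneg m)
      linarith
end BQF
end

section
open Set MeasureTheory Filter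
open scoped ENNReal
namespace BQF
def MG (g : BQF) (α β γ p q r t : ℝ) : Prop := ∀ x y, g.evalR x y = SS α β γ (p*x+q*y) (r*x+t*y)

theorem ang {p r : ℝ} (h : 0 < p^2+r^2) : ∃ θ ρ : ℝ, 0 < ρ ∧ ρ^2 = p^2+r^2 ∧ p = ρ*Real.cos θ ∧ r = ρ*Real.sin θ ∧
    ((0 < r ∨ (r = 0 ∧ 0 < p)) → 0 ≤ θ ∧ θ < Real.pi) ∧ ((0 < p ∧ 0 ≤ r) → 0 ≤ θ ∧ θ < Real.pi/2) := by
  set z : ℂ := ⟨p, r⟩ with hz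
  have hn : ‖z‖^2 = p^2+r^2 := by rw [Complex.sq_norm, Complex.normSq_apply, hz]; ring
  have hr : z.im = r := rfl
  have hp : z.re = p := rfl
  refine ⟨z.arg, ‖z‖, ?_, hn, (Complex.norm_mul_cos_arg z).symm, (Complex.norm_mul_sin_arg z).symm, fun h' => ⟨?_, ?_⟩, fun h' => ⟨?_, ?_⟩⟩
  · have := norm_nonneg z; by_contra! hc
    have : ‖z‖ = 0 := le_antisymm hc this
    rw [this] at hn; linarith
  · rw [Complex.arg_nonneg_iff, hr]; rcases h' with h' | h' <;> linarith
  · refine lt_of_le_of_ne (Complex.arg_le_pi z) fun he => ?_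
    rw [Complex.arg_eq_pi_iff, hr, hp] at he
    rcases h' with h' | h' <;> linarith
  · rw [Complex.arg_nonneg_iff, hr]; linarith
  · rw [Complex.arg_lt_pi_div_two_iff, hp]; exact Or.inl h'.1

theorem mk_z {g : BQF} {α β γ p q r t : ℝ} (hd : 0 < p*t-q*r) (h : MG g α β γ p q r t) :
    ∃ z : E4, 0 < z 0 ∧ 0 < z 3 ∧ z 2 = (p*q+r*t)/(p^2+r^2) ∧ z 3 = (p*t-q*r)/(p^2+r^2) ∧
      0 ≤ z 1 ∧ z 1 < Real.pi ∧ (α = γ → z 1 < Real.pi/2) ∧ ∀ x y, g.evalR x y = FR α β γ z x y := by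
  have hpr : ∀ {p q r t : ℝ}, 0 < p*t-q*r → 0 < p^2+r^2 := fun {p q r t} hd => by
    rcases eq_or_ne p 0 with rfl | e
    · rcases eq_or_ne r 0 with rfl | e
      · simp at hd
      · positivity
    · positivity
  have main : ∀ p q r t : ℝ, 0 < p*t-q*r → MG g α β γ p q r t → (∃ T, T ≤ Real.pi ∧ (α = γ → T ≤ Real.pi/2) ∧
     ((0 < r ∨ (r = 0 ∧ 0 < p)) ∧ T = Real.pi ∨ (0 < p ∧ 0 ≤ r) ∧ T = Real.pi/2)) → ∃ z : E4, 0 < z 0 ∧ 0 < z 3 ∧ z 2 = (p*q+r*t)/(p^2+r^2) ∧ z 3 = (p*t-q*r)/(p^2+r^2) ∧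
      0 ≤ z 1 ∧ z 1 < Real.pi ∧ (α = γ → z 1 < Real.pi/2) ∧ ∀ x y, g.evalR x y = FR α β γ z x y := by
    intro p q r t hd h ⟨T, hT, hT2, hTT⟩
    have hR := hpr hd
    obtain ⟨θ, ρ, hρ, hρ2, hp, hr, h1, h2⟩ := ang hR
    have hθ : 0 ≤ θ ∧ θ < T := by
      rcases hTT with ⟨a, rfl⟩ | ⟨a, rfl⟩
      · exact h1 a
      · exact h2 a
    have h3 : 0 < (p*t-q*r)/(p^2+r^2) := by positivity
    set z : E4 := ![p*t-q*r, θ, (p*q+r*t)/(p^2+r^2), (p*t-q*r)/(p^2+r^2)] with hz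
    have hmu : mu z = ρ := by
      show √((p*t-q*r)/((p*t-q*r)/(p^2+r^2))) = ρ
      rw [div_div_cancel₀ hd.ne', ← hρ2, Real.sqrt_sq hρ.le]
    refine ⟨z, hd, h3, rfl, rfl, hθ.1, hθ.2.trans_le hT, fun h => hθ.2.trans_le (hT2 h), fun x y => ?_⟩
    rw [h, FR_eq hd h3]
    have ep : mp z = p := by rw [mp, hmu, hp]; rfl
    have er : mr z = r := by rw [mr, hmu, hr]; rfl
    have eq : mq z = q := by
      have : mq z = mp z*z 2 - mr z*z 3 := by simp only [mq, mp, mr]; ring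
      rw [this, ep, er, hz]; simp; field_simp; ring
    have et : mt z = t := by
      have : mt z = mr z*z 2 + mp z*z 3 := by simp only [mt, mp, mr]; ring
      rw [this, ep, er, hz]; simp; field_simp; ring
    rw [ep, er, eq, et]
  have neg : ∀ {p q r t : ℝ}, MG g α β γ p q r t → MG g α β γ (-p) (-q) (-r) (-t) := fun h x y => by
    rw [h]; simp only [SS]; ring
  have hR := hpr hd
  by_cases hα : α = γ
  · have rot : ∀ {p q r t : ℝ}, MG g α β γ p q r t → MG g α β γ r t (-p) (-q) := fun h x y => by
      rw [h]; simp only [SS, hα]; ring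
    have hT : ∀ p r : ℝ, 0 < p → 0 ≤ r → (∃ T, T ≤ Real.pi ∧ (α = γ → T ≤ Real.pi/2) ∧
     ((0 < r ∨ (r = 0 ∧ 0 < p)) ∧ T = Real.pi ∨ (0 < p ∧ 0 ≤ r) ∧ T = Real.pi/2)) := fun p r h1 h2 =>
      ⟨Real.pi/2, by linarith [Real.pi_pos], fun _ => le_rfl, Or.inr ⟨⟨h1, h2⟩, rfl⟩⟩
    rcases lt_or_ge 0 p with h1 | h1
    · rcases le_or_gt 0 r with h2 | h2
      · exact main _ _ _ _ hd h (hT _ _ h1 h2)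
      · obtain ⟨z, a, b, c, d, e⟩ := main _ _ _ _ (by linarith) (neg (rot h)) (hT _ _ (by linarith) (by linarith))
        refine ⟨z, a, b, ?_, ?_, e⟩
        · rw [c]; ring
        · rw [d]; ring
    · rcases lt_or_ge 0 r with h2 | h2
      · obtain ⟨z, a, b, c, d, e⟩ := main _ _ _ _ (by linarith) (rot h) (hT _ _ (by linarith) (by linarith))
        refine ⟨z, a, b, ?_, ?_, e⟩
        · rw [c]; ring
        · rw [d]; ring
      · rcases h1.lt_or_eq with h1 | h1
        · obtain ⟨z, a, b, c, d, e⟩ := main _ _ _ _ (by linarith) (neg h) (hT _ _ (by linarith) (by linarith))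
          refine ⟨z, a, b, ?_, ?_, e⟩
          · rw [c]; ring
          · rw [d]; ring
        · have h2 : r < 0 := lt_of_le_of_ne h2 (by rintro rfl; rw [h1] at hR; simp at hR)
          obtain ⟨z, a, b, c, d, e⟩ := main _ _ _ _ (by linarith) (neg (rot h)) (hT _ _ (by linarith) (by linarith))
          refine ⟨z, a, b, ?_, ?_, e⟩
          · rw [c]; ring
          · rw [d]; ring
  · have hT : ∀ p r : ℝ, (0 < r ∨ (r = 0 ∧ 0 < p)) → (∃ T, T ≤ Real.pi ∧ (α = γ → T ≤ Real.pi/2) ∧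
     ((0 < r ∨ (r = 0 ∧ 0 < p)) ∧ T = Real.pi ∨ (0 < p ∧ 0 ≤ r) ∧ T = Real.pi/2)) := fun p r h1 =>
      ⟨Real.pi, le_rfl, fun h => absurd h hα, Or.inl ⟨h1, rfl⟩⟩
    by_cases h1 : 0 < r ∨ (r = 0 ∧ 0 < p)
    · exact main _ _ _ _ hd h (hT _ _ h1)
    · push Not at h1
      obtain ⟨z, a, b, c, d, e⟩ := main _ _ _ _ (by linarith) (neg h) (hT (-p) (-r) (by
        rcases h1.1.lt_or_eq with h2 | h2
        · left; linarith
        · have := h1.2 h2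
          have h3 : p ≠ 0 := by rintro rfl; rw [h2] at hR; simp at hR
          have := lt_of_le_of_ne this h3
          right; constructor <;> linarith))
      refine ⟨z, a, b, ?_, ?_, e⟩
      · rw [c]; ring
      · rw [d]; ring

theorem MG.sub {g : BQF} {α β γ p q r t : ℝ} (h : MG g α β γ p q r t) (m k l o : ℤ) :
    MG (g.sub m k l o) α β γ (p*m+q*l) (p*k+q*o) (r*m+t*l) (r*k+t*o) := fun x y => by
  rw [evalR_sub, h]; congr 1 <;> ring

open scoped UpperHalfPlane MatrixGroups in
theorem red_fd {p q r t : ℝ} (hd : 0 < p*t-q*r) : ∃ m k l o : ℤ, m*o-k*l = 1 ∧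
    let p' := p*m+q*l; let q' := p*k+q*o; let r' := r*m+t*l; let t' := r*k+t*o
    |(p'*q'+r'*t')/(p'^2+r'^2)| ≤ 1/2 ∧ 1 ≤ ((p'*q'+r'*t')/(p'^2+r'^2))^2 + ((p'*t'-q'*r')/(p'^2+r'^2))^2 := by
  have hre : ∀ p q r t : ℝ, ((⟨q, t⟩ : ℂ)/⟨p, r⟩).re = (p*q+r*t)/(p^2+r^2) := fun p q r t => by
    rw [Complex.div_re, Complex.normSq_apply]; ring
  have him : ∀ p q r t : ℝ, ((⟨q, t⟩ : ℂ)/⟨p, r⟩).im = (p*t-q*r)/(p^2+r^2) := fun p q r t => by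
    rw [Complex.div_im, Complex.normSq_apply]; ring
  have hR : 0 < p^2+r^2 := by
    rcases eq_or_ne p 0 with rfl | e
    · rcases eq_or_ne r 0 with rfl | e
      · simp at hd
      · positivity
    · positivity
  let τ : ℍ := ⟨(⟨q, t⟩ : ℂ)/⟨p, r⟩, by rw [him]; positivity⟩
  obtain ⟨γ, hγ⟩ := ModularGroup.exists_smul_mem_fd τ
  refine ⟨γ 1 1, γ 0 1, γ 1 0, γ 0 0, ?_, ?_⟩
  · have := γ.det_coe; rw [Matrix.det_fin_two] at this; linarith
  intro p' q' r' t'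
  have key : ((γ • τ : ℍ) : ℂ) = (⟨q', t'⟩ : ℂ)/⟨p', r'⟩ := by
    rw [UpperHalfPlane.coe_specialLinearGroup_apply]
    have h0 : (⟨p, r⟩ : ℂ) ≠ 0 := by
      intro h; rw [Complex.ext_iff] at h; simp at h; rw [h.1, h.2] at hR; simp at hR
    have e1 : (⟨q', t'⟩ : ℂ) = (γ 0 0 : ℂ)*⟨q, t⟩ + (γ 0 1 : ℂ)*⟨p, r⟩ := by
      apply Complex.ext <;> simp [q', t'] <;> ring
    have e2 : (⟨p', r'⟩ : ℂ) = (γ 1 0 : ℂ)*⟨q, t⟩ + (γ 1 1 : ℂ)*⟨p, r⟩ := by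
      apply Complex.ext <;> simp [p', r'] <;> ring
    have e3 : (τ : ℂ) = (⟨q, t⟩ : ℂ)/⟨p, r⟩ := rfl
    rw [e1, e2, e3]; simp only [algebraMap_int_eq, eq_intCast, Complex.ofReal_intCast]
    rw [← mul_div_mul_right _ _ h0]; congr 1 <;> field_simp
  obtain ⟨h1, h2⟩ := hγ
  rw [key, Complex.normSq_apply, hre, him] at h1
  rw [← UpperHalfPlane.coe_re, key, hre] at h2
  exact ⟨h2, by linarith⟩

theorem Red {f : BQF} {α β γ : ℝ} (h : Rep f.evalR α β γ) : ∃ g : BQF, ∃ z : E4, Equivalent f g ∧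
    0 < z 0 ∧ 0 < z 3 ∧ 0 ≤ z 2 ∧ z 2 ≤ 1/2 ∧ 1 ≤ z 2^2+z 3^2 ∧ 0 ≤ z 1 ∧ z 1 < Real.pi ∧
      (α = γ → z 1 < Real.pi/2) ∧ ∀ x y, g.evalR x y = FR α β γ z x y := by
  obtain ⟨p, q, r, t, hd, h⟩ : ∃ p q r t : ℝ, 0 < p*t-q*r ∧ MG f α β γ p q r t := by
    obtain ⟨p, q, r, t, hd, h⟩ := h
    rcases lt_or_gt_of_ne hd with hd | hd
    · exact ⟨p, q, -r, -t, by linarith, fun x y => by rw [h]; simp only [SS]; ring⟩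
    · exact ⟨p, q, r, t, hd, h⟩
  obtain ⟨m, k, l, o, hdet, h1, h2⟩ := red_fd hd
  have hdR : (m:ℝ)*o-k*l = 1 := by exact_mod_cast hdet
  have hd' : 0 < (p*m+q*l)*(r*k+t*o)-(p*k+q*o)*(r*m+t*l) := by
    have : (p*m+q*l)*(r*k+t*o)-(p*k+q*o)*(r*m+t*l) = p*t-q*r := by linear_combination (p*t-q*r)*hdR
    rw [this]; exact hd
  have hM := h.sub m k l o
  have heq : Equivalent f (f.sub m k l o) := equiv_iff.2 ⟨m, k, l, o, Or.inl hdet, rfl⟩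
  clear h
  obtain ⟨P, hP⟩ : ∃ P, P = p*m+q*l := ⟨_, rfl⟩
  obtain ⟨Q, hQ⟩ : ∃ P, P = p*k+q*o := ⟨_, rfl⟩
  obtain ⟨R, hR⟩ : ∃ P, P = r*m+t*l := ⟨_, rfl⟩
  obtain ⟨T, hT⟩ : ∃ P, P = r*k+t*o := ⟨_, rfl⟩
  rw [← hP, ← hQ, ← hR, ← hT] at h1 h2 hd' hM
  rw [abs_le] at h1
  rcases le_or_gt 0 ((P*Q+R*T)/(P^2+R^2)) with hx | hx
  · obtain ⟨z, a, b, c, d, e⟩ := mk_z hd' hM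
    refine ⟨_, z, heq, a, b, ?_, ?_, ?_, e⟩
    · rw [c]; exact hx
    · rw [c]; exact h1.2
    · rw [c, d]; exact h2
  · have hM2 : MG ((f.sub m k l o).sub 1 0 0 (-1)) α β γ P (-Q) (-R) T := fun x y => by
      rw [hM.sub 1 0 0 (-1) x y]; push_cast; simp only [SS]; ring
    obtain ⟨z, a, b, c, d, e⟩ := mk_z (by linarith) hM2
    have c' : z 2 = -((P*Q+R*T)/(P^2+R^2)) := by rw [c]; ring
    have d' : z 3 = (P*T-Q*R)/(P^2+R^2) := by rw [d]; ring
    refine ⟨_, z, heq.trans (equiv_iff.2 ⟨1, 0, 0, -1, by norm_num, rfl⟩), a, b, ?_, ?_, ?_, e⟩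
    · rw [c']; linarith
    · rw [c']; linarith
    · rw [c', d']; linarith
end BQF
end

section
open Set MeasureTheory Filter
open scoped ENNReal
namespace BQF
open Polynomial in
theorem irr_ne {f : BQF} (hf : f.Irred) {x y : ℤ} (h : x ≠ 0 ∨ y ≠ 0) : f.evalZ x y ≠ 0 := by
  intro h0
  have ha : (f.a:ℚ) ≠ 0 := by exact_mod_cast hf.1
  rcases eq_or_ne y 0 with rfl | hy
  · simp [evalZ, hf.1] at h0; simp [h0] at h
  · have h1 := degree_eq_one_of_irreducible_of_root hf.2 (x := (x:ℚ)/y) (by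
      have hy' : (y:ℚ) ≠ 0 := by exact_mod_cast hy
      have h2 : (f.a:ℚ)*x^4+f.b*x^3*y+f.c*x^2*y^2+f.d*x*y^3+f.e*y^4 = 0 := by exact_mod_cast h0
      simp only [IsRoot, eval_add, eval_mul, eval_pow, eval_C, eval_X]
      field_simp; linear_combination h2)
    have h2 : degree (C (f.a : ℚ) * X ^ 4 + C (f.b : ℚ) * X ^ 3 + C (f.c : ℚ) * X ^ 2 + C (f.d : ℚ) * X + C (f.e : ℚ)) = 4 := by
      compute_degree!
      exact hf.1
    rw [h2] at h1; norm_num at h1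

theorem Equivalent.a_ne {f g : BQF} (hf : f.Irred) (h : Equivalent f g) : g.a ≠ 0 := by
  obtain ⟨m, k, l, o, hd, rfl⟩ := equiv_iff.1 h
  have : (f.sub m k l o).a = f.evalZ m l := rfl
  rw [this]; refine irr_ne hf ?_
  by_contra! hc; rw [hc.1, hc.2] at hd; simp at hd

theorem translate {g : BQF} (ha : g.a ≠ 0) : ∃ g', Equivalent g g' ∧ g'.a = g.a ∧ |g'.b| ≤ 2*|g'.a| ∧ g'.Hz = g.Hz := by
  refine ⟨g.sub 1 (-round ((g.b:ℚ)/(4*g.a))) 0 1, equiv_iff.2 ⟨_, _, _, _, Or.inl (by ring), rfl⟩, by simp [sub], ?_,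
    by simp only [Hz, sub]; ring⟩
  have h := abs_sub_round ((g.b:ℚ)/(4*g.a))
  generalize round ((g.b:ℚ)/(4*g.a)) = k at *
  have ha' : (g.a:ℚ) ≠ 0 := by exact_mod_cast ha
  have e1 : (g.sub 1 (-k) 0 1).b = g.b - 4*g.a*k := by simp only [sub]; ring
  have e2 : (g.sub 1 (-k) 0 1).a = g.a := by simp [sub]
  rw [e1, e2]
  have : |((g.b - 4*g.a*k : ℤ):ℚ)| ≤ 2*|(g.a:ℚ)| := by
    have : ((g.b - 4*g.a*k : ℤ):ℚ) = (g.b/(4*g.a) - k)*(4*g.a) := by push_cast; field_simp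
    rw [this, abs_mul, abs_mul 4, abs_of_pos (by norm_num : (0:ℚ) < 4)]
    have := mul_le_mul_of_nonneg_right h (by positivity : 0 ≤ 4*|(g.a:ℚ)|)
    linarith
  exact_mod_cast this

theorem FR_coef {g : BQF} {u v w : ℝ} {z : E4} (h : ∀ x y, g.evalR x y = FR u v w z x y) :
    (g.a:ℝ) = Pa u v w z ∧ (g.b:ℝ) = Pb u v w z ∧ (g.c:ℝ) = Pc u v w z ∧ (g.d:ℝ) = Pd u v w z ∧ (g.e:ℝ) = Pe u v w z :=
  coef_eq h
theorem FR_inv {g : BQF} {u v w : ℝ} {z : E4} (h : ∀ x y, g.evalR x y = FR u v w z x y) (hy : z 3 ≠ 0) :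
    (g.I:ℝ) = z 0^4*(12*u*w+v^2) ∧ (g.J:ℝ) = z 0^6*(2*v*(36*u*w-v^2)) ∧
      (g.Hz:ℝ) = z 0^4 * ((z 3)⁻¹)^2 * HA u v w (z 1) := by
  obtain ⟨ha, hb, hc, hd, he⟩ := FR_coef h
  refine ⟨?_, ?_, ?_⟩
  · rw [← I_PP u v w z hy]; simp only [I]; push_cast; rw [ha, hb, hc, hd, he]
  · rw [← J_PP u v w z hy]; simp only [J]; push_cast; rw [ha, hb, hc, hd, he]
  · rw [← Hr_PP u v w z hy]; simp only [Hz, Hr, PP, Matrix.cons_val]; push_cast; rw [ha, hb, hc]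

theorem A0_le {u v w : ℝ} (hu : |u| ≤ 7) (hv : |v| ≤ 7) (hw : |w| ≤ 7) (t : ℝ) : |A0 u v w t| ≤ 21 := by
  have hc := Real.cos_sq_add_sin_sq t
  have h1 : Real.cos t^2 ≤ 1 := by nlinarith [sq_nonneg (Real.sin t)]
  have h2 : Real.sin t^2 ≤ 1 := by nlinarith [sq_nonneg (Real.cos t)]
  rw [abs_le] at *
  have e : A0 u v w t = u*(Real.cos t^2*Real.cos t^2) + v*(Real.cos t^2*Real.sin t^2) + w*(Real.sin t^2*Real.sin t^2) := by
    simp only [A0]; ring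
  have hb : ∀ x y : ℝ, 0 ≤ x → x ≤ 1 → 0 ≤ y → y ≤ 1 → 0 ≤ x*y ∧ x*y ≤ 1 := fun x y a b c d =>
    ⟨mul_nonneg a c, mul_le_one₀ b c d⟩
  have hk : ∀ u x : ℝ, -7 ≤ u → u ≤ 7 → 0 ≤ x ∧ x ≤ 1 → -7 ≤ u*x ∧ u*x ≤ 7 := fun u x a b c => by
    constructor <;> nlinarith
  have k1 := hk u _ hu.1 hu.2 (hb _ _ (sq_nonneg _) h1 (sq_nonneg _) h1)
  have k2 := hk v _ hv.1 hv.2 (hb _ _ (sq_nonneg _) h1 (sq_nonneg _) h2)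
  have k3 := hk w _ hw.1 hw.2 (hb _ _ (sq_nonneg _) h2 (sq_nonneg _) h2)
  rw [e]; constructor <;> linarith
theorem HA_le {u v w : ℝ} (hu : |u| ≤ 7) (hv : |v| ≤ 7) (hw : |w| ≤ 7) (t : ℝ) : |HA u v w t| ≤ 4200 := by
  have h0 := A0_le hu hv hw t
  rw [HA_eq]
  have hc := Real.cos_sq_add_sin_sq t
  have h1 : (Real.cos t*Real.sin t)^2 ≤ 1 := by
    rw [mul_pow]; exact mul_le_one₀ (by nlinarith [sq_nonneg (Real.sin t)]) (sq_nonneg _) (by nlinarith [sq_nonneg (Real.cos t)])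
  have e1 : |8*v*A0 u v w t| ≤ 8*7*21 := by
    rw [abs_mul, abs_mul, abs_of_pos (by norm_num : (0:ℝ) < 8)]
    exact mul_le_mul (by linarith) h0 (abs_nonneg _) (by norm_num)
  have e2 : |48*u*w-12*v^2| ≤ 48*7*7+12*7^2 := by
    refine (abs_sub _ _).trans ?_
    rw [abs_mul, abs_mul, abs_mul, abs_pow]; norm_num
    have := mul_le_mul hu hw (abs_nonneg _) (by norm_num)
    have := mul_le_mul hv hv (abs_nonneg _) (by norm_num)
    rw [← pow_two, sq_abs] at this; linarith
  have e3 : |(48*u*w-12*v^2)*(Real.cos t*Real.sin t)^2| ≤ (48*7*7+12*7^2)*1 := by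
    rw [abs_mul, abs_of_nonneg (sq_nonneg (Real.cos t*Real.sin t))]
    exact mul_le_mul e2 h1 (sq_nonneg _) (by norm_num)
  refine (abs_add_le _ _).trans ?_
  linarith

/-- reduced domain -/
def ZC (z : E4) : Prop := 0 < z 0 ∧ 0 < z 3 ∧ 0 ≤ z 2 ∧ z 2 ≤ 1/2 ∧ 1 ≤ z 2^2+z 3^2 ∧ 0 ≤ z 1
theorem ZC.y {z : E4} (h : ZC z) : 3/4 ≤ z 3^2 ∧ ((z 3)⁻¹)^2 ≤ 4/3 := by
  obtain ⟨_, h3, h2, h2', h1, _⟩ := h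
  have : 3/4 ≤ z 3^2 := by nlinarith
  refine ⟨this, ?_⟩
  rw [inv_pow, show (4/3:ℝ) = (3/4)⁻¹ by norm_num]
  exact inv_anti₀ (by norm_num) this

theorem TI.c {i : ℕ} {u v w T β : ℝ} (h : TI i u v w T) (hβ : |β-v| ≤ 1) :
    |u| ≤ 1 ∧ |w| ≤ 1 ∧ |β| ≤ 7 ∧ 11 ≤ |12*u*w+β^2| ∧ |β-v| ≤ |2*β*(36*u*w-β^2)| ∧ |12*u*w+v^2| ≤ 48 := by
  rw [abs_le] at hβ
  have aux : ∀ β : ℝ, -1 ≤ β → β ≤ 1 → β^2 ≤ 1 := fun β a b => by nlinarith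
  rcases h with ⟨-, rfl, rfl, rfl, -⟩ | ⟨-, rfl, rfl, rfl, -⟩ | ⟨-, rfl, rfl, rfl, -⟩ | ⟨-, rfl, rfl, rfl, -⟩
  · refine ⟨by norm_num, by norm_num, abs_le.2 ⟨by linarith, by linarith⟩, ?_, ?_, by norm_num⟩
    · rw [abs_of_pos (by positivity)]; nlinarith [sq_nonneg β]
    · rw [show 2*β*(36*1*1-β^2) = (β- -6)*(2*β*(6-β)) by ring, abs_mul]
      refine le_mul_of_one_le_right (abs_nonneg _) ?_
      rw [abs_mul, abs_of_neg (by linarith), abs_of_pos (by linarith)]; nlinarith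
  · have := aux β (by linarith) (by linarith)
    refine ⟨by norm_num, by norm_num, abs_le.2 ⟨by linarith, by linarith⟩, ?_, ?_, by norm_num⟩
    · rw [abs_of_neg (by linarith)]; linarith
    · rw [sub_zero, abs_mul, abs_of_neg (by linarith [sq_nonneg β] : 36*1*(-1)-β^2 < 0), abs_mul]
      norm_num; nlinarith [abs_nonneg β, sq_nonneg β]
  all_goals
    have := aux β (by linarith) (by linarith)
    refine ⟨by norm_num, by norm_num, abs_le.2 ⟨by linarith, by linarith⟩, ?_, ?_, by norm_num⟩
    · rw [abs_of_pos (by norm_num; positivity)]; linarith [sq_nonneg β]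
    · rw [sub_zero, abs_mul, abs_mul]
      rw [abs_of_pos (by linarith : (0:ℝ) < 36*_*_-β^2)]
      norm_num; nlinarith [abs_nonneg β, sq_nonneg β]

def GD (u v w T : ℝ) (g : BQF) : Prop := ∃ (z : E4) (β : ℝ), ZC z ∧ z 1 < T ∧ |β-v| ≤ 1 ∧
  ∀ x y, g.evalR x y = FR u β w z x y

theorem Pa_le {u v w : ℝ} {z : E4} (hu : |u| ≤ 7) (hv : |v| ≤ 7) (hw : |w| ≤ 7) (hz : ZC z) :
    |Pa u v w z| ≤ 28*z 0^2 ∧ |Pa u v w z| ≤ 21*z 0^2*((z 3)⁻¹)^2 := by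
  have h1 := A0_le hu hv hw (z 1)
  have h2 := hz.y.2
  have h3 : |Pa u v w z| ≤ 21*z 0^2*((z 3)⁻¹)^2 := by
    rw [Pa, kk, abs_mul, abs_of_nonneg (by positivity : 0 ≤ z 0^2*((z 3)⁻¹)^2)]
    have := mul_le_mul_of_nonneg_left h1 (by positivity : 0 ≤ z 0^2*((z 3)⁻¹)^2)
    linarith
  refine ⟨h3.trans ?_, h3⟩
  have := mul_le_mul_of_nonneg_left h2 (by positivity : 0 ≤ 21*z 0^2)
  linarith

theorem classify {i n : ℕ} (hi : i ≤ 2) (hn : 1 ≤ n) {f : BQF} (hf : f ∈ AA i (n^2)) :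
    ∃ g, Equivalent f g ∧ g.a ≠ 0 ∧ |(g.a:ℝ)| ≤ 6000*n ∧ |(g.Hz:ℝ)| ≤ 6000*n^2 ∧
      (|(g.a:ℝ)|^3 ≤ 28^3*n^2 ∨ ∃ u v w T, TI i u v w T ∧ GD u v w T g) := by
  obtain ⟨hirr, hnc, hI, hJ⟩ := hf
  obtain ⟨α, β, γ, hα, hβ, hγ, hrep, hcase⟩ := NF one_pos le_rfl hi hirr hnc
  obtain ⟨g, z, hfg, h0, h3, h2, h2', hxy, h1, h1', h1'', hFR⟩ := Red hrep
  have hz : ZC z := ⟨h0, h3, h2, h2', hxy, h1⟩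
  obtain ⟨eI, eJ, eH⟩ := FR_inv hFR h3.ne'
  rw [hfg.I_eq] at eI; rw [hfg.J_eq] at eJ
  rw [eI] at hI; rw [eJ] at hJ
  have hn' : (1:ℝ) ≤ n := by exact_mod_cast hn
  have hPa := Pa_le hα hβ hγ hz
  rw [← (FR_coef hFR).1] at hPa
  have hD3 : 1 ≤ |β*(36*α*γ-β^2)| → (z 0^2)^3 ≤ n^2 := fun h => by
    rw [abs_mul, abs_of_pos (by positivity : 0 < z 0^6), mul_assoc, abs_mul, abs_two] at hJ
    have := mul_le_mul_of_nonneg_left h (by positivity : 0 ≤ z 0^6)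
    nlinarith [pow_pos h0 6]
  have hD : z 0^2 ≤ n := by
    rcases hcase with h | ⟨u, v, w, T, hTI, rfl, rfl, hb⟩
    · have h' := hD3 h
      refine le_of_pow_le_pow_left₀ (n := 3) (by norm_num) (by positivity) (h'.trans ?_)
      exact pow_le_pow_right₀ hn' (by norm_num)
    · have := (hTI.c hb).2.2.2.1
      refine le_of_pow_le_pow_left₀ (n := 2) (by norm_num) (by positivity) ?_
      rw [abs_mul, abs_of_pos (by positivity : 0 < z 0^4)] at hI
      have := mul_le_mul_of_nonneg_left this (by positivity : 0 ≤ z 0^4)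
      nlinarith [pow_pos h0 4]
  refine ⟨g, hfg, hfg.a_ne hirr, by linarith [hPa.1], ?_, ?_⟩
  · rw [eH, abs_mul, abs_of_pos (by positivity)]
    have k1 : z 0^4 ≤ n^2 := by
      have := pow_le_pow_left₀ (by positivity) hD 2; linarith [this, (by ring : (z 0^2)^2 = z 0^4)]
    have k2 := mul_le_mul k1 hz.y.2 (by positivity) (by positivity)
    have k3 := mul_le_mul k2 (HA_le hα hβ hγ (z 1)) (abs_nonneg _) (by positivity)
    have : (0:ℝ) ≤ n^2 := by positivity
    linarith
  · rcases hcase with h | ⟨u, v, w, T, hTI, rfl, rfl, hb⟩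
    · left
      have := pow_le_pow_left₀ (abs_nonneg _) hPa.1 3
      have := hD3 h
      nlinarith
    · right
      refine ⟨α, v, γ, T, hTI, z, β, hz, ?_, hb, hFR⟩
      rcases hTI with ⟨-, rfl, -, rfl, rfl⟩ | ⟨-, rfl, -, rfl, rfl⟩ | ⟨-, rfl, -, rfl, rfl⟩ | ⟨-, rfl, -, rfl, rfl⟩
      · exact h1'' rfl
      · exact h1'
      · exact h1'' rfl
      · exact h1'' rfl
end BQF
end

section
open Set MeasureTheory Filter
open scoped ENNReal
namespace BQF
noncomputable def Ph (u w : ℝ) (p : E4 × ℝ) : E4 := PP u p.2 w p.1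
theorem Ph_cd (u w : ℝ) {s : Set (E4 × ℝ)} (hs : ∀ p ∈ s, p.1 3 ≠ 0) : ContDiffOn ℝ 1 (Ph u w) s := by
  have h3 : ContDiffOn ℝ 1 (fun p : E4 × ℝ => (p.1 3)⁻¹) s := ContDiffOn.inv (by fun_prop) hs
  have key : ∀ c s' : E4 × ℝ → ℝ, ContDiff ℝ 1 c → ContDiff ℝ 1 s' → ContDiff ℝ 1 (fun p : E4 × ℝ => u*c p^4+p.2*c p^2*s' p^2+w*s' p^4) ∧
    ContDiff ℝ 1 (fun p : E4 × ℝ => -4*u*c p^3*s' p + p.2*(2*c p^3*s' p - 2*c p*s' p^3) + 4*w*s' p^3*c p) ∧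
    ContDiff ℝ 1 (fun p : E4 × ℝ => 6*u*c p^2*s' p^2 + p.2*(c p^4-4*c p^2*s' p^2+s' p^4) + 6*w*s' p^2*c p^2) ∧
    ContDiff ℝ 1 (fun p : E4 × ℝ => -4*u*c p*s' p^3 + p.2*(-2*c p^3*s' p + 2*c p*s' p^3) + 4*w*s' p*c p^3) := by
    intro c s' hc hs; refine ⟨?_, ?_, ?_, ?_⟩ <;> fun_prop
  obtain ⟨a0, a1, a2, a3⟩ := key (fun p => Real.cos (p.1 1)) (fun p => Real.sin (p.1 1)) (by fun_prop) (by fun_prop)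
  replace a0 := a0.contDiffOn (s := s)
  replace a1 := a1.contDiffOn (s := s)
  replace a2 := a2.contDiffOn (s := s)
  replace a3 := a3.contDiffOn (s := s)
  have x2 : ContDiffOn ℝ 1 (fun p : E4 × ℝ => p.1 2) s := by fun_prop
  have x3 : ContDiffOn ℝ 1 (fun p : E4 × ℝ => p.1 3) s := by fun_prop
  have k : ContDiffOn ℝ 1 (fun p : E4 × ℝ => p.1 0^2*((p.1 3)⁻¹)^2) s := by fun_prop
  have c := fun r : ℝ => contDiffOn_const (𝕜 := ℝ) (n := 1) (c := r) (s := s)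
  refine contDiffOn_pi.2 fun i => ?_
  fin_cases i
  · exact k.mul a0
  · exact k.mul ((((c 4).mul x2).mul a0).add (x3.mul a1))
  · exact k.mul ((((c 6).mul (x2.pow 2)).mul a0).add (((c 3).mul x2).mul x3 |>.mul a1) |>.add ((x3.pow 2).mul a2))
  · exact k.mul ((((c 4).mul (x2.pow 3)).mul a0).add ((((c 3).mul (x2.pow 2)).mul x3).mul a1) |>.add ((((c 2).mul x2).mul (x3.pow 2)).mul a2)
     |>.add ((x3.pow 3).mul a3))
theorem Ph_cont (u w : ℝ) {s : Set (E4 × ℝ)} (hs : ∀ p ∈ s, p.1 3 ≠ 0) : ContinuousOn (Ph u w) s :=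
  (Ph_cd u w hs).continuousOn

theorem PP_T {u v w T : ℝ} (h : TT u v w T) {z : E4} (hz : z 1 = T) : PP u v w z = PP u v w ![z 0, 0, z 2, z 3] := by
  rcases h with ⟨rfl, rfl, rfl, rfl⟩ | ⟨rfl, rfl, rfl, rfl⟩ | ⟨rfl, rfl, rfl, rfl⟩ | ⟨rfl, rfl, rfl, rfl⟩ <;>
  simp [PP, Pa, Pb, Pc, Pd, kk, A0, A1, A2, A3, hz]; norm_num

theorem up_int {u v w T : ℝ} (h : TT u v w T) {K : Set E4} (hK : ∀ x ∈ K, ∃ z : E4, ZC z ∧ z 1 ≤ T ∧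
    z 0^4*|12*u*w+v^2| ≤ 1 ∧ HA u v w (z 1) ≠ 0 ∧ x = PP u v w z) :
    ∫⁻ x in K, dens x ≤ ENNReal.ofReal (T*Real.pi/81) := by
  obtain ⟨-, -, -, -, -, -, hI, hT, -⟩ := h.facts
  have hI' := abs_pos.2 hI
  have hpi := Real.pi_pos
  set B : Set E4 := {ζ | 0 < ζ 0 ∧ ζ 0 ≤ 1/|12*u*w+v^2| ∧ 0 ≤ ζ 1 ∧ ζ 1 < T ∧ HA u v w (ζ 1) ≠ 0 ∧ 0 ≤ ζ 2 ∧ ζ 2 ≤ Real.pi/6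
    ∧ 0 < ζ 3 ∧ ζ 3 ≤ 1} with hB
  have hHm : Measurable (fun ζ : E4 => HA u v w (ζ 1)) := by
    simp only [HA, A0, A1, A2]; fun_prop
  have mB : MeasurableSet B := by
    have p := fun i : Fin 4 => measurable_pi_apply (X := fun _ => ℝ) i
    refine (measurableSet_lt measurable_const (p 0)).inter <| (measurableSet_le (p 0) measurable_const).inter <|
      (measurableSet_le measurable_const (p 1)).inter <| (measurableSet_lt (p 1) measurable_const).inter <|
      (measurableSet_eq_fun hHm measurable_const).compl.inter <| (measurableSet_le measurable_const (p 2)).inter <|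
      (measurableSet_le (p 2) measurable_const).inter <| (measurableSet_lt measurable_const (p 3)).inter
      (measurableSet_le (p 3) measurable_const)
  have hBQ : B ⊆ Qdom := fun ζ hζ => ⟨hζ.1, ⟨by linarith [hζ.2.2.2.2.2.1], by linarith [hζ.2.2.2.2.2.2.1]⟩, hζ.2.2.2.2.2.2.2.1⟩
  have e := E_int h mB hBQ fun ζ hζ => ⟨⟨hζ.2.2.1, hζ.2.2.2.1⟩, hζ.2.2.2.2.1⟩
  have hv : volume B ≤ ENNReal.ofReal ((1/|12*u*w+v^2|) *T*(Real.pi/6)) := by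
    refine (measure_mono (t := Icc ![0,0,0,0] ![1/|12*u*w+v^2|, T, Real.pi/6, 1]) ?_).trans ?_
    · rintro ζ ⟨a, b, c, d, -, e, f, g, h⟩
      constructor <;> intro i <;> fin_cases i <;> simp <;> first | linarith | simpa using b
    · rw [Real.volume_Icc_pi]; simp only [Fin.prod_univ_four]; simp
      rw [← ENNReal.ofReal_mul (by positivity), ← ENNReal.ofReal_mul (by positivity)]
  have hsub : K ⊆ PP u v w '' (Qm '' B) := by
    have main : ∀ z : E4, ZC z → z 1 < T → z 0^4*|12*u*w+v^2| ≤ 1 → HA u v w (z 1) ≠ 0 → PP u v w z ∈ PP u v w '' (Qm '' B) := by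
      rintro z ⟨z0, z3, z2, z2', z23, z1⟩ hzT hz0 hH
      have hs : Real.sin (Real.arcsin (z 2)) = z 2 := Real.sin_arcsin (by linarith) (by linarith)
      have hc : Real.cos (Real.arcsin (z 2)) = √(1-z 2^2) := Real.cos_arcsin _
      have hcp : 0 < √(1-z 2^2) := Real.sqrt_pos.2 (by nlinarith)
      refine ⟨z, ⟨![z 0^4, z 1, Real.arcsin (z 2), √(1-z 2^2)*(z 3)⁻¹], ?_, ?_⟩, rfl⟩
      · refine ⟨by simpa using by positivity, ?_, z1, hzT, hH, Real.arcsin_nonneg.2 z2, ?_, ?_, ?_⟩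
        · simpa using (le_div_iff₀ hI').2 hz0
        · have : Real.arcsin (z 2) ≤ Real.pi/6 := by
            rw [Real.arcsin_le_iff_le_sin ⟨by linarith, by linarith⟩ ⟨by linarith, by linarith⟩, Real.sin_pi_div_six]; exact z2'
          exact this
        · exact mul_pos hcp (inv_pos.2 z3)
        · have : √(1-z 2^2)*(z 3)⁻¹ ≤ 1 := by
            rw [← div_eq_mul_inv, div_le_one z3]
            exact Real.sqrt_le_iff.2 ⟨z3.le, by linarith⟩
          exact this
      · ext j; fin_cases j
        · have : √√(z 0^4) = z 0 := by
            rw [show z 0^4 = (z 0^2)^2 by ring, Real.sqrt_sq (by positivity), Real.sqrt_sq z0.le]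
          exact this
        · rfl
        · exact hs
        · have : Real.cos (Real.arcsin (z 2)) * (√(1-z 2^2)*(z 3)⁻¹)⁻¹ = z 3 := by
            rw [hc]; field_simp
          exact this
    intro x hx
    obtain ⟨z, hz, hzT, h0, hH, rfl⟩ := hK x hx
    rcases hzT.lt_or_eq with h1 | h1
    · exact main z hz h1 h0 hH
    · have e := PP_T h h1
      have eH : HA u v w 0 ≠ 0 := by
        have k1 := Hr_PP u v w z hz.2.1.ne'
        have k2 := Hr_PP u v w ![z 0, 0, z 2, z 3] hz.2.1.ne'
        rw [← e, k1] at k2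
        intro h; rw [show (![z 0, 0, z 2, z 3] : E4) 1 = 0 from rfl, h, mul_zero] at k2
        have := hz.1; have := hz.2.1
        have : z 0^4 * ((z 3)⁻¹)^2 ≠ 0 := by positivity
        simp_all
      rw [e]; exact main _ ⟨hz.1, hz.2.1, hz.2.2.1, hz.2.2.2.1, hz.2.2.2.2.1, le_rfl⟩ hT h0 eH
  refine (lintegral_mono_set hsub).trans ?_
  rw [e]
  refine (mul_le_mul_right hv _).trans ?_
  rw [← ENNReal.ofReal_mul (by positivity)]
  apply le_of_eq; congr 1; field_simp; ring

theorem up_fam {i : ℕ} {u v w T η θ ε : ℝ} (hTI : TI i u v w T) (hη : 0 < η) (hθ : 0 < θ) (hε : 0 < ε) :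
    ∀ᶠ n : ℕ in atTop, ∀ s : Finset BQF, (∀ g ∈ s, GD u v w T g ∧ |(g.I:ℝ)| < n^2 ∧ |(g.J:ℝ)| < n^2 ∧
      η*n ≤ |(g.a:ℝ)| ∧ θ*n^2 ≤ |(g.Hz:ℝ)|) → (s.card:ℝ) ≤ (T*Real.pi/81+ε)*n^4 := by
  have hT := hTI.tt.facts.2.2.2.2.2.2.2.1
  set δ := η/28 with hδ
  have hδp : 0 < δ := by positivity
  set lo : E4 := ![δ, 0, 0, 1/2]
  set hi : E4 := ![1, T, 1/2, 1+21/η]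
  set L : Set E4 := {x | η ≤ |x 0| ∧ θ ≤ |Hr x|} with hL
  have cL : IsClosed L := (isClosed_le (g := fun x : E4 => |x 0|) continuous_const (by fun_prop)).inter (isClosed_le continuous_const Hr_cont.abs)
  set C : Set (E4 × ℝ) := (Icc lo hi ×ˢ Icc (v-1) (v+1)) ∩ ({p | 1 ≤ p.1 2^2+p.1 3^2} ∩ {p | p.1 0^4*|12*u*w+p.2^2| ≤ 1}) with hC
  have cC : IsCompact C := (isCompact_Icc.prod isCompact_Icc).inter_right
    ((isClosed_le continuous_const (by fun_prop)).inter (isClosed_le (by fun_prop) continuous_const))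
  have hC3 : ∀ p ∈ C, p.1 3 ≠ 0 := fun p hp => by
    have : 1/2 ≤ p.1 3 := hp.1.1.1 3
    linarith
  have cPh := Ph_cont u w hC3
  set S := C ∩ Ph u w ⁻¹' L
  have cS : IsCompact S := cC.of_isClosed_subset (cPh.preimage_isClosed_of_isClosed cC.isClosed cL) inter_subset_left
  have cPhS : ContinuousOn (Ph u w) S := cPh.mono inter_subset_left
  set K := Ph u w '' (S ∩ {p | p.2 = v})
  have cK : IsCompact K := (cS.inter_right (isClosed_eq continuous_snd continuous_const)).image_of_continuousOn
    (cPhS.mono inter_subset_left)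
  have hKO : K ⊆ Om := by
    rintro _ ⟨p, ⟨⟨-, h1, h2⟩, -⟩, rfl⟩
    exact ⟨abs_pos.1 (hη.trans_le h1), abs_pos.1 (hθ.trans_le h2)⟩
  have hint : ∫⁻ x in K, dens x < ENNReal.ofReal (T*Real.pi/81+ε) := by
    refine (up_int hTI.tt ?_).trans_lt ((ENNReal.ofReal_lt_ofReal_iff (by positivity)).2 (by linarith))
    rintro _ ⟨⟨z, β⟩, ⟨⟨⟨⟨⟨h1, h2⟩, -⟩, h4, h5⟩, h6, h7⟩, (rfl : β = v)⟩, rfl⟩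
    have a0 : δ ≤ z 0 := h1 0
    have a1 : 0 ≤ z 1 := h1 1
    have a2 : 0 ≤ z 2 := h1 2
    have a3 : 1/2 ≤ z 3 := h1 3
    have b2 : z 2 ≤ 1/2 := h2 2
    refine ⟨z, ⟨by linarith, by linarith, a2, b2, h4, a1⟩, h2 1, h5, ?_, rfl⟩
    have h7' : θ ≤ |Hr (PP u β w z)| := h7
    rw [Hr_PP _ _ _ _ (by linarith)] at h7'
    intro h; rw [h, mul_zero, abs_zero] at h7'; linarith
  obtain ⟨U, hU, hKU, hev⟩ := D_up cK hKO hint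
  obtain ⟨ρ, hρ, hρS⟩ : ∃ ρ > 0, ∀ p ∈ S, |p.2-v| < ρ → Ph u w p ∈ U := by
    have c1 : IsCompact (S ∩ Ph u w ⁻¹' Uᶜ) := cS.of_isClosed_subset
      (cPhS.preimage_isClosed_of_isClosed cS.isClosed hU.isClosed_compl) inter_subset_left
    obtain ⟨ρ, h1, h2⟩ := c1.exists_forall_le' (f := fun p => |p.2-v|) (by fun_prop) (a := 0) fun p hp => by
      refine abs_pos.2 fun h => hp.2 (hKU ⟨p, ⟨hp.1, ?_⟩, rfl⟩)
      simpa [sub_eq_zero] using h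
    refine ⟨ρ, h1, fun p hp h => ?_⟩
    by_contra hc
    exact absurd (h2 p ⟨hp, hc⟩) (not_le.2 h)
  have hlim : ∀ᶠ n : ℕ in atTop, 1/(δ^6*ρ) < (n:ℝ) := tendsto_natCast_atTop_atTop.eventually_gt_atTop _
  filter_upwards [hev, hlim, eventually_ge_atTop 1] with n hn hnρ hn1 s hs
  refine hn s fun g hg => ?_
  obtain ⟨⟨z, β, hz, hzT, hβ, hFR⟩, hI, hJ, ha, hH⟩ := hs g hg
  refine ⟨?_, hJ⟩
  obtain ⟨cu, cw, cβ, c11, cβ', -⟩ := hTI.c hβ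
  have hnp : (0:ℝ) < n := by exact_mod_cast hn1
  have hr := Real.sq_sqrt hnp.le
  have hrp := Real.sqrt_pos.2 hnp
  generalize √(n:ℝ) = r at hr hrp
  obtain ⟨z', hz'⟩ : ∃ z' : E4, z' = ![z 0/r, z 1, z 2, z 3] := ⟨_, rfl⟩
  have e0 : z 0 = r*z' 0 := by rw [hz']; simp; field_simp
  have e1 : z' 1 = z 1 := by rw [hz']; rfl
  have e2 : z' 2 = z 2 := by rw [hz']; rfl
  have e3 : z' 3 = z 3 := by rw [hz']; rfl
  clear hz'
  have z0' : 0 < z' 0 := by have := hz.1; rw [e0] at this; exact pos_of_mul_pos_right this hrp.le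
  have hz' : ZC z' := ⟨z0', e3 ▸ hz.2.1, e2 ▸ hz.2.2.1, e2 ▸ hz.2.2.2.1, by rw [e2, e3]; exact hz.2.2.2.2.1, e1 ▸ hz.2.2.2.2.2⟩
  obtain ⟨fa, fb, fc, fd, -⟩ := FR_coef hFR
  obtain ⟨fI, fJ, fH⟩ := FR_inv hFR hz.2.1.ne'
  have hvf : vf n g = PP u β w z' := by
    ext j
    fin_cases j <;> simp only [vf, vc, PP, fa, fb, fc, fd] <;> dsimp <;> rw [div_eq_iff hnp.ne', ← hr] <;>
      simp only [Pa, Pb, Pc, Pd, kk, e0, e1, e2, e3] <;> ring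
  have hI0 : z' 0^4*|12*u*w+β^2| ≤ 1 := by
    rw [fI, e0, show (r*z' 0)^4*(12*u*w+β^2) = (n:ℝ)^2*(z' 0^4*(12*u*w+β^2)) by rw [← hr]; ring, abs_mul,
      abs_of_pos (by positivity : (0:ℝ) < n^2), abs_mul, abs_of_pos (by positivity : 0 < z' 0^4)] at hI
    have := lt_of_mul_lt_mul_left (hI.trans_eq (mul_one _).symm) (by positivity)
    exact this.le
  have hz01 : z' 0 ≤ 1 := by
    by_contra! hc
    have := one_lt_pow₀ hc (by norm_num : 4 ≠ 0)
    have := mul_le_mul this.le c11 (by norm_num) (by positivity)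
    linarith only [this, hI0]
  have hPa : η ≤ |Pa u β w z'| := by
    have : (g.a:ℝ) = n*Pa u β w z' := by
      have := congrFun hvf 0
      simp only [vf, vc, PP, Matrix.cons_val] at this
      rw [← this]; field_simp
    rw [this, abs_mul, abs_of_pos hnp] at ha
    exact le_of_mul_le_mul_left (by linarith) hnp
  obtain ⟨l1, l2⟩ := Pa_le (cu.trans (by norm_num)) cβ (cw.trans (by norm_num)) hz'
  have hδ0 : δ ≤ z' 0 := by
    have : z' 0^2 ≤ z' 0 := by rw [pow_two]; exact mul_le_of_le_one_left z0'.le hz01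
    linarith only [hδ, this, l1, hPa]
  have hy : z' 3 ≤ 1+21/η := by
    have h3 := hz'.2.1
    have : η*z' 3^2 ≤ 21 := by
      have : η ≤ 21*((z' 3)⁻¹)^2 := hPa.trans (l2.trans (by
        have : z' 0^2 ≤ 1 := pow_le_one₀ z0'.le hz01
        exact mul_le_mul_of_nonneg_right (by linarith) (by positivity)))
      have := mul_le_mul_of_nonneg_right this (by positivity : 0 ≤ z' 3^2)
      rwa [mul_assoc, ← mul_pow, inv_mul_cancel₀ h3.ne', one_pow, mul_one] at this
    have : z' 3^2 ≤ 21/η := by rw [le_div_iff₀ hη]; linarith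
    linarith only [this, sq_nonneg (z' 3 - 1), sq_nonneg (z' 3)]
  rw [hvf]
  refine hρS (z', β) ⟨⟨⟨⟨fun j => ?_, fun j => ?_⟩, ?_⟩, hz'.2.2.2.2.1, hI0⟩, hPa, ?_⟩ ?_
  · have k1 := hz'.y.1; have k2 := hz'.2.1
    fin_cases j
    exacts [hδ0, hz'.2.2.2.2.2, hz'.2.2.1, (by nlinarith only [k1, k2] : 1/2 ≤ z' 3)]
  · fin_cases j
    exacts [hz01, by rw [← e1] at hzT; exact hzT.le, hz'.2.2.2.1, hy]
  · rw [abs_le] at hβ; exact ⟨by linarith, by linarith⟩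
  · change θ ≤ |Hr (PP u β w z')|
    have : (g.Hz:ℝ) = n^2*Hr (PP u β w z') := by
      rw [fH, Hr_PP _ _ _ _ hz'.2.1.ne', e0, e1, e3, ← hr]; ring
    rw [this, abs_mul, abs_of_pos (by positivity : (0:ℝ) < n^2)] at hH
    exact le_of_mul_le_mul_left (by linarith) (by positivity : (0:ℝ) < n^2)
  · rw [fJ, e0, show (r*z' 0)^6*(2*β*(36*u*w-β^2)) = (n:ℝ)^2*(n*z' 0^6*(2*β*(36*u*w-β^2))) by rw [← hr]; ring, abs_mul,
      abs_of_pos (by positivity : (0:ℝ) < n^2), abs_mul, abs_of_pos (by positivity : 0 < n*z' 0^6)] at hJ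
    have h1 := lt_of_mul_lt_mul_left (hJ.trans_eq (mul_one _).symm) (by positivity)
    have h2 : n*δ^6*|β-v| < 1 := lt_of_le_of_lt (by gcongr) h1
    rw [div_lt_iff₀ (by positivity)] at hnρ
    by_contra! hc
    have := mul_le_mul_of_nonneg_left hc (by positivity : 0 ≤ n*δ^6)
    dsimp only at *
    linarith
end BQF
end

section
open Set MeasureTheory Filter
open scoped ENNReal
namespace BQF
noncomputable def VV (i : ℕ) : ℝ := if i = 0 then Real.pi^2/162 else Real.pi^2/81
theorem up_main {i : ℕ} {η θ ε : ℝ} (hi : i ≤ 2) (hη : 0 < η) (hθ : 0 < θ) (hε : 0 < ε) :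
    ∀ᶠ n : ℕ in atTop, ∀ s : Finset BQF, (∀ g ∈ s, (∃ u v w T, TI i u v w T ∧ GD u v w T g) ∧ |(g.I:ℝ)| < n^2 ∧ |(g.J:ℝ)| < n^2 ∧
      η*n ≤ |(g.a:ℝ)| ∧ θ*n^2 ≤ |(g.Hz:ℝ)|) → (s.card:ℝ) ≤ (VV i+ε)*n^4 := by
  classical
  obtain rfl | rfl | rfl : i = 0 ∨ i = 1 ∨ i = 2 := by omega
  · filter_upwards [up_fam (Or.inl ⟨rfl, rfl, rfl, rfl, rfl⟩ : TI 0 _ _ _ _) hη hθ hε] with n hn s hs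
    refine (hn s fun g hg => ?_).trans_eq (by simp [VV]; ring_nf; tauto)
    obtain ⟨⟨u, v, w, T, h1, h2⟩, h3⟩ := hs g hg
    obtain ⟨-, rfl, rfl, rfl, rfl⟩ | ⟨h, -⟩ | ⟨h, -⟩ | ⟨h, -⟩ := h1
    · exact ⟨h2, h3⟩
    all_goals norm_num at h
  · filter_upwards [up_fam (Or.inr (Or.inl ⟨rfl, rfl, rfl, rfl, rfl⟩) : TI 1 _ _ _ _) hη hθ hε] with n hn s hs
    refine (hn s fun g hg => ?_).trans_eq (by simp [VV]; ring_nf; tauto)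
    obtain ⟨⟨u, v, w, T, h1, h2⟩, h3⟩ := hs g hg
    obtain ⟨h, -⟩ | ⟨-, rfl, rfl, rfl, rfl⟩ | ⟨h, -⟩ | ⟨h, -⟩ := h1
    rotate_left
    · exact ⟨h2, h3⟩
    all_goals norm_num at h
  · filter_upwards [up_fam (Or.inr (Or.inr (Or.inl ⟨rfl, rfl, rfl, rfl, rfl⟩)) : TI 2 _ _ _ _) hη hθ (half_pos hε),
      up_fam (Or.inr (Or.inr (Or.inr ⟨rfl, rfl, rfl, rfl, rfl⟩)) : TI 2 _ _ _ _) hη hθ (half_pos hε)] with n hn hn' s hs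
    have k1 := hn (s.filter fun g => GD 1 0 1 (Real.pi/2) g) fun g hg => by
      rw [Finset.mem_filter] at hg; exact ⟨hg.2, (hs g hg.1).2⟩
    have k2 := hn' (s.filter fun g => ¬ GD 1 0 1 (Real.pi/2) g) fun g hg => by
      rw [Finset.mem_filter] at hg
      obtain ⟨⟨u, v, w, T, h1, h2⟩, h3⟩ := hs g hg.1
      obtain ⟨h, -⟩ | ⟨h, -⟩ | ⟨-, rfl, rfl, rfl, rfl⟩ | ⟨-, rfl, rfl, rfl, rfl⟩ := h1
      · norm_num at h
      · norm_num at h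
      · exact absurd h2 hg.2
      · exact ⟨h2, h3⟩
    have k3 : (s.card:ℝ) = _ := congrArg Nat.cast (Finset.card_filter_add_card_filter_not (s := s) (fun g => GD 1 0 1 (Real.pi/2) g)).symm
    rw [k3]; push_cast; refine (add_le_add k1 k2).trans_eq ?_
    simp [VV]; ring

theorem upper {i : ℕ} {ε : ℝ} (hi : i ≤ 2) (hε : 0 < ε) :
    ∀ᶠ n : ℕ in atTop, (cls '' AA i (n^2)).Finite ∧ ((cls '' AA i (n^2)).ncard : ℝ) ≤ (VV i+ε)*n^4 := by
  classical
  obtain ⟨K, hK, hK1⟩ := tail1 (C := 6000) (by norm_num)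
  obtain ⟨K', hK', hK2⟩ := tail2 (C := 6000) (by norm_num)
  obtain ⟨η, hη⟩ : ∃ η, η = (ε/(4*K))^2 := ⟨_, rfl⟩
  have hηp : 0 < η := by rw [hη]; positivity
  have hη' : K*√η = ε/4 := by rw [hη, Real.sqrt_sq (by positivity)]; field_simp
  obtain ⟨θ, hθ⟩ : ∃ θ, θ = (ε*η/(4*K'))^2 := ⟨_, rfl⟩
  have hθp : 0 < θ := by rw [hθ]; positivity
  have hθ' : K'*(√θ/η) = ε/4 := by rw [hθ, Real.sqrt_sq (by positivity)]; field_simp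
  have l1 : ∀ᶠ n : ℕ in atTop, (28/η)^3 < (n:ℝ) := tendsto_natCast_atTop_atTop.eventually_gt_atTop _
  have l2 : ∀ᶠ n : ℕ in atTop, (4*K'/ε)^2 < (n:ℝ) := tendsto_natCast_atTop_atTop.eventually_gt_atTop _
  filter_upwards [up_main hi hηp hθp (by positivity : 0 < ε/4), l1, l2, eventually_ge_atTop 1] with n hn ln1 ln2 hn1
  have hnp : (1:ℝ) ≤ n := by exact_mod_cast hn1
  have main : ∀ t : Finset (Quotient stoid), (↑t ⊆ cls '' AA i (n^2)) → (t.card:ℝ) ≤ (VV i+ε)*n^4 := by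
    intro t ht
    have hc : ∀ q : t, ∃ g : BQF, cls g = q ∧ g.a ≠ 0 ∧ |(g.a:ℝ)| ≤ 6000*n ∧ |(g.Hz:ℝ)| ≤ 6000*n^2 ∧
      (|(g.a:ℝ)|^3 ≤ 28^3*n^2 ∨ ∃ u v w T, TI i u v w T ∧ GD u v w T g) ∧ |(g.I:ℝ)| < n^2 ∧ |(g.J:ℝ)| < n^2 := fun q => by
      obtain ⟨f, hf, hfq⟩ := ht q.2
      obtain ⟨g, h1, h2, h3, h4, h5⟩ := classify hi hn1 hf
      exact ⟨g, by rw [← hfq]; exact cls_eq.2 h1.symm, h2, h3, h4, h5, by rw [h1.I_eq]; exact hf.2.2.1, by rw [h1.J_eq]; exact hf.2.2.2⟩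
    choose g g1 g2 g3 g4 g5 g6 g7 using hc
    have hc' := fun q : t => translate (g2 q)
    choose g' t1 t2 t3 t4 using hc'
    have hginj : Function.Injective g := fun q q' h => Subtype.ext (by rw [← g1, ← g1, h])
    have hg'inj : Function.Injective g' := fun q q' h => Subtype.ext (by
      rw [← g1, ← g1, cls_eq.2 (t1 q), cls_eq.2 (t1 q'), h])
    have hT : ∀ q, g' q ∈ TailSet 6000 n := fun q =>
      ⟨by rw [t2]; exact g2 q, by rw [t2]; exact g3 q, t3 q, by rw [t4]; exact g4 q, by rw [(t1 q).I_eq]; exact (g6 q).le,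
        by rw [(t1 q).J_eq]; exact (g7 q).le⟩
    set P1 : t → Prop := fun q => |((g q).a:ℝ)| ≤ η*n
    set P2 : t → Prop := fun q => |((g q).Hz:ℝ)| ≤ θ*n^2
    have c1 := hK1 n hn1 η hηp ((Finset.univ.filter P1).image g') (by
      intro f hf; obtain ⟨q, hq, rfl⟩ := Finset.mem_image.1 hf
      exact ⟨hT q, by rw [t2]; exact (Finset.mem_filter.1 hq).2⟩)
    have c2 := hK2 n hn1 η θ hηp hθp.le (((Finset.univ.filter fun q => ¬ P1 q).filter P2).image g') (by
      intro f hf; obtain ⟨q, hq, rfl⟩ := Finset.mem_image.1 hf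
      rw [Finset.mem_filter, Finset.mem_filter] at hq
      exact ⟨hT q, by rw [t2]; exact (not_le.1 hq.1.2).le, by rw [t4]; exact hq.2⟩)
    have c3 := hn (((Finset.univ.filter fun q => ¬ P1 q).filter fun q => ¬ P2 q).image g) (by
      intro f hf; obtain ⟨q, hq, rfl⟩ := Finset.mem_image.1 hf
      rw [Finset.mem_filter, Finset.mem_filter] at hq
      have hq1 := (not_le.1 hq.1.2)
      refine ⟨(g5 q).resolve_left fun h => ?_, g6 q, g7 q, hq1.le, (not_le.1 hq.2).le⟩
      have k1 := pow_lt_pow_left₀ hq1 (by positivity) (by norm_num : 3 ≠ 0)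
      rw [div_pow, div_lt_iff₀ (by positivity)] at ln1
      have := mul_lt_mul_of_pos_right ln1 (by positivity : (0:ℝ) < n^2)
      nlinarith only [this, k1, h])
    rw [Finset.card_image_of_injective _ hg'inj] at c1 c2
    rw [Finset.card_image_of_injective _ hginj] at c3
    have e1 := Finset.card_filter_add_card_filter_not (s := (Finset.univ : Finset t)) P1
    have e2 := Finset.card_filter_add_card_filter_not (s := (Finset.univ.filter fun q => ¬ P1 q)) P2
    have e3 : (t.card:ℝ) = (Finset.univ.filter P1).card + (((Finset.univ.filter fun q => ¬ P1 q).filter P2).card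
       + ((Finset.univ.filter fun q => ¬ P1 q).filter fun q => ¬ P2 q).card) := by
      rw [← Fintype.card_coe, ← Finset.card_univ, ← e1, ← e2]; push_cast; ring
    have hsq : K'*(n^3*√(n:ℝ)) ≤ ε/4*n^4 := by
      have h1 : 4*K'/ε ≤ √(n:ℝ) := Real.le_sqrt_of_sq_le ln2.le
      rw [div_le_iff₀ hε] at h1
      have h2 := Real.sq_sqrt (by linarith : (0:ℝ) ≤ n)
      have : (n:ℝ)^4 = n^3*(√(n:ℝ) * √(n:ℝ)) := by rw [← pow_two, h2]; ring
      rw [this]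
      have := mul_le_mul_of_nonneg_right h1 (by positivity : 0 ≤ (n:ℝ)^3*√(n:ℝ))
      linarith only [this]
    have e4 : K'*(n^3*√(n:ℝ) + √θ/η*n^4) = K'*(n^3*√(n:ℝ)) + (K'*(√θ/η))*n^4 := by ring
    rw [hη'] at c1; rw [e4, hθ'] at c2
    rw [e3]; linarith only [c1, c2, c3, hsq]
  obtain ⟨M, hM⟩ := exists_nat_gt ((VV i+ε)*n^4)
  have hfin : (cls '' AA i (n^2)).Finite := by
    by_contra hinf
    obtain ⟨t, ht, htc⟩ := Set.Infinite.exists_subset_card_eq hinf M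
    have := main t ht
    rw [htc] at this; linarith
  refine ⟨hfin, ?_⟩
  rw [ncard_eq_toFinset_card _ hfin]
  exact main _ (by simp)
end BQF
end

section
open Set MeasureTheory Filter
open scoped ENNReal
namespace BQF
def NB (u v w T : ℝ) : Set (E4 × ℝ) := {p | (0 < p.1 0 ∧ p.1 0^4*|12*u*w+p.2^2| < 1 ∧ 0 < p.1 1 ∧ p.1 1 < T ∧
  A0 u p.2 w (p.1 1) ≠ 0 ∧ HA u p.2 w (p.1 1) ≠ 0) ∧ 0 < p.1 2 ∧ p.1 2 < 1/2 ∧ 1 < p.1 2^2+p.1 3^2 ∧ 0 < p.1 3 ∧ |p.2-v| < 1/10}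
theorem NB_open (u v w T : ℝ) : IsOpen (NB u v w T) := by
  have a0 : Continuous (fun p : E4 × ℝ => A0 u p.2 w (p.1 1)) := by unfold A0; fun_prop
  have ha : Continuous (fun p : E4 × ℝ => HA u p.2 w (p.1 1)) := by
    simp only [HA_eq]; fun_prop
  have l : ∀ {f g : E4 × ℝ → ℝ}, Continuous f → Continuous g → IsOpen {p | f p < g p} := fun h h' => isOpen_lt h h'
  simp only [NB, Set.ofPred_and]
  refine IsOpen.inter ?_ ?_ <;> repeat' apply IsOpen.inter
  pick_goal 5; exact isOpen_ne_fun a0 continuous_const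
  pick_goal 5; exact isOpen_ne_fun ha continuous_const
  all_goals exact l (by fun_prop) (by fun_prop)

noncomputable def Psi (u w : ℝ) (p : E4 × ℝ) : E4 × ℝ := (Ph u w p, p.1 0^6*(2*p.2*(36*u*w-p.2^2)))

theorem Psi_nhds {u v w T : ℝ} (h : TT u v w T) {z : E4} (hz : (z, v) ∈ NB u v w T) :
    Psi u w '' NB u v w T ∈ nhds (PP u v w z, (0:ℝ)) := by
  obtain ⟨-, -, -, -, -, hJ, hI, -, hQ⟩ := h.facts
  have hz' := hz
  obtain ⟨⟨h0, -, -, -, -, hH⟩, -, -, -, h3, -⟩ := hz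
  have h0 : 0 < z 0 := h0
  have h3 : 0 < z 3 := h3
  have cd : ContDiffAt ℝ 1 (Psi u w) (z, v) := by
    refine ContDiffAt.prodMk ?_ (by fun_prop)
    refine (Ph_cd u w (s := {p | p.1 3 ≠ 0}) fun p hp => hp).contDiffAt ?_
    exact (isOpen_ne_fun (by fun_prop) (by fun_prop)).mem_nhds h3.ne'
  have hs := cd.hasStrictFDerivAt (by norm_num)
  obtain ⟨D, hD⟩ : ∃ D, D = fderiv ℝ (Psi u w) (z, v) := ⟨_, rfl⟩
  rw [← hD] at hs
  have d1 : ∀ k : E4, D (k, 0) = (PD u v w z k, 0) := by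
    intro k
    have e1 : HasFDerivAt (fun y : E4 => Psi u w (y, v)) (D.comp (ContinuousLinearMap.inl ℝ E4 ℝ)) z :=
      HasFDerivAt.comp z (g := Psi u w) hs.hasFDerivAt (hasFDerivAt_prodMk_left z v)
    have e2 : HasFDerivAt (fun y : E4 => Psi u w (y, v)) ((PD u v w z).prod 0) z := by
      have : (fun y : E4 => Psi u w (y, v)) = fun y => (PP u v w y, (0:ℝ)) := by
        ext1 y; simp only [Psi, Ph]; rw [mul_assoc 2, hJ]; simp
      rw [this]
      exact (PP_deriv u v w z h3.ne').prodMk (hasFDerivAt_const 0 z)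
    exact congrArg (fun L => L k) (e1.unique e2)
  have d2 : (D (0, 1)).2 = z 0^6*(72*u*w-6*v^2) := by
    have e1 : HasFDerivAt (fun y : ℝ => (Psi u w (z, y)).2) ((ContinuousLinearMap.snd ℝ E4 ℝ).comp (D.comp (ContinuousLinearMap.inr ℝ E4 ℝ))) v :=
      (hasFDerivAt_snd (p := Psi u w (z, v))).comp v (HasFDerivAt.comp v (g := Psi u w) hs.hasFDerivAt (hasFDerivAt_prodMk_right z v))
    have e2 : HasDerivAt (fun y : ℝ => (Psi u w (z, y)).2) (z 0^6*(72*u*w-6*v^2)) v := by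
      have := ((((hasDerivAt_id v).const_mul 2).mul (((hasDerivAt_id v).pow 2).const_sub (36*u*w))).const_mul (z 0^6))
      refine this.congr_deriv ?_
      simp only [Pi.pow_apply, id]; push_cast; ring
    have := e1.hasDerivAt.unique e2
    simpa using this
  have hsurj : D.range = ⊤ := by
    refine LinearMap.range_eq_top.2 fun q => ?_
    have hdet : (PD u v w z).det ≠ 0 := by
      rw [PD_det u v w z h3.ne' hJ]
      exact mul_ne_zero (mul_ne_zero (mul_ne_zero (mul_ne_zero (by norm_num) hI) hH) (by positivity)) (by positivity)
    obtain ⟨t, ht⟩ : ∃ t : ℝ, t*(z 0^6*(72*u*w-6*v^2)) = q.2 :=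
      ⟨q.2/(z 0^6*(72*u*w-6*v^2)), div_mul_cancel₀ _ (mul_ne_zero (by positivity) hQ)⟩
    have hs : Function.Surjective (PD u v w z) := by
      have : IsUnit (LinearMap.det (PD u v w z : E4 →ₗ[ℝ] E4)) := isUnit_iff_ne_zero.2 hdet
      exact (LinearEquiv.ofIsUnitDet (f := (PD u v w z : E4 →ₗ[ℝ] E4)) (v := Pi.basisFun ℝ _) (v' := Pi.basisFun ℝ _)
        (by rw [LinearMap.det_toMatrix]; exact this)).surjective
    obtain ⟨k, hk⟩ := hs (q.1 - (t • D (0, 1)).1)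
    refine ⟨(k, t), ?_⟩
    have : ((k, t) : E4 × ℝ) = (k, 0) + t • (0, 1) := by simp
    change D (k, t) = q
    rw [this, map_add, map_smul, d1, hk]
    ext1
    · simp
    · simp [d2, ht]
  have hm := hs.map_nhds_eq_of_surj hsurj
  have e : Psi u w (z, v) = (PP u v w z, 0) := by simp only [Psi, Ph]; rw [mul_assoc 2, hJ]; simp
  rw [e] at hm; rw [← hm]
  exact image_mem_map ((NB_open u v w T).mem_nhds hz')
end BQF
end

section
open Set MeasureTheory Filter
open scoped ENNReal
namespace BQF
theorem null_ang {u v w T : ℝ} (h : TT u v w T) : volume {t : ℝ | A0 u v w t*HA u v w t = 0} = 0 := by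
  refine ((countable_range fun k : ℤ => (k:ℝ)*Real.pi/8).mono fun t ht => ?_).measure_zero _
  have e : Real.sin (8*t) = 8*(Real.sin t*Real.cos t)*(Real.cos t^2-Real.sin t^2)*(Real.cos t^4-6*Real.cos t^2*Real.sin t^2+Real.sin t^4) := by
    rw [show 8*t = 2*(2*(2*t)) by ring, Real.sin_two_mul, Real.sin_two_mul (2*t), Real.cos_two_mul' (2*t), Real.sin_two_mul, Real.cos_two_mul']
    ring
  have h8 : Real.sin (8*t) = 0 := by
    have h1 := Real.cos_sq_add_sin_sq t
    have ht : A0 u v w t*HA u v w t = 0 := ht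
    rw [e]; rw [HA_eq] at ht
    have hQ : (Real.sin t*Real.cos t)*(Real.cos t^2-Real.sin t^2)*(Real.cos t^4-6*Real.cos t^2*Real.sin t^2+Real.sin t^4) = 0 := by
      unfold A0 at ht
      generalize Real.cos t = c at *
      generalize Real.sin t = s at *
      have hcs : (c*s)^2 = 0 → s*c = 0 := fun h => by rw [mul_comm]; exact pow_eq_zero_iff two_ne_zero |>.1 h
      have k1 : c^4+s^4 = 0 → False := fun h => by nlinarith only [h, h1, sq_nonneg (c^2-s^2), congrArg (·^2) h1]
      rcases mul_eq_zero.1 ht with ht | ht <;>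
      rcases h with ⟨rfl, rfl, rfl, -⟩ | ⟨rfl, rfl, rfl, -⟩ | ⟨rfl, rfl, rfl, -⟩ | ⟨rfl, rfl, rfl, -⟩
      · linear_combination (s*c*(c^2-s^2))*ht
      · linear_combination (s*c*(c^4-6*c^2*s^2+s^4))*ht - (s*c*(c^4-6*c^2*s^2+s^4)*(c^2-s^2))*h1
      · exact (k1 (by linarith)).elim
      · exact (k1 (by linarith)).elim
      · exfalso; have : (c^2+s^2)^2 = 1^2 := by rw [h1]
        linarith
      all_goals rw [hcs (by linarith)]; ring
    linear_combination 8*hQ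
  obtain ⟨k, hk⟩ := Real.sin_eq_zero_iff.1 h8
  exact ⟨k, by simp only; linarith⟩

theorem low_W {i : ℕ} {u v w T : ℝ} (hTI : TI i u v w T) : IsOpen {x | ∃ z, (z, v) ∈ NB u v w T ∧ x = PP u v w z} ∧
    {x | ∃ z, (z, v) ∈ NB u v w T ∧ x = PP u v w z} ⊆ Om ∧
    ENNReal.ofReal (T*Real.pi/81) ≤ ∫⁻ x in {x | ∃ z, (z, v) ∈ NB u v w T ∧ x = PP u v w z}, dens x := by
  have h := hTI.tt
  obtain ⟨-, -, -, -, -, hJ, hI, hT, hQ⟩ := h.facts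
  have hI' := abs_pos.2 hI
  refine ⟨isOpen_iff_mem_nhds.2 ?_, ?_, ?_⟩
  · rintro _ ⟨z, hz, rfl⟩
    have := (Continuous.prodMk_left (0:ℝ) (X := E4)).continuousAt.preimage_mem_nhds (Psi_nhds h hz)
    filter_upwards [this]
    rintro x ⟨⟨z', β⟩, hz', he⟩
    obtain ⟨e1, e2⟩ := Prod.ext_iff.1 he
    have hb := hz'.2.2.2.2.2
    have h0 := hz'.1.1
    have := (hTI.c (hb.le.trans (by norm_num))).2.2.2.2.1
    simp only at h0 e2 this
    rw [(mul_eq_zero.1 e2).resolve_left (by positivity), abs_zero] at this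
    have : β = v := sub_eq_zero.1 (abs_nonpos_iff.1 this)
    subst this
    exact ⟨z', hz', e1.symm⟩
  · rintro _ ⟨z, ⟨⟨h0, -, -, -, h4, h5⟩, -, -, -, h3, -⟩, rfl⟩
    simp only at h0 h4 h5 h3
    refine ⟨?_, ?_⟩
    · change kk z * A0 u v w (z 1) ≠ 0
      unfold kk; exact mul_ne_zero (by positivity) h4
    · rw [Hr_PP _ _ _ _ h3.ne']; exact mul_ne_zero (by positivity) h5
  · obtain ⟨a, ha⟩ : ∃ a : E4, a = ![0, 0, 0, 0] := ⟨_, rfl⟩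
    obtain ⟨b, hb⟩ : ∃ b : E4, b = ![1/|12*u*w+v^2|, T, Real.pi/6, 1] := ⟨_, rfl⟩
    obtain ⟨N, hN⟩ : ∃ N : Set E4, N = (fun ζ : E4 => ζ 1) ⁻¹' {t : ℝ | A0 u v w t*HA u v w t = 0} := ⟨_, rfl⟩
    have cA : Continuous (A0 u v w) := by unfold A0; fun_prop
    have cH : Continuous (HA u v w) := by rw [show HA u v w = _ from funext (HA_eq u v w)]; fun_prop
    have mN : MeasurableSet N := by
      rw [hN]; exact (isClosed_eq (cA.mul cH) continuous_const).measurableSet.preimage (measurable_pi_apply 1)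
    have nN : volume N = 0 := by
      rw [hN]; exact (Measure.quasiMeasurePreserving_eval (fun _ : Fin 4 => (volume : Measure ℝ)) 1).preimage_null (null_ang h)
    have hB : ∀ ζ ∈ (pi univ fun i => Ioo (a i) (b i)) \ N, ζ ∈ Qdom ∧ (Qm ζ, v) ∈ NB u v w T ∧ ζ 1 ∈ Ico 0 T ∧ HA u v w (ζ 1) ≠ 0 := by
      rintro ζ ⟨h1, h2⟩
      have k0 := h1 0 trivial; have k1 := h1 1 trivial; have k2 := h1 2 trivial; have k3 := h1 3 trivial
      simp only [ha, hb, Matrix.cons_val, mem_Ioo] at k0 k1 k2 k3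
      have h2 : A0 u v w (ζ 1)*HA u v w (ζ 1) ≠ 0 := fun h => h2 (by rw [hN]; exact h)
      have pp := Real.pi_pos
      have hq : ζ ∈ Qdom := ⟨k0.1, ⟨by linarith [k2.1], by linarith [k2.2]⟩, k3.1⟩
      obtain ⟨q0, q3⟩ := Q_pos hq
      have hc : 0 < Real.cos (ζ 2) := Real.cos_pos_of_mem_Ioo hq.2.1
      have hs : 0 < Real.sin (ζ 2) := Real.sin_pos_of_pos_of_lt_pi k2.1 (by linarith [k2.2])
      have hs2 : Real.sin (ζ 2) < 1/2 := by
        rw [← Real.sin_pi_div_six]; exact Real.sin_lt_sin_of_lt_of_le_pi_div_two (by linarith) (by linarith) k2.2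
      refine ⟨hq, ⟨⟨q0, ?_, k1.1, k1.2, left_ne_zero_of_mul h2, right_ne_zero_of_mul h2⟩, hs, hs2, ?_, q3, by simp⟩, ⟨k1.1.le, k1.2⟩, right_ne_zero_of_mul h2⟩
      · change (√√(ζ 0))^4*_ < _
        rw [show (√√(ζ 0))^4 = ((√√(ζ 0))^2)^2 by ring, Real.sq_sqrt (Real.sqrt_nonneg _), Real.sq_sqrt k0.1.le]
        exact (lt_div_iff₀ hI').1 k0.2
      · change 1 < Real.sin (ζ 2)^2 + (Real.cos (ζ 2)*(ζ 3)⁻¹)^2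
        have i1 : 1 < (ζ 3)⁻¹ := (one_lt_inv₀ k3.1).2 k3.2
        have := Real.sin_sq_add_cos_sq (ζ 2)
        have i2 : 1 < ((ζ 3)⁻¹)^2 := by nlinarith only [i1]
        rw [mul_pow]; nlinarith only [this, i2, mul_lt_mul_of_pos_left i2 (pow_pos hc 2)]
    have := E_int h ((MeasurableSet.univ_pi fun i => measurableSet_Ioo).diff mN) (fun ζ hζ => (hB ζ hζ).1) fun ζ hζ => (hB ζ hζ).2.2
    refine le_trans (le_of_eq ?_) (lintegral_mono_set (?_ : PP u v w '' (Qm '' ((pi univ fun i => Ioo (a i) (b i)) \ N)) ⊆ _))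
    · rw [this, measure_sdiff_null nN, Real.volume_pi_Ioo, Fin.prod_univ_four, ha, hb]
      simp only [Matrix.cons_val, sub_zero]
      have pp := Real.pi_pos
      rw [← ENNReal.ofReal_mul (by positivity), ← ENNReal.ofReal_mul (by positivity), ← ENNReal.ofReal_mul (by positivity), ← ENNReal.ofReal_mul (by positivity)]
      congr 1; field_simp; norm_num
    · rintro _ ⟨_, ⟨ζ, hζ, rfl⟩, rfl⟩
      exact ⟨_, (hB ζ hζ).2.1, rfl⟩

def GLo (u v w : ℝ) (f : BQF) : Prop := ∃ (z : E4) (β : ℝ), 0 < z 0 ∧ 0 < z 2 ∧ z 2 < 1/2 ∧ 1 < z 2^2+z 3^2 ∧ 0 < z 3 ∧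
  |β-v| < 1/10 ∧ ∀ x y, f.evalR x y = FR u β w z x y

theorem scale_z {n : ℝ} (hn : 0 < n) (u v w : ℝ) (z : E4) : ∃ z' : E4, z' 0 = √n*z 0 ∧ z' 2 = z 2 ∧ z' 3 = z 3 ∧
    Pa u v w z' = n*Pa u v w z ∧ Pb u v w z' = n*Pb u v w z ∧ Pc u v w z' = n*Pc u v w z ∧ Pd u v w z' = n*Pd u v w z := by
  refine ⟨![√n*z 0, z 1, z 2, z 3], rfl, rfl, rfl, ?_⟩
  simp only [Pa, Pb, Pc, Pd, kk, Matrix.cons_val, mul_pow, Real.sq_sqrt hn.le]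
  refine ⟨?_, ?_, ?_, ?_⟩ <;> ring

theorem low_fam {i : ℕ} {u v w T V : ℝ} (hTI : TI i u v w T) (hV0 : 0 ≤ V) (hV : V < T*Real.pi/81) : ∃ C θ : ℝ, 0 < θ ∧
    ∀ᶠ n : ℕ in atTop, ∃ s : Finset BQF, V*n^4 ≤ s.card ∧ ∀ f ∈ s, GLo u v w f ∧ f.a ≠ 0 ∧ |(f.I:ℝ)| < n^2 ∧ |(f.J:ℝ)| < n^2 ∧
      |(f.a:ℝ)| ≤ C*n ∧ |(f.b:ℝ)| ≤ C*n ∧ |(f.c:ℝ)| ≤ C*n ∧ |(f.d:ℝ)| ≤ C*n ∧ θ*n^2 ≤ |(f.Hz:ℝ)| := by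
  obtain ⟨hW, hWO, hWi⟩ := low_W hTI
  obtain ⟨K, cK, hKW, hev⟩ := D_low hW hWO (((ENNReal.ofReal_lt_ofReal_iff (by linarith)).2 hV).trans_le hWi)
  obtain ⟨O, hO⟩ : ∃ O, O = interior (Psi u w '' NB u v w T) := ⟨_, rfl⟩
  have hKO : K ×ˢ {(0:ℝ)} ⊆ O := by
    rintro ⟨x, t⟩ ⟨hx, (rfl : t = 0)⟩
    obtain ⟨z, hz, rfl⟩ := hKW hx
    rw [hO]; exact mem_interior_iff_mem_nhds.2 (Psi_nhds hTI.tt hz)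
  obtain ⟨U, U', -, oU', hU, hU', hUU⟩ := generalized_tube_lemma cK isCompact_singleton (hO ▸ isOpen_interior) hKO
  obtain ⟨ρ, hρ, hρU⟩ := Metric.isOpen_iff.1 oU' 0 (hU' rfl)
  obtain ⟨C, hC⟩ := cK.isBounded.exists_norm_le
  obtain ⟨θ, hθ, hθK⟩ : ∃ θ > 0, ∀ x ∈ K, θ ≤ |Hr x| := by
    rcases K.eq_empty_or_nonempty with h | h
    · exact ⟨1, one_pos, fun x hx => by simp [h] at hx⟩
    · obtain ⟨x, hx, hm⟩ := cK.exists_isMinOn h (Hr_cont.abs.continuousOn)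
      exact ⟨|Hr x|, abs_pos.2 (hWO (hKW hx)).2, fun y hy => hm hy⟩
  refine ⟨C, θ, hθ, ?_⟩
  filter_upwards [hev, eventually_gt_atTop ⌈1/ρ⌉₊] with n ⟨s, hs, hcard⟩ hn
  refine ⟨s, hcard, fun f hf => ?_⟩
  have hn1 : 1/ρ < n := Nat.lt_of_ceil_lt hn
  have hn0 : (0:ℝ) < n := lt_of_le_of_lt (by positivity) hn1
  obtain ⟨hfK, hfJ⟩ := hs f hf
  have hmem : (vf n f, (f.J:ℝ)/n^3) ∈ Psi u w '' NB u v w T := by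
    refine interior_subset (hO ▸ hUU ⟨hU hfK, hρU ?_⟩)
    rw [Metric.mem_ball, dist_zero_right, Real.norm_eq_abs, abs_div, abs_of_pos (by positivity : (0:ℝ) < n^3), div_lt_iff₀ (by positivity)]
    rw [div_lt_iff₀ hρ] at hn1
    nlinarith only [hfJ, hn1, pow_pos hn0 2]
  obtain ⟨⟨z, β⟩, ⟨⟨h0, hI, -, -, -, hHA⟩, h2, h2', hc, h3, hβ⟩, he⟩ := hmem
  simp only at h0 hI hHA h2 h2' hc h3 hβ
  obtain ⟨e1, e2⟩ := Prod.ext_iff.1 he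
  obtain ⟨z', y0, y2, y3, pa, pb, pc, pd⟩ := scale_z hn0 u β w z
  have q0 : Pa u β w z = f.a/n := congrFun e1 0
  have q1 : Pb u β w z = f.b/n := congrFun e1 1
  have q2 : Pc u β w z = f.c/n := congrFun e1 2
  have q3 : Pd u β w z = f.d/n := congrFun e1 3
  rw [q0, mul_div_cancel₀ _ hn0.ne'] at pa
  rw [q1, mul_div_cancel₀ _ hn0.ne'] at pb
  rw [q2, mul_div_cancel₀ _ hn0.ne'] at pc
  rw [q3, mul_div_cancel₀ _ hn0.ne'] at pd
  have hsn := Real.sqrt_pos.2 hn0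
  have h0' : 0 < z' 0 := by rw [y0]; positivity
  have h3' : 0 < z' 3 := by rw [y3]; exact h3
  have hHr : Hr (vf n f) = f.Hz/n^2 := by
    simp only [Hr, vf, vc, Matrix.cons_val, Hz]; push_cast; field_simp
  have hK := hθK _ hfK
  have hH : θ*n^2 ≤ |(f.Hz:ℝ)| := by
    rwa [hHr, abs_div, abs_of_pos (by positivity : (0:ℝ) < n^2), le_div_iff₀ (by positivity)] at hK
  have hH0 : (f.Hz:ℝ) ≠ 0 := abs_pos.1 (lt_of_lt_of_le (by positivity) hH)
  have hs2 := Real.sq_sqrt hn0.le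
  have pe : Pe u β w z' = f.e := by
    have j1 := J_PP u β w z' h3'.ne'
    have j2 : (f.J:ℝ) = z' 0^6*(2*β*(36*u*w-β^2)) := by
      have : z 0^6*(2*β*(36*u*w-β^2)) = f.J/n^3 := e2
      rw [eq_div_iff (by positivity)] at this
      rw [← this, y0, mul_pow, show √(n:ℝ)^6 = (√(n:ℝ)^2)^3 by ring, hs2]; ring
    rw [← j2, pa, pb, pc, pd] at j1
    refine mul_left_cancel₀ hH0 ?_
    simp only [J, Hz] at j1 ⊢; push_cast at j1 ⊢; linear_combination j1/9
  have hfr : ∀ x y, f.evalR x y = FR u β w z' x y := fun x y => by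
    simp only [FR, evalR, pa, pb, pc, pd, pe]
  have hcoef : ∀ j, |vf n f j| ≤ C := fun j => (norm_le_pi_norm (vf n f) j).trans (hC _ hfK)
  have hb : ∀ x : ℝ, |x/n| ≤ C → |x| ≤ C*n := fun x h => by
    rwa [abs_div, abs_of_pos hn0, div_le_iff₀ hn0] at h
  refine ⟨⟨z', β, h0', by rwa [y2], by rwa [y2], by rwa [y2, y3], h3', hβ, hfr⟩, fun h => ?_, ?_, hfJ,
    hb _ (hcoef 0), hb _ (hcoef 1), hb _ (hcoef 2), hb _ (hcoef 3), hH⟩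
  · exact (hWO (hKW hfK)).1 (by simp [vf, vc, h])
  · rw [(FR_inv hfr h3'.ne').1, abs_mul, abs_of_pos (by positivity), y0, mul_pow, show √(n:ℝ)^4 = (√(n:ℝ)^2)^2 by ring, hs2]
    nlinarith only [mul_lt_mul_of_pos_left hI (pow_pos hn0 2)]
end BQF
end

section
open Set MeasureTheory Filter
open scoped ENNReal
namespace BQF
theorem TI.small {i : ℕ} {u v w T β : ℝ} (h : TI i u v w T) (hβ : |β-v| < 1/10) : u^2 = 1 ∧ w^2 = 1 ∧
    ((v = 0 ∧ β^2 ≤ 1/100 ∧ (u*w = 1 ∨ u*w = -1)) ∨ (u*w = 1 ∧ β < 0 ∧ 34 < β^2 ∧ β^2 < 38)) := by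
  rw [abs_lt] at hβ
  rcases h with ⟨-, rfl, rfl, rfl, -⟩ | ⟨-, rfl, rfl, rfl, -⟩ | ⟨-, rfl, rfl, rfl, -⟩ | ⟨-, rfl, rfl, rfl, -⟩ <;>
    refine ⟨by norm_num, by norm_num, ?_⟩
  · exact Or.inr ⟨by norm_num, by linarith, by nlinarith, by nlinarith⟩
  all_goals exact Or.inl ⟨rfl, by nlinarith, by norm_num⟩

theorem inv_eq {i : ℕ} {u v w T β β' D D' : ℝ} (h : TI i u v w T) (hb : |β-v| < 1/10) (hb' : |β'-v| < 1/10) (hD : 0 < D) (hD' : 0 < D')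
    (hI : D^2*(12*u*w+β^2) = D'^2*(12*u*w+β'^2)) (hJ : D^3*(2*β*(36*u*w-β^2)) = D'^3*(2*β'*(36*u*w-β'^2))) : D = D' ∧ β = β' := by
  obtain ⟨hu, hw, hs⟩ := h.small hb
  obtain ⟨-, -, hs'⟩ := h.small hb'
  have hP : D*β = D'*β' := by
    by_contra hne
    have e : 4*((D*β)^2+(D*β)*(D'*β')+(D'*β')^2) = 3*(D^2*(12*u*w+β^2)) := by
      refine mul_left_cancel₀ (sub_ne_zero.2 hne) ?_
      linear_combination (3*D'*β')*hI - (1/2)*hJ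
    have p := pow_pos hD 2; have p' := pow_pos hD' 2
    rcases hs with ⟨rfl, h1, h2⟩ | ⟨h1, h2, h3, h4⟩
    · rcases hs' with ⟨-, h1', -⟩ | ⟨-, -, h3, -⟩
      swap; · rw [abs_lt] at hb'; nlinarith
      have k := mul_le_mul_of_nonneg_left h1 p.le
      have k' := mul_le_mul_of_nonneg_left h1' p'.le
      rcases h2 with h2 | h2 <;> rw [mul_assoc 12, h2] at hI e
      · nlinarith [sq_nonneg (D*β-D'*β'), sq_nonneg (D*β)]
      · nlinarith [sq_nonneg (D*β+D'*β'), sq_nonneg (D*β), sq_nonneg (D'*β')]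
    · rcases hs' with ⟨rfl, h1', -⟩ | ⟨-, h2', h3', h4'⟩
      · rw [abs_lt] at hb; nlinarith
      rw [mul_assoc 12, h1] at hI e
      have := mul_pos (mul_pos_of_neg_of_neg h2 h2') (mul_pos hD hD')
      nlinarith [mul_lt_mul_of_pos_left h3 p, mul_lt_mul_of_pos_left h3' p', mul_lt_mul_of_pos_left h4 p]
  have huw : u*w ≠ 0 := mul_ne_zero (fun h => by simp [h] at hu) (fun h => by simp [h] at hw)
  have hDD : D^2 = D'^2 := by
    refine mul_left_cancel₀ huw ?_
    have : (D*β)^2 = (D'*β')^2 := by rw [hP]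
    linear_combination (hI - this)/12
  have : D = D' := (sq_eq_sq₀ hD.le hD'.le).1 hDD
  subst this
  exact ⟨rfl, mul_left_cancel₀ hD.ne' hP⟩

theorem red_int {A B C : ℝ} (hA : 0 < A) (hB : 0 < B) (hBA : 2*B < A) (hAC : A < C) {m l : ℤ} (hl : l ≠ 0) :
    A < A*m^2+2*B*(m*l)+C*l^2 := by
  have h1 : 1 ≤ m^2-|m*l|+l^2 := by
    have : 0 < l^2 := by positivity
    rw [abs_mul]; nlinarith [sq_nonneg (|m|-|l|), sq_abs m, sq_abs l, abs_nonneg m, abs_nonneg l, mul_nonneg (abs_nonneg m) (abs_nonneg l), sq_nonneg (2*|m|-|l|)]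
  have h1 : (1:ℝ) ≤ m^2-|(m:ℝ)*l|+l^2 := by exact_mod_cast h1
  have h2 : 0 < (l:ℝ)^2 := by positivity
  have h3 := abs_nonneg ((m:ℝ)*l)
  have h4 := neg_abs_le ((m:ℝ)*l)
  nlinarith [mul_lt_mul_of_pos_right hAC h2, mul_le_mul_of_nonneg_left h1 hA.le, mul_le_mul_of_nonneg_left h4 hB.le, mul_le_mul_of_nonneg_right hBA.le h3]

theorem fin_int {A B C A' B' C' : ℝ} {m k l o : ℤ} (pA : 0 < A) (pA' : 0 < A') (k1 : 0 < B) (k2 : 2*B < A) (k3 : A < C)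
    (k1' : 0 < B') (k2' : 2*B' < A') (k3' : A' < C') (hd : m*o-k*l = 1 ∨ m*o-k*l = -1) (hdR : ((m:ℝ)*o-k*l)^2 = 1)
    (e1 : A' = A*m^2+2*B*(m*l)+C*l^2) (e2 : B' = A*(m*k)+B*(m*o+k*l)+C*(l*o)) (e3 : C' = A*k^2+2*B*(k*o)+C*o^2) :
    l = 0 ∧ m*k = 0 ∧ m*o = 1 := by
  have hl : l = 0 := by
    by_contra hl
    have r1 := red_int pA k1 k2 k3 (m := m) hl
    have r2 := red_int pA' k1' k2' k3' (m := o) (neg_ne_zero.2 hl)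
    rw [← e1] at r1
    have : A'*o^2+2*B'*(o*(-l:ℤ))+C'*(-l:ℤ)^2 = A := by
      push_cast; rw [e1, e2, e3]; linear_combination A*hdR
    linarith
  subst hl
  have hmo : m*o = 1 ∨ m*o = -1 := by simpa using hd
  have hm2 : (m:ℝ)^2 = 1 := by
    have : m^2 = 1 := by
      rcases Int.isUnit_iff.1 (isUnit_of_mul_isUnit_left (Int.isUnit_iff.2 hmo)) with h | h <;> rw [h] <;> norm_num
    exact_mod_cast this
  simp only [Int.cast_zero, mul_zero, ne_eq, OfNat.ofNat_ne_zero, not_false_eq_true, zero_pow, add_zero, zero_mul, hm2, mul_one] at e1 e2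
  rw [e1] at k2'
  refine ⟨rfl, ?_⟩
  · rcases hmo with hmo | hmo
    · have : (m:ℝ)*o = 1 := by exact_mod_cast hmo
      rw [this] at e2
      have u1 : ((m*k:ℤ):ℝ) < 1 := by push_cast; exact lt_of_mul_lt_mul_left (by linarith : A*((m:ℝ)*k) < A*1) pA.le
      have u2 : (-1:ℝ) < ((m*k:ℤ):ℝ) := by push_cast; exact lt_of_mul_lt_mul_left (by linarith : A*(-1) < A*((m:ℝ)*k)) pA.le
      have u1 : m*k < 1 := by exact_mod_cast u1
      have u2 : -1 < m*k := by exact_mod_cast u2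
      exact ⟨by omega, hmo⟩
    · exfalso
      have : (m:ℝ)*o = -1 := by exact_mod_cast hmo
      rw [this] at e2
      have u1 : ((m*k:ℤ):ℝ) < 1 := by push_cast; exact lt_of_mul_lt_mul_left (by linarith : A*((m:ℝ)*k) < A*1) pA.le
      have u2 : (0:ℝ) < ((m*k:ℤ):ℝ) := by push_cast; exact lt_of_mul_lt_mul_left (by linarith : A*0 < A*((m:ℝ)*k)) pA.le
      have u1 : m*k < 1 := by exact_mod_cast u1
      have u2 : 0 < m*k := by exact_mod_cast u2
      omega

theorem dist_same {i : ℕ} {u v w T : ℝ} (h : TI i u v w T) {f g : BQF} (hf : GLo u v w f) (hg : GLo u v w g) (he : Equivalent f g) :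
    f = g := by
  obtain ⟨m, k, l, o, hd, rfl⟩ := equiv_iff.1 he
  obtain ⟨z, β, h0, h2, h2', hc, h3, hb, hfr⟩ := hf
  obtain ⟨z', β', h0', hx, hx', hc', h3', hb', hgr⟩ := hg
  obtain ⟨i1, j1, -⟩ := FR_inv hfr h3.ne'
  obtain ⟨i2, j2, -⟩ := FR_inv hgr h3'.ne'
  have hI : z 0^4*(12*u*w+β^2) = z' 0^4*(12*u*w+β'^2) := by rw [← i1, ← i2, he.I_eq]
  have hJ : z 0^6*(2*β*(36*u*w-β^2)) = z' 0^6*(2*β'*(36*u*w-β'^2)) := by rw [← j1, ← j2, he.J_eq]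
  obtain ⟨hD, rfl⟩ := inv_eq h hb hb' (pow_pos h0 2) (pow_pos h0' 2) (by linear_combination hI) (by linear_combination hJ)
  have hz : z 0 = z' 0 := (sq_eq_sq₀ h0.le h0'.le).1 hD
  obtain ⟨hu, hw, hs⟩ := h.small hb
  have hv : 4*u*w ≠ β^2 := by
    rw [mul_assoc]
    rcases hs with ⟨-, h1, h2 | h2⟩ | ⟨h1, -, h2, -⟩
    · rw [h2]; intro h; linarith [sq_nonneg β]
    · rw [h2]; intro h; linarith [sq_nonneg β]
    · rw [h1]; intro h; linarith [sq_nonneg β]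
  have hdR : ((m:ℝ)*o-k*l)^2 = 1 := by
    have : (m*o-k*l)^2 = 1 := by rcases hd with h | h <;> rw [h] <;> norm_num
    exact_mod_cast this
  have dM := det_M h0 h3
  have dM' := det_M h0' h3'
  have key := stab (p := mp z*m+mq z*l) (q := mp z*k+mq z*o) (r := mr z*m+mt z*l) (t := mr z*k+mt z*o)
    (p' := mp z') (q' := mq z') (r' := mr z') (t' := mt z') hu hw hv
  have ed : (mp z*m+mq z*l)*(mr z*k+mt z*o)-(mp z*k+mq z*o)*(mr z*m+mt z*l) = z 0*((m:ℝ)*o-k*l) := by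
    rw [← dM]; ring
  rw [ed, dM', mul_pow, hdR, mul_one, hz] at key
  have hne : (m:ℝ)*o-k*l ≠ 0 := fun h => by simp [h] at hdR
  obtain ⟨ε, η, hε, hη, hcs⟩ := key (mul_ne_zero h0'.ne' hne) rfl fun X Y => by
    rw [← FR_eq h0' h3', ← hgr, evalR_sub, hfr, FR_eq h0 h3]; congr 1 <;> ring
  have hε : ε^2 = 1 := by rcases hε with h | h <;> rw [h] <;> norm_num
  have hη : η^2 = 1 := by rcases hη with h | h <;> rw [h] <;> norm_num
  obtain ⟨a1, a2, a3⟩ := mxy z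
  obtain ⟨b1, b2, b3⟩ := mxy z'
  have a4 : mq z^2+mt z^2 = mu z^2*(z 2^2+z 3^2) := by
    have := Real.cos_sq_add_sin_sq (z 1); unfold mq mt; linear_combination (mu z^2*(z 2^2+z 3^2))*this
  have b4 : mq z'^2+mt z'^2 = mu z'^2*(z' 2^2+z' 3^2) := by
    have := Real.cos_sq_add_sin_sq (z' 1); unfold mq mt; linear_combination (mu z'^2*(z' 2^2+z' 3^2))*this
  rw [a3] at a1; rw [b3] at b1
  have pA := pow_pos (mu_pos h0 h3) 2
  have pA' := pow_pos (mu_pos h0' h3') 2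
  have e1 : mu z'^2 = mu z^2*m^2+2*(mu z^2*z 2)*(m*l)+mu z^2*(z 2^2+z 3^2)*l^2 := by
    rw [← a4, a1, ← a3, ← b3]
    rcases hcs with ⟨q1, q2, q3, q4⟩ | ⟨-, q1, q2, q3, q4⟩ <;> rw [q1, q3, mul_pow, mul_pow, hε, hη] <;> ring
  have e2 : mu z'^2*z' 2 = mu z^2*(m*k)+(mu z^2*z 2)*(m*o+k*l)+mu z^2*(z 2^2+z 3^2)*(l*o) := by
    rw [← a4, a1, ← a3, b1]
    rcases hcs with ⟨q1, q2, q3, q4⟩ | ⟨-, q1, q2, q3, q4⟩ <;> rw [q1, q2, q3, q4] <;>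
    [linear_combination ((mp z*m+mq z*l)*(mp z*k+mq z*o))*hε + ((mr z*m+mt z*l)*(mr z*k+mt z*o))*hη;
     linear_combination ((mp z*m+mq z*l)*(mp z*k+mq z*o))*hη + ((mr z*m+mt z*l)*(mr z*k+mt z*o))*hε]
  have e3 : mu z'^2*(z' 2^2+z' 3^2) = mu z^2*k^2+2*(mu z^2*z 2)*(k*o)+mu z^2*(z 2^2+z 3^2)*o^2 := by
    rw [← a4, a1, ← a3, ← b4]
    rcases hcs with ⟨q1, q2, q3, q4⟩ | ⟨-, q1, q2, q3, q4⟩ <;> rw [q2, q4, mul_pow, mul_pow, hε, hη] <;> ring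
  clear a1 a2 a3 a4 b1 b2 b3 b4 hcs
  have k1 : 0 < mu z^2*z 2 := mul_pos pA h2
  have k2 : 2*(mu z^2*z 2) < mu z^2 := by nlinarith only [pA, h2']
  have k3 : mu z^2 < mu z^2*(z 2^2+z 3^2) := by nlinarith only [pA, hc]
  have k1' : 0 < mu z'^2*z' 2 := mul_pos pA' hx
  have k2' : 2*(mu z'^2*z' 2) < mu z'^2 := by nlinarith only [pA', hx']
  have k3' : mu z'^2 < mu z'^2*(z' 2^2+z' 3^2) := by nlinarith only [pA', hc']
  obtain ⟨rfl, hk⟩ := fin_int pA pA' k1 k2 k3 k1' k2' k3' hd hdR e1 e2 e3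
  rcases Int.mul_eq_one_iff_eq_one_or_neg_one.1 hk.2 with ⟨rfl, rfl⟩ | ⟨rfl, rfl⟩
  all_goals
    have hk0 : k = 0 := by simpa using hk.1
    subst hk0; simp [sub]
end BQF
end

section
open Set MeasureTheory Filter
open scoped ENNReal
namespace BQF
theorem def_pos {u β w x y : ℝ} (hu : u^2 = 1) (hw : w = u) (hb : β^2 ≤ 1/100) : (x^4+y^4)/2 ≤ u*SS u β w x y := by
  rw [hw, SS, show u*(u*x^4+β*x^2*y^2+u*y^4) = u^2*(x^4+y^4)+(u*β)*(x^2*y^2) by ring, hu]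
  have : -(1/10) ≤ u*β := (abs_le_of_sq_le_sq' (by rw [mul_pow, hu]; linarith) (by norm_num)).1
  nlinarith only [mul_le_mul_of_nonneg_right this (by positivity : 0 ≤ x^2*y^2), sq_nonneg (x^2-y^2), sq_nonneg (x^2), sq_nonneg (y^2)]

theorem dist_pm {u v u' v' : ℝ} (hu : u^2 = 1) (hu' : u' = -u) (hv : v = 0) (hv' : v' = 0) {f g : BQF} (hf : GLo u v u f) (hg : GLo u' v' u' g)
    (ha : g.a ≠ 0) : ¬ Equivalent f g := by
  intro he
  obtain ⟨m, k, l, o, hd, rfl⟩ := equiv_iff.1 he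
  obtain ⟨z, β, h0, h2, h2', hc, h3, hb, hfr⟩ := hf
  obtain ⟨z', β', h0', hx, hx', hc', h3', hb', hgr⟩ := hg
  subst hv hv' hu'
  rw [sub_zero, abs_lt] at hb hb'
  have e1 := hgr 1 0
  rw [evalR_sub, hfr, FR_eq h0 h3, FR_eq h0' h3'] at e1
  have p1 := def_pos (x := mp z*(m*1+k*0)+mq z*(l*1+o*0)) (y := mr z*(m*1+k*0)+mt z*(l*1+o*0)) hu rfl (by nlinarith only [hb.1, hb.2] : β^2 ≤ 1/100)
  have p2 := def_pos (x := mp z'*1+mq z'*0) (y := mr z'*1+mt z'*0) (by rw [neg_sq]; exact hu) rfl (by nlinarith only [hb'.1, hb'.2] : β'^2 ≤ 1/100)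
  rw [e1] at p1
  have h4 : (mp z'*1+mq z'*0)^4 + (mr z'*1+mt z'*0)^4 ≤ 0 := by
    have : 0 ≤ ((mp z*(m*1+k*0)+mq z*(l*1+o*0))^4+(mr z*(m*1+k*0)+mt z*(l*1+o*0))^4)/2 := by positivity
    linarith
  have hd := det_M h0' h3'
  have q1 : mp z'^4 ≤ 0 := by nlinarith only [h4, sq_nonneg (mr z'^2)]
  have q2 : mr z'^4 ≤ 0 := by nlinarith only [h4, sq_nonneg (mp z'^2)]
  rw [pow_eq_zero_iff (four_ne_zero) |>.1 (le_antisymm q1 (by positivity)), pow_eq_zero_iff (four_ne_zero) |>.1 (le_antisymm q2 (by positivity))] at hd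
  linarith

theorem roots_map {f : BQF} {u β w p q r t : ℝ} (hu : u ≠ 0) (ha : f.a ≠ 0) (hd : p*t-q*r ≠ 0)
    (h : ∀ x y, f.evalR x y = SS u β w (p*x+q*y) (r*x+t*y)) : f.realRoots.ncard = {τ : ℝ | SS u β w τ 1 = 0}.ncard := by
  have hp : ∀ τ, SS u β w τ 1 = 0 → p-τ*r ≠ 0 := fun τ hτ h0 => by
    have e := h 1 0
    rw [show p = τ*r by linarith] at e
    have : (f.a:ℝ) = r^4*SS u β w τ 1 := by simp only [evalR, SS] at e ⊢; linear_combination e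
    rw [hτ, mul_zero] at this; exact ha (by exact_mod_cast this)
  have hS : ∀ τ Y, SS u β w (τ*Y) Y = Y^4*SS u β w τ 1 := fun τ Y => by simp only [SS]; ring
  have e : f.realRoots = (fun τ => (τ*t-q)/(p-τ*r)) '' {τ : ℝ | SS u β w τ 1 = 0} := by
    ext x
    constructor
    · intro hx
      have hx : f.evalR x 1 = 0 := hx
      rw [h] at hx
      have hY : r*x+t*1 ≠ 0 := fun hY => by
        simp only [hY, SS, ne_eq, OfNat.ofNat_ne_zero, not_false_eq_true, zero_pow, mul_zero, add_zero, mul_eq_zero, hu, false_or, pow_eq_zero_iff] at hx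
        exact hd (by linear_combination p*hY - r*hx)
      obtain ⟨τ, hτ⟩ : ∃ τ, p*x+q*1 = τ*(r*x+t*1) := ⟨_, (div_mul_cancel₀ _ hY).symm⟩
      rw [hτ, hS] at hx
      have hR := (mul_eq_zero.1 hx).resolve_left (pow_ne_zero _ hY)
      refine ⟨τ, hR, ?_⟩
      simp only; rw [div_eq_iff (hp _ hR)]; linear_combination -hτ
    · rintro ⟨τ, hτ, rfl⟩
      have h2 := div_mul_cancel₀ (τ*t-q) (hp τ hτ)
      change f.evalR _ 1 = 0
      simp only
      generalize (τ*t-q)/(p-τ*r) = x at *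
      have hτ : SS u β w τ 1 = 0 := hτ
      rw [h, show p*x+q*1 = τ*(r*x+t*1) by linear_combination h2, hS, hτ, mul_zero]
  rw [e, InjOn.ncard_image]
  intro τ hτ τ' hτ' he
  simp only at he
  rw [div_eq_div_iff (hp _ hτ) (hp _ hτ')] at he
  exact mul_left_cancel₀ hd (by linear_combination he)

theorem low_roots {i : ℕ} {u v w T : ℝ} (hTI : TI i u v w T) {f : BQF} (hf : GLo u v w f) (ha : f.a ≠ 0) :
    f.realRoots.ncard = 4-2*i := by
  obtain ⟨z, β, h0, h2, h2', hc, h3, hb, hfr⟩ := hf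
  obtain ⟨hu, hw, -⟩ := hTI.small hb
  rw [roots_map (u := u) (fun h => by simp [h] at hu) ha (by rw [det_M h0 h3]; exact h0.ne') fun x y => by rw [hfr, FR_eq h0 h3]]
  rw [abs_lt] at hb
  have hdef : ∀ u β w : ℝ, u^2 = 1 → w = u → β^2 ≤ 1/100 → {τ : ℝ | SS u β w τ 1 = 0}.ncard = 0 := fun u β w hu hw hb => by
    have : {τ : ℝ | SS u β w τ 1 = 0} = ∅ := by
      ext τ
      simp only [mem_ofPred_eq, mem_empty_iff_false, iff_false]
      intro h
      have := def_pos (x := τ) (y := 1) hu hw hb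
      rw [h] at this; nlinarith only [this, sq_nonneg (τ^2)]
    rw [this, ncard_empty]
  rcases hTI with ⟨rfl, rfl, rfl, rfl, -⟩ | ⟨rfl, rfl, rfl, rfl, -⟩ | ⟨rfl, rfl, rfl, rfl, -⟩ | ⟨rfl, rfl, rfl, rfl, -⟩
  · have hs := Real.sq_sqrt (by nlinarith only [hb.1, hb.2] : 0 ≤ β^2-4)
    have hs0 : 0 < √(β^2-4) := Real.sqrt_pos.2 (by nlinarith only [hb.1, hb.2])
    have hs1 : √(β^2-4) < -β := by nlinarith only [hs, hb.2]
    generalize √(β^2-4) = R at *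
    have e1 := Real.sq_sqrt (by linarith : 0 ≤ (-β-R)/2)
    have e2 := Real.sq_sqrt (by linarith : 0 ≤ (-β+R)/2)
    have p1 := Real.sqrt_pos.2 (by linarith : 0 < (-β-R)/2)
    have p2 : √((-β-R)/2) < √((-β+R)/2) := Real.sqrt_lt_sqrt (by linarith) (by linarith)
    generalize √((-β-R)/2) = a at *
    generalize √((-β+R)/2) = b at *
    have : {τ : ℝ | SS 1 β 1 τ 1 = 0} = {a, -a, b, -b} := by
      ext τ
      have : SS 1 β 1 τ 1 = (τ-a)*(τ+a)*((τ-b)*(τ+b)) := by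
        rw [SS, show (τ-a)*(τ+a)*((τ-b)*(τ+b)) = (τ^2-a^2)*(τ^2-b^2) by ring, e1, e2]; linear_combination hs/4
      simp only [mem_ofPred_eq, this, mul_eq_zero, mem_insert_iff, mem_singleton_iff, sub_eq_zero, add_eq_zero_iff_eq_neg, or_assoc]
    rw [this, ncard_insert_of_notMem, ncard_insert_of_notMem, ncard_pair (by linarith)]
    · simp; exact ⟨by linarith, by linarith⟩
    · simp; exact ⟨by linarith, by linarith, by linarith⟩
  · have hs := Real.sq_sqrt (by positivity : 0 ≤ β^2+4)
    have hs0 : 0 < √(β^2+4) := Real.sqrt_pos.2 (by nlinarith only [hb.1, hb.2])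
    have hs1 : |β| < √(β^2+4) := Real.lt_sqrt_of_sq_lt (by rw [sq_abs]; linarith)
    rw [abs_lt] at hs1
    generalize √(β^2+4) = R at *
    have e2 := Real.sq_sqrt (by linarith : 0 ≤ (-β+R)/2)
    have p2 := Real.sqrt_pos.2 (by linarith : 0 < (-β+R)/2)
    generalize √((-β+R)/2) = b at *
    have : {τ : ℝ | SS 1 β (-1) τ 1 = 0} = {b, -b} := by
      ext τ
      have : SS 1 β (-1) τ 1 = (τ^2+(β+R)/2)*((τ-b)*(τ+b)) := by
        rw [SS, show (τ-b)*(τ+b) = τ^2-b^2 by ring, e2]; linear_combination hs/4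
      have hne : τ^2+(β+R)/2 ≠ 0 := by have := sq_nonneg τ; intro h; linarith
      simp only [mem_ofPred_eq, this, mul_eq_zero, mem_insert_iff, mem_singleton_iff, sub_eq_zero, add_eq_zero_iff_eq_neg, hne, false_or]
    rw [this, ncard_pair (by linarith)]
  · exact hdef _ _ _ hu rfl (by nlinarith only [hb.1, hb.2])
  · exact hdef _ _ _ hu rfl (by nlinarith only [hb.1, hb.2])
end BQF
end

section
open Polynomial
namespace BQF
theorem gauss {f : BQF} (ha : f.a ≠ 0) (hf : ¬ f.Irred) :
    (∃ k m p q r t : ℤ, f.a = k*p ∧ f.b = k*q+m*p ∧ f.c = k*r+m*q ∧ f.d = k*t+m*r ∧ f.e = m*t) ∨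
    (∃ k m l p q r : ℤ, f.a = k*p ∧ f.b = k*q+m*p ∧ f.c = k*r+m*q+l*p ∧ f.d = m*r+l*q ∧ f.e = l*r) := by
  obtain ⟨P, hP⟩ : ∃ P : ℤ[X], P = C f.a*X^4+C f.b*X^3+C f.c*X^2+C f.d*X+C f.e := ⟨_, rfl⟩
  have hc : P.coeff 4 = f.a ∧ P.coeff 3 = f.b ∧ P.coeff 2 = f.c ∧ P.coeff 1 = f.d ∧ P.coeff 0 = f.e := by
    rw [hP]; refine ⟨?_, ?_, ?_, ?_, ?_⟩ <;> simp [coeff_X, coeff_C, -eq_intCast, -map_intCast, -Int.cast_id]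
  have hdeg : P.natDegree = 4 := by rw [hP]; compute_degree!
  have hP0 : P ≠ 0 := by rintro rfl; simp at hdeg
  have hirr : ¬ Irreducible (P.map (Int.castRingHom ℚ)) := by
    intro h; refine hf ⟨ha, ?_⟩; rw [hP] at h; simpa using h
  have hcont : P.content ≠ 0 := by rwa [Ne, content_eq_zero_iff]
  have hpp : ¬ Irreducible P.primPart := by
    rw [IsPrimitive.Int.irreducible_iff_irreducible_map_cast P.isPrimitive_primPart]
    intro h; apply hirr
    rw [P.eq_C_content_mul_primPart, Polynomial.map_mul, map_C]
    refine (irreducible_isUnit_mul (isUnit_C.2 ?_)).2 h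
    simpa using hcont
  have hnu : ¬ IsUnit P.primPart := fun h => by
    have := natDegree_eq_zero_of_isUnit h
    rw [natDegree_primPart] at this; omega
  rw [irreducible_iff] at hpp
  push Not at hpp
  obtain ⟨g, h, hgh, hg, hh⟩ := hpp hnu
  have key : ∀ g : ℤ[X], g ∣ P.primPart → ¬ IsUnit g → 1 ≤ g.natDegree := by
    intro g hd hu
    by_contra h0
    rw [eq_C_of_natDegree_eq_zero (by omega : g.natDegree = 0)] at hd hu
    exact hu (isUnit_C.2 (P.isPrimitive_primPart _ hd))
  have hg1 := key g ⟨h, hgh⟩ hg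
  have hh1 := key h ⟨g, by rw [hgh, mul_comm]⟩ hh
  have hs : g.natDegree + h.natDegree = 4 := by
    rw [← natDegree_mul (by rintro rfl; simp at hg1) (by rintro rfl; simp at hh1), ← hgh, natDegree_primPart, hdeg]
  have main : ∀ g h : ℤ[X], P = g*h → g.natDegree + h.natDegree = 4 → 1 ≤ g.natDegree → g.natDegree ≤ 2 →
    (∃ k m p q r t : ℤ, f.a = k*p ∧ f.b = k*q+m*p ∧ f.c = k*r+m*q ∧ f.d = k*t+m*r ∧ f.e = m*t) ∨
    (∃ k m l p q r : ℤ, f.a = k*p ∧ f.b = k*q+m*p ∧ f.c = k*r+m*q+l*p ∧ f.d = m*r+l*q ∧ f.e = l*r) := by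
    intro g h e hs h1 h2
    obtain ⟨c4, c3, c2, c1, c0⟩ := hc
    rw [e] at c4 c3 c2 c1 c0
    simp only [coeff_mul, Finset.Nat.antidiagonal_succ] at c4 c3 c2 c1 c0
    have z4 : g.coeff 4 = 0 := coeff_eq_zero_of_natDegree_lt (by omega)
    have z3 : g.coeff 3 = 0 := coeff_eq_zero_of_natDegree_lt (by omega)
    have y4 : h.coeff 4 = 0 := coeff_eq_zero_of_natDegree_lt (by omega)
    simp [z4, z3, y4] at c4 c3 c2 c1 c0
    rcases (by omega : g.natDegree = 1 ∨ g.natDegree = 2) with hd | hd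
    · have z2 : g.coeff 2 = 0 := coeff_eq_zero_of_natDegree_lt (by omega)
      rw [z2] at c4 c3 c2
      exact Or.inl ⟨g.coeff 1, g.coeff 0, h.coeff 3, h.coeff 2, h.coeff 1, h.coeff 0, by linarith, by linarith, by linarith, by linarith, by linarith⟩
    · have y3 : h.coeff 3 = 0 := coeff_eq_zero_of_natDegree_lt (by omega)
      rw [y3] at c4 c3
      exact Or.inr ⟨g.coeff 2, g.coeff 1, g.coeff 0, h.coeff 2, h.coeff 1, h.coeff 0, by linarith, by linarith, by linarith, by linarith, by linarith⟩
  have e : P = (C P.content*g)*h := by rw [mul_assoc, ← hgh]; exact P.eq_C_content_mul_primPart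
  have e' : P = h*(C P.content*g) := by rw [mul_comm]; exact e
  have hd : (C P.content*g).natDegree = g.natDegree := natDegree_C_mul hcont
  rcases le_total g.natDegree 2 with h2 | h2
  · exact main _ _ e (by omega) (by omega) (by omega)
  · exact main _ _ e' (by omega) (by omega) (by omega)

theorem sublev {P : ℝ[X]} {d : ℕ} {ρ : ℝ} (hd : P.natDegree = d) (h1 : 1 ≤ d) (hl : 1 ≤ |P.leadingCoeff|) (hρ : 0 ≤ ρ)
    {s : Finset ℤ} (hs : ∀ c ∈ s, |P.eval (c:ℝ)| ≤ ρ^d) : (s.card : ℝ) ≤ d*(2*ρ+1) := by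
  classical
  obtain ⟨Q, hQ⟩ : ∃ Q : ℂ[X], Q = P.map (algebraMap ℝ ℂ) := ⟨_, rfl⟩
  have hsp : Q.Splits := IsAlgClosed.splits Q
  have hcard : Q.roots.card = d := by rw [← hsp.natDegree_eq_card_roots, hQ, natDegree_map, hd]
  have near : ∀ c ∈ s, ∃ z ∈ Q.roots, ‖(c:ℂ)-z‖ ≤ ρ := by
    intro c hc
    by_contra! h
    have e := hsp.eval_eq_prod_roots (c:ℂ)
    have e1 : ‖Q.eval (c:ℂ)‖ = |P.eval (c:ℝ)| := by
      rw [hQ, eval_map_algebraMap, show (c:ℂ) = algebraMap ℝ ℂ (c:ℝ) by simp, aeval_algebraMap_apply]; simp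
    have e2 : ‖Q.leadingCoeff‖ = |P.leadingCoeff| := by rw [hQ, leadingCoeff_map]; simp
    rw [e, norm_mul, e2] at e1
    have : ∀ m : Multiset ℂ, (∀ z ∈ m, ρ < ‖(c:ℂ)-z‖) → 0 < m.card → ρ^m.card < ‖(m.map fun z => (c:ℂ)-z).prod‖ := by
      intro m
      induction m using Multiset.induction_on with
      | empty => simp
      | cons z m ih =>
        intro hm _
        rw [Multiset.map_cons, Multiset.prod_cons, norm_mul, Multiset.card_cons, pow_succ']
        have hz := hm z (Multiset.mem_cons_self _ _)
        rcases Nat.eq_zero_or_pos m.card with h0 | h0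
        · rw [Multiset.card_eq_zero.1 h0]; simpa using hz
        · have := ih (fun w hw => hm w (Multiset.mem_cons_of_mem hw)) h0
          exact mul_lt_mul'' hz this hρ (by positivity)
    have h3 := this _ h (by omega)
    rw [hcard] at h3
    nlinarith only [h3, hs c hc, e1, hl, norm_nonneg (Multiset.map (fun z => (c:ℂ)-z) Q.roots).prod]
  choose! z hz hn using near
  have hb : s.card ≤ _ := Finset.card_le_mul_card_image (f := z) s ⌊2*ρ+1⌋₊ (by
    intro w _
    apply Nat.le_floor
    refine card_window (by positivity) fun x hx y hy => ?_
    rw [Finset.mem_filter] at hx hy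
    have a1 := hn x hx.1; have a2 := hn y hy.1
    rw [hx.2] at a1; rw [hy.2] at a2
    have : ‖((x:ℂ)-w)-((y:ℂ)-w)‖ ≤ ρ+ρ := (norm_sub_le _ _).trans (by linarith)
    rw [sub_sub_sub_cancel_right] at this
    have e : ((x:ℂ)-y) = (((x:ℝ)-y : ℝ):ℂ) := by simp
    rw [e, Complex.norm_real, Real.norm_eq_abs] at this; linarith)
  have hi : (s.image z).card ≤ d := by
    rw [← hcard]
    refine (Finset.card_le_card (t := Q.roots.toFinset) ?_).trans (Multiset.toFinset_card_le _)
    intro w hw; obtain ⟨c, hc, rfl⟩ := Finset.mem_image.1 hw; exact Multiset.mem_toFinset.2 (hz c hc)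
  calc (s.card:ℝ) ≤ (⌊2*ρ+1⌋₊ * (s.image z).card : ℕ) := by exact_mod_cast hb
    _ ≤ (2*ρ+1)*d := by
      push_cast
      exact mul_le_mul (Nat.floor_le (by positivity)) (by exact_mod_cast hi) (by positivity) (by positivity)
    _ = _ := by ring
end BQF
end

section
open Polynomial
namespace BQF
theorem ext5 {f g : BQF} (ha : f.a = g.a) (hb : f.b = g.b) (hc : f.c = g.c) (hd : f.d = g.d) (he : f.e = g.e) : f = g := by
  cases f; cases g; simp_all

theorem fib {β : Type*} [DecidableEq β] {s : Finset BQF} {T : Finset β} {Φ : BQF → β} {ψ : BQF → ℤ} {d : ℕ} {ρ : ℝ}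
    (h1 : 1 ≤ d) (h3 : d ≤ 3) (hρ : 0 ≤ ρ) (hT : ∀ f ∈ s, Φ f ∈ T) (hi : ∀ f ∈ s, ∀ g ∈ s, Φ f = Φ g → ψ f = ψ g → f = g)
    (hP : ∀ g ∈ s, ∃ P : ℝ[X], P.natDegree = d ∧ 1 ≤ |P.leadingCoeff| ∧ ∀ f ∈ s, Φ f = Φ g → |P.eval (ψ f:ℝ)| ≤ ρ^d) :
    (s.card:ℝ) ≤ 3*(2*ρ+1)*T.card := by
  classical
  have hb : s.card ≤ _ := Finset.card_le_mul_card_image (f := Φ) s ⌊3*(2*ρ+1)⌋₊ (by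
    intro w hw
    obtain ⟨g, hg, rfl⟩ := Finset.mem_image.1 hw
    obtain ⟨P, hd, hl, hP⟩ := hP g hg
    apply Nat.le_floor
    rw [← Finset.card_image_of_injOn (f := ψ)]
    · refine (sublev hd h1 hl hρ ?_).trans (mul_le_mul_of_nonneg_right (by exact_mod_cast h3) (by positivity))
      intro c hc
      obtain ⟨f, hf, rfl⟩ := Finset.mem_image.1 hc
      rw [Finset.mem_filter] at hf
      exact hP f hf.1 hf.2
    · intro f hf f' hf' he
      rw [Finset.mem_coe, Finset.mem_filter] at hf hf'
      exact hi f hf.1 f' hf'.1 (hf.2.trans hf'.2.symm) he)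
  have ht : (s.image Φ).card ≤ T.card := Finset.card_le_card fun w hw => by
    obtain ⟨f, hf, rfl⟩ := Finset.mem_image.1 hw; exact hT f hf
  calc (s.card:ℝ) ≤ (⌊3*(2*ρ+1)⌋₊ * (s.image Φ).card : ℕ) := by exact_mod_cast hb
    _ ≤ _ := by
      push_cast
      exact mul_le_mul (Nat.floor_le (by positivity)) (by exact_mod_cast ht) (by positivity) (by positivity)

noncomputable def ZN (N : ℕ) : Finset ℤ := Finset.Icc (-N) N
noncomputable def DP (N : ℕ) : Finset (ℤ×ℤ) := (ZN N ×ˢ ZN N).filter fun x => x.1*x.2 ≠ 0 ∧ |x.1*x.2| ≤ N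

theorem ZN_mem {N : ℕ} {x : ℤ} : x ∈ ZN N ↔ |x| ≤ N := by rw [ZN, Finset.mem_Icc, abs_le]

theorem ZN_card (N : ℕ) : ((ZN N).card : ℝ) = 2*N+1 := by
  rw [ZN, Int.card_Icc, show ((N:ℤ)+1- -N).toNat = 2*N+1 by omega]; push_cast; ring

theorem DP_mem {N : ℕ} {x y : ℤ} (h0 : x*y ≠ 0) (h : |x*y| ≤ N) : (x, y) ∈ DP N := by
  have := left_ne_zero_of_mul h0; have := right_ne_zero_of_mul h0
  rw [DP, Finset.mem_filter, Finset.mem_product, ZN_mem, ZN_mem]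
  rw [abs_mul] at *
  have h1 := Int.one_le_abs this; have h2 := Int.one_le_abs ‹x ≠ 0›
  exact ⟨⟨by nlinarith, by nlinarith⟩, h0, h⟩

theorem DP_card (N : ℕ) : ((DP N).card : ℝ) ≤ 4*N*(1+Real.log N) := by
  have h := card_nest (s := DP N) Prod.fst ((ZN N).erase 0) (fun k => (fun j : ℕ => 2*((N:ℝ)/j)) k.natAbs) (by
    rintro ⟨x, y⟩ hx
    rw [DP, Finset.mem_filter, Finset.mem_product] at hx
    exact Finset.mem_erase.2 ⟨left_ne_zero_of_mul hx.2.1, hx.1.1⟩) (by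
    intro k hk
    have hk0 : 0 < k.natAbs := Int.natAbs_pos.2 (Finset.mem_erase.1 hk).1
    have e : ((DP N).filter fun x => x.1 = k).card ≤ ((Finset.Icc (1:ℤ) (N/k.natAbs)) ∪ (Finset.Icc (-(N/k.natAbs:ℤ)) (-1))).card := by
      refine Finset.card_le_card_of_injOn Prod.snd ?_ ?_
      · rintro ⟨x, y⟩ hx
        rw [Finset.mem_coe, Finset.mem_filter, DP, Finset.mem_filter] at hx
        obtain ⟨⟨_, h0, h1⟩, rfl⟩ := hx
        have hy := right_ne_zero_of_mul h0
        simp only at h0 h1 hk0 hy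
        have : |y| ≤ N/(x.natAbs:ℤ) := by
          rw [Int.le_ediv_iff_mul_le (by exact_mod_cast hk0), Int.natCast_natAbs, mul_comm, ← abs_mul]; exact h1
        rw [abs_le] at this
        simp only [Finset.coe_union, Finset.coe_Icc, Set.mem_union, Set.mem_Icc]; omega
      · rintro ⟨x, y⟩ hx ⟨x', y'⟩ hx' he
        rw [Finset.mem_coe, Finset.mem_filter] at hx hx'
        exact Prod.ext (hx.2.trans hx'.2.symm) he
    have e2 := e.trans (Finset.card_union_le _ _)
    rw [Int.card_Icc, Int.card_Icc] at e2
    have e3 : (((N/k.natAbs : ℕ)):ℝ) ≤ N/k.natAbs := Nat.cast_div_le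
    have e4 : ((DP N).filter fun x => x.1 = k).card ≤ 2*(N/k.natAbs) := by
      refine e2.trans ?_
      rw [← Int.natCast_ediv]
      omega
    have e5 : ((((DP N).filter fun x => x.1 = k).card : ℕ):ℝ) ≤ (2*(N/k.natAbs) : ℕ) := by exact_mod_cast e4
    push_cast at e5 ⊢; push_cast at e3; linarith)
  refine (h.trans (sum_even (fun j : ℕ => 2*((N:ℝ)/j)) (fun j => by positivity) _)).trans ?_
  have h2 : ((ZN N).erase 0).image Int.natAbs ⊆ Finset.Icc 1 N := by
    intro j hj
    obtain ⟨k, hk, rfl⟩ := Finset.mem_image.1 hj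
    rw [Finset.mem_erase, ZN, Finset.mem_Icc] at hk
    rw [Finset.mem_Icc]; omega
  have h3 := Finset.sum_le_sum_of_subset_of_nonneg h2 (f := fun j : ℕ => 2*((N:ℝ)/j)) (fun j _ _ => by positivity)
  have h4 := harmonic_le_one_add_log N
  rw [harmonic_eq_sum_Icc] at h4
  push_cast at h4
  have h5 : ∑ j ∈ Finset.Icc 1 N, 2*((N:ℝ)/j) = 2*N*∑ j ∈ Finset.Icc 1 N, ((j:ℝ))⁻¹ := by
    rw [Finset.mul_sum]; exact Finset.sum_congr rfl fun j _ => by ring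
  rw [h5] at h3
  nlinarith only [h3, mul_le_mul_of_nonneg_left h4 (by positivity : (0:ℝ) ≤ 2*N)]

theorem red_count {N : ℕ} {ρ Y : ℝ} (hρ : 0 ≤ ρ) (hY : Y ≤ ρ^3) (hN : (N:ℝ) ≤ ρ^2) {s : Finset BQF}
    (h : ∀ f ∈ s, f.a ≠ 0 ∧ ¬ f.Irred ∧ |(f.J:ℝ)| ≤ Y ∧ |f.a| ≤ N ∧ |f.b| ≤ N ∧ |f.c| ≤ N ∧ |f.d| ≤ N ∧ |f.e| ≤ N) :
    (s.card:ℝ) ≤ 3*(2*ρ+1)*((2*N+1)^3+2*((4*N*(1+Real.log N))^2*(2*N+1))) := by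
  classical
  let A1 : BQF → Prop := fun f => ∃ x : ℤ×ℤ×ℤ×ℤ×ℤ×ℤ, f.a = x.1*x.2.2.1 ∧ f.b = x.1*x.2.2.2.1+x.2.1*x.2.2.1 ∧
    f.c = x.1*x.2.2.2.2.1+x.2.1*x.2.2.2.1 ∧ f.d = x.1*x.2.2.2.2.2+x.2.1*x.2.2.2.2.1 ∧ f.e = x.2.1*x.2.2.2.2.2
  let A2 : BQF → Prop := fun f => ∃ x : ℤ×ℤ×ℤ×ℤ×ℤ×ℤ, f.a = x.1*x.2.2.2.1 ∧ f.b = x.1*x.2.2.2.2.1+x.2.1*x.2.2.2.1 ∧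
    f.c = x.1*x.2.2.2.2.2+x.2.1*x.2.2.2.2.1+x.2.2.1*x.2.2.2.1 ∧ f.d = x.2.1*x.2.2.2.2.2+x.2.2.1*x.2.2.2.2.1 ∧ f.e = x.2.2.1*x.2.2.2.2.2 ∧ |x.1| ≤ |x.2.2.2.1|
  have hsub : s ⊆ (s.filter fun f => f.e = 0) ∪ ((s.filter fun f => f.e ≠ 0 ∧ A1 f) ∪ (s.filter fun f => f.e ≠ 0 ∧ A2 f)) := by
    intro f hf
    simp only [Finset.mem_union, Finset.mem_filter, hf, true_and]
    by_cases he : f.e = 0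
    · exact Or.inl he
    refine Or.inr ?_
    rcases gauss (h f hf).1 (h f hf).2.1 with ⟨k, m, p, q, r, t, hh⟩ | ⟨k, m, l, p, q, r, h1, h2, h3, h4, h5⟩
    · exact Or.inl ⟨he, (k, m, p, q, r, t), hh⟩
    · rcases le_total |k| |p| with h6 | h6
      · exact Or.inr ⟨he, (k, m, l, p, q, r), h1, h2, h3, h4, h5, h6⟩
      · exact Or.inr ⟨he, (p, q, r, k, m, l), by linarith, by linarith, by linarith, by linarith, by linarith, h6⟩
  have c0 := (Finset.card_le_card hsub).trans ((Finset.card_union_le _ _).trans (Nat.add_le_add_left (Finset.card_union_le _ _) _))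
  have cD : ((DP N ×ˢ DP N ×ˢ ZN N).card:ℝ) ≤ (4*N*(1+Real.log N))^2*(2*N+1) := by
    rw [Finset.card_product, Finset.card_product]; push_cast
    rw [ZN_card, ← mul_assoc, pow_two]
    have := DP_card N
    gcongr
  have cZ : ((ZN N ×ˢ ZN N ×ˢ ZN N).card:ℝ) = (2*N+1)^3 := by
    rw [Finset.card_product, Finset.card_product]; push_cast
    rw [ZN_card]; ring
  have c1 : ((s.filter fun f => f.e = 0).card:ℝ) ≤ 3*(2*ρ+1)*((2*N+1)^3) := by
    rw [← cZ]
    refine fib (d := 3) (Φ := fun f => (f.a, f.b, f.d)) (ψ := fun f => f.c) (by norm_num) le_rfl hρ ?_ ?_ ?_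
    · intro f hf
      obtain ⟨-, -, -, h1, h2, h3, h4, h5⟩ := h f (Finset.mem_filter.1 hf).1
      simp only [Finset.mem_product, ZN_mem]; exact ⟨h1, h2, h4⟩
    · intro f hf g hg he hc
      have h1 := (Finset.mem_filter.1 hf).2; have h2 := (Finset.mem_filter.1 hg).2
      simp only [Prod.mk.injEq] at he
      cases f; cases g; simp_all
    · intro g hg
      refine ⟨C (-2)*X^3+C 0*X^2+C (9*g.b*g.d:ℝ)*X+C (-27*g.a*g.d^2:ℝ), natDegree_cubic (by norm_num), ?_, ?_⟩
      · rw [leadingCoeff_cubic (by norm_num)]; norm_num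
      · intro f hf he
        have h1 := (Finset.mem_filter.1 hf).2
        simp only [Prod.mk.injEq] at he
        refine le_trans (le_of_eq ?_) ((h f (Finset.mem_filter.1 hf).1).2.2.1.trans hY)
        rw [J, h1, ← he.1, ← he.2.1, ← he.2.2]; simp only [eval_add, eval_mul, eval_C, eval_X, eval_pow]; push_cast; congr 1; ring
  have c2 : ((s.filter fun f => f.e ≠ 0 ∧ A1 f).card:ℝ) ≤ 3*(2*ρ+1)*(DP N ×ˢ DP N ×ˢ ZN N).card := by
    have hx : ∀ f ∈ s.filter fun f => f.e ≠ 0 ∧ A1 f, A1 f := fun f hf => (Finset.mem_filter.1 hf).2.2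
    choose! x hx using hx
    refine fib (d := 3) (Φ := fun f => (((x f).1, (x f).2.2.1), ((x f).2.1, (x f).2.2.2.2.2), f.b)) (ψ := fun f => (x f).2.2.2.2.1) (by norm_num) le_rfl hρ ?_ ?_ ?_
    · intro f hf
      have hf' := Finset.mem_filter.1 hf
      obtain ⟨h0, -, -, h1, h2, h3, h4, h5⟩ := h f hf'.1
      obtain ⟨x1, x2, x3, x4, x5⟩ := hx f hf
      rw [x1] at h0 h1; rw [x5] at h5
      simp only [Finset.mem_product, ZN_mem]; exact ⟨DP_mem h0 h1, DP_mem (by rw [← x5]; exact hf'.2.1) h5, h2⟩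
    · intro f hf g hg he hc
      obtain ⟨x1, x2, x3, x4, x5⟩ := hx f hf
      obtain ⟨y1, y2, y3, y4, y5⟩ := hx g hg
      have h0 := (h f (Finset.mem_filter.1 hf).1).1
      rw [x1] at h0; have h0 := left_ne_zero_of_mul h0
      simp only [Prod.mk.injEq] at he
      obtain ⟨⟨e1, e2⟩, ⟨e3, e4⟩, e5⟩ := he
      change _ = _ at hc
      rw [← e1, ← e2, ← e3] at y2
      have hq : (x f).2.2.2.1 = (x g).2.2.2.1 := mul_left_cancel₀ h0 (by linarith)
      rw [← e1, ← hc, ← e3, ← hq] at y3; rw [← e1, ← hc, ← e3, ← e4] at y4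
      rw [← e1, ← e2] at y1; rw [← e3, ← e4] at y5
      exact ext5 (by rw [x1, y1]) e5 (by rw [x3, y3]) (by rw [x4, y4]) (by rw [x5, y5])
    · intro g hg
      obtain ⟨y1, y2, y3, y4, y5⟩ := hx g hg
      have h0 := (h g (Finset.mem_filter.1 hg).1).1
      rw [y1] at h0; have h0 := left_ne_zero_of_mul h0
      obtain ⟨⟨k, m, p, q, r, t⟩, hxg⟩ : ∃ y, y = x g := ⟨_, rfl⟩
      rw [← hxg] at y1 y2 y3 y4 y5 h0
      simp only at y1 y2 y3 y4 y5 h0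
      have hk : (1:ℝ) ≤ |(k:ℝ)| := by exact_mod_cast Int.one_le_abs h0
      have hk0 : (k:ℝ) ≠ 0 := by exact_mod_cast h0
      refine ⟨C (-2*k^3:ℝ)*X^3+C (9*g.b*k*m-27*g.a*m^2-6*k^2*(m*q):ℝ)*X^2+C (72*g.a*g.e*k+9*g.b*(k*(k*t)+m*(m*q))-54*g.a*m*(k*t)-6*k*(m*q)^2:ℝ)*X+
        C (72*g.a*g.e*(m*q)+9*g.b*(m*q)*(k*t)-27*g.a*(k*t)^2-27*g.e*g.b^2-2*(m*q)^3:ℝ), natDegree_cubic (by simpa using hk0), ?_, ?_⟩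
      · rw [leadingCoeff_cubic (by simpa using hk0), abs_mul, abs_pow]
        have := one_le_pow₀ hk (n := 3)
        norm_num; linarith
      · intro f hf he
        obtain ⟨x1, x2, x3, x4, x5⟩ := hx f hf
        simp only [Prod.mk.injEq, ← hxg] at he
        obtain ⟨⟨e1, e2⟩, ⟨e3, e4⟩, e5⟩ := he
        rw [e1, e2, e3, e5] at x2
        have hq : (x f).2.2.2.1 = q := mul_left_cancel₀ h0 (by linarith)
        refine le_trans (le_of_eq ?_) ((h f (Finset.mem_filter.1 hf).1).2.2.1.trans hY)
        rw [e1, e2] at x1; rw [e1, e3, hq] at x3; rw [e1, e3, e4] at x4; rw [e3, e4] at x5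
        rw [J, x1.trans y1.symm, e5, x3, x4, x5.trans y5.symm]; simp only [eval_add, eval_mul, eval_C, eval_X, eval_pow]; push_cast; congr 1; ring
  have c3 : ((s.filter fun f => f.e ≠ 0 ∧ A2 f).card:ℝ) ≤ 3*(2*ρ+1)*(DP N ×ˢ DP N ×ˢ ZN N).card := by
    have hx : ∀ f ∈ s.filter fun f => f.e ≠ 0 ∧ A2 f, A2 f := fun f hf => (Finset.mem_filter.1 hf).2.2
    choose! x hx using hx
    refine fib (d := 2) (Φ := fun f => (((x f).1, (x f).2.2.2.1), ((x f).2.2.1, (x f).2.2.2.2.2), f.b)) (ψ := fun f => (x f).2.1) (by norm_num) (by norm_num) hρ ?_ ?_ ?_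
    · intro f hf
      have hf' := Finset.mem_filter.1 hf
      obtain ⟨h0, -, -, h1, h2, h3, h4, h5⟩ := h f hf'.1
      obtain ⟨x1, x2, x3, x4, x5, x6⟩ := hx f hf
      rw [x1] at h0 h1; rw [x5] at h5
      simp only [Finset.mem_product, ZN_mem]; exact ⟨DP_mem h0 h1, DP_mem (by rw [← x5]; exact hf'.2.1) h5, h2⟩
    · intro f hf g hg he hc
      obtain ⟨x1, x2, x3, x4, x5, x6⟩ := hx f hf
      obtain ⟨y1, y2, y3, y4, y5, y6⟩ := hx g hg
      have h0 := (h f (Finset.mem_filter.1 hf).1).1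
      rw [x1] at h0; have h0 := left_ne_zero_of_mul h0
      simp only [Prod.mk.injEq] at he
      obtain ⟨⟨e1, e2⟩, ⟨e3, e4⟩, e5⟩ := he
      change _ = _ at hc
      rw [← e1, ← e2, ← hc] at y2
      have hq : (x f).2.2.2.2.1 = (x g).2.2.2.2.1 := mul_left_cancel₀ h0 (by linarith)
      rw [← e1, ← e2, ← e3, ← e4, ← hc, ← hq] at y3; rw [← hc, ← e3, ← e4, ← hq] at y4
      rw [← e1, ← e2] at y1; rw [← e3, ← e4] at y5
      exact ext5 (by rw [x1, y1]) e5 (by rw [x3, y3]) (by rw [x4, y4]) (by rw [x5, y5])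
    · intro g hg
      obtain ⟨y1, y2, y3, y4, y5, y6⟩ := hx g hg
      have h0 := (h g (Finset.mem_filter.1 hg).1).1
      rw [y1] at h0; have h0 := left_ne_zero_of_mul h0
      obtain ⟨⟨k, m, l, p, q, r⟩, hxg⟩ : ∃ y, y = x g := ⟨_, rfl⟩
      rw [← hxg] at y1 y2 y3 y4 y5 y6 h0
      simp only at y1 y2 y3 y4 y5 y6 h0
      have hk0 : (k:ℝ) ≠ 0 := by exact_mod_cast h0
      have hkp : 1 ≤ |(-p/k:ℝ)| := by
        rw [abs_div, abs_neg, one_le_div (abs_pos.2 hk0)]; exact_mod_cast y6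
      have hl : (-p/k:ℝ) ≠ 0 := by intro h; rw [h] at hkp; norm_num at hkp
      refine ⟨C (-p/k:ℝ)*X^2+C (g.b/k:ℝ)*X+C (k*r+l*p:ℝ), natDegree_quadratic hl, by rwa [leadingCoeff_quadratic hl], ?_⟩
      intro f hf he
      obtain ⟨x1, x2, x3, x4, x5, x6⟩ := hx f hf
      simp only [Prod.mk.injEq, ← hxg] at he
      obtain ⟨⟨e1, e2⟩, ⟨e3, e4⟩, e5⟩ := he
      rw [e1, e2, e5] at x2
      rw [e1, e2, e3, e4] at x3
      have hc : |(f.c:ℝ)| ≤ N := by exact_mod_cast (h f (Finset.mem_filter.1 hf).1).2.2.2.2.2.1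
      refine le_trans (le_of_eq ?_) (hc.trans hN)
      rw [x3, x2]; simp only [eval_add, eval_mul, eval_C, eval_X, eval_pow]; push_cast; congr 1; field_simp; ring
  have c0' := (Nat.cast_le (α := ℝ)).2 c0
  push_cast at c0'
  have p : 0 ≤ 3*(2*ρ+1) := by positivity
  nlinarith only [c0', c1, c2, c3, mul_le_mul_of_nonneg_left cD p]
end BQF
end

section
open Filter
namespace BQF
theorem red_small (C : ℝ) {θ ε : ℝ} (hθ : 0 < θ) (hε : 0 < ε) : ∀ᶠ n : ℕ in atTop, ∀ s : Finset BQF,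
    (∀ f ∈ s, f.a ≠ 0 ∧ ¬ f.Irred ∧ |(f.J:ℝ)| < n^2 ∧ |(f.a:ℝ)| ≤ C*n ∧ |(f.b:ℝ)| ≤ C*n ∧ |(f.c:ℝ)| ≤ C*n ∧ |(f.d:ℝ)| ≤ C*n ∧
      θ*n^2 ≤ |(f.Hz:ℝ)|) → (s.card:ℝ) ≤ ε*n^4 := by
  obtain ⟨D, hD⟩ : ∃ D, D = max C 1 := ⟨_, rfl⟩
  have hCD : C ≤ D := hD ▸ le_max_left _ _
  have hD1 : 1 ≤ D := hD ▸ le_max_right _ _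
  obtain ⟨K, hK⟩ := exists_nat_ge (max D (5*D^3/θ))
  have hK1 := (le_max_left _ _).trans hK
  have hK2 := (le_max_right _ _).trans hK
  rw [div_le_iff₀ hθ] at hK2
  have hK0 : (1:ℝ) ≤ K := hD1.trans hK1
  obtain ⟨δ, hδ⟩ : ∃ δ, δ = ε/(1107*K^3) := ⟨_, rfl⟩
  have hδ0 : 0 < δ := by rw [hδ]; positivity
  have hδe : 1107*K^3*δ = ε := by rw [hδ]; field_simp
  obtain ⟨κ, hκ⟩ : ∃ κ, κ = min δ (min (δ^3) (δ^2/K)) := ⟨_, rfl⟩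
  have hκ0 : 0 < κ := by rw [hκ]; positivity
  have k1 : κ ≤ δ := hκ ▸ min_le_left _ _
  have k2 : κ ≤ δ^3 := hκ ▸ (min_le_right _ _).trans (min_le_left _ _)
  have k3 : κ ≤ δ^2/K := hκ ▸ (min_le_right _ _).trans (min_le_right _ _)
  rw [le_div_iff₀ (by positivity)] at k3
  have hE := Real.exp_pos 1
  have ht : Tendsto (fun n : ℕ => Real.exp 1*K*(n:ℝ)) atTop atTop := tendsto_natCast_atTop_atTop.const_mul_atTop (by positivity)
  have hlog := ht.eventually ((Real.isLittleO_pow_log_id_atTop (n := 6)).def (c := κ/(Real.exp 1*K)) (by positivity))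
  filter_upwards [hlog, eventually_ge_atTop 1] with n hl hn s hs
  have hn1 : (1:ℝ) ≤ n := by exact_mod_cast hn
  obtain ⟨L, hL⟩ : ∃ L, L = 1+Real.log ((K*n:ℕ):ℝ) := ⟨_, rfl⟩
  have hKn : (1:ℝ) ≤ K*n := by nlinarith only [hK0, hn1]
  have hL1 : 1 ≤ L := by rw [hL]; push_cast; linarith [Real.log_nonneg hKn]
  have hLe : Real.log (Real.exp 1*K*n) = L := by
    rw [hL, mul_assoc, Real.log_mul hE.ne' (by positivity), Real.log_exp]; push_cast; rfl
  have h6 : L^6 ≤ κ*n := by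
    rw [hLe, Real.norm_eq_abs, abs_of_nonneg (by positivity), id, Real.norm_eq_abs, abs_of_nonneg (by positivity)] at hl
    refine hl.trans (le_of_eq ?_); field_simp
  have h4 : L^4 ≤ κ*n := (pow_le_pow_right₀ hL1 (by norm_num)).trans h6
  have h2 : L^2 ≤ κ*n := (pow_le_pow_right₀ hL1 (by norm_num)).trans h6
  obtain ⟨ρ, hρ⟩ : ∃ ρ, ρ = δ*n/L^2 := ⟨_, rfl⟩
  have hρ1 : 1 ≤ ρ := by rw [hρ, one_le_div (by positivity)]; nlinarith only [h2, k1, hn1]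
  have hρL : ρ*L^2 = δ*n := by rw [hρ]; field_simp
  have hb := red_count (N := K*n) (ρ := ρ) (Y := n^2) (s := s) (by linarith) ?_ ?_ ?_
  · rw [← hL] at hb
    push_cast at hb
    refine hb.trans ?_
    obtain ⟨M, hM⟩ : ∃ M : ℝ, M = K*n := ⟨_, rfl⟩
    rw [← hM] at hb hKn ⊢
    have e1 : (2*M+1)^3+2*((4*M*L)^2*(2*M+1)) ≤ 123*M^3*L^2 := by
      have a1 : 2*M+1 ≤ 3*M := by linarith
      have a2 : (2*M+1)^3 ≤ (3*M)^3 := pow_le_pow_left₀ (by linarith) a1 3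
      nlinarith only [a2, mul_le_mul_of_nonneg_left a1 (by positivity : 0 ≤ (4*M*L)^2), mul_le_mul_of_nonneg_left (one_le_pow₀ hL1 (n := 2)) (by positivity : 0 ≤ M^3)]
    calc _ ≤ (9*ρ)*(123*M^3*L^2) := mul_le_mul (by linarith) e1 (by positivity) (by positivity)
      _ = 1107*M^3*(ρ*L^2) := by ring
      _ = _ := by rw [hρL, hM, ← hδe]; ring
  · rw [hρ, div_pow, le_div_iff₀ (by positivity), ← pow_mul]
    calc (n:ℝ)^2*L^6 ≤ n^2*(δ^3*n) := mul_le_mul_of_nonneg_left (h6.trans (mul_le_mul_of_nonneg_right k2 (by positivity))) (by positivity)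
      _ = _ := by ring
  · rw [hρ, div_pow, le_div_iff₀ (by positivity), ← pow_mul]; push_cast
    nlinarith only [mul_le_mul_of_nonneg_left h4 (by positivity : (0:ℝ) ≤ K*n), mul_le_mul_of_nonneg_left k3 (by positivity : (0:ℝ) ≤ n^2)]
  · intro f hf
    obtain ⟨h0, h1, hJ, ha, hb, hc, hd, hh⟩ := hs f hf
    have up : ∀ x : ℤ, |(x:ℝ)| ≤ C*n → |(x:ℝ)| ≤ D*n := fun x hx => hx.trans (by gcongr)
    have cv : ∀ x : ℤ, |(x:ℝ)| ≤ K*n → |x| ≤ ((K*n:ℕ):ℤ) := fun x hx => by exact_mod_cast hx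
    have up2 : ∀ x : ℤ, |(x:ℝ)| ≤ C*n → |x| ≤ ((K*n:ℕ):ℤ) := fun x hx => cv x ((up x hx).trans (by gcongr))
    refine ⟨h0, h1, hJ.le, up2 _ ha, up2 _ hb, up2 _ hc, up2 _ hd, cv _ ?_⟩
    obtain ⟨R, hR⟩ : ∃ R, R = D*n := ⟨_, rfl⟩
    have ha := up _ ha; have hb := up _ hb; have hc := up _ hc; have hd := up _ hd
    rw [← hR] at ha hb hc hd
    have hR0 : 0 ≤ R := (abs_nonneg _).trans ha
    have e : 9*(f.Hz:ℝ)*f.e = f.J-9*(f.b*f.c*f.d)+27*(f.a*(f.d*f.d))+2*(f.c*(f.c*f.c)) := by rw [Hz, J]; push_cast; ring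
    have m3 : ∀ x y z : ℝ, |x| ≤ R → |y| ≤ R → |z| ≤ R → |x*(y*z)| ≤ R^3 := by
      intro x y z hx hy hz
      rw [abs_mul, abs_mul, pow_succ', pow_two]; gcongr
    have b1 := abs_le.1 (m3 _ _ _ hb hc hd); have b2 := abs_le.1 (m3 _ _ _ ha hd hd); have b3 := abs_le.1 (m3 _ _ _ hc hc hc)
    have hJ' := abs_lt.1 hJ
    have e2 : |9*(f.Hz:ℝ)*f.e| ≤ n^2+38*R^3 := by rw [e, abs_le]; constructor <;> linarith
    have e3 : (n:ℝ)^2 ≤ R^3 := by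
      rw [hR, mul_pow]; nlinarith only [one_le_pow₀ hD1 (n := 3), hn1, mul_le_mul_of_nonneg_left hn1 (by positivity : (0:ℝ) ≤ n^2), mul_le_mul_of_nonneg_right (one_le_pow₀ hD1 (n := 3)) (by positivity : (0:ℝ) ≤ n^3)]
    rw [abs_mul, abs_mul, abs_of_nonneg (by norm_num : (0:ℝ) ≤ 9)] at e2
    have e4 : θ*n^2*|(f.e:ℝ)| ≤ 5*R^3 := by
      nlinarith only [e2, e3, mul_le_mul_of_nonneg_right hh (abs_nonneg (f.e:ℝ)), pow_nonneg hR0 3]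
    rw [hR] at e4
    refine le_of_mul_le_mul_left (e4.trans ?_) (by positivity : 0 < θ*(n:ℝ)^2)
    nlinarith only [mul_le_mul_of_nonneg_right hK2 (by positivity : (0:ℝ) ≤ n^3)]
end BQF
end

section
open Filter
namespace BQF
theorem low_one {i : ℕ} {u v w T ε : ℝ} (hTI : TI i u v w T) (hε : 0 < ε) : ∀ᶠ n : ℕ in atTop, ∃ s : Finset BQF,
    (T*Real.pi/81-ε)*n^4 ≤ s.card ∧ ∀ f ∈ s, GLo u v w f ∧ f.a ≠ 0 ∧ f ∈ AA i (n^2) := by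
  classical
  have hT : 0 < T*Real.pi/81 := by
    have := Real.pi_pos
    rcases hTI with h | h | h | h <;> rw [h.2.2.2.2] <;> positivity
  obtain ⟨C, θ, hθ, hev⟩ := low_fam hTI (le_max_left 0 (T*Real.pi/81-ε/2)) (max_lt hT (by linarith))
  filter_upwards [hev, red_small C hθ (half_pos hε)] with n ⟨s, hs, hp⟩ hr
  refine ⟨s.filter Irred, ?_, fun f hf => ?_⟩
  · have h1 := hr (s.filter fun f => ¬ f.Irred) (fun f hf => by
      rw [Finset.mem_filter] at hf
      obtain ⟨-, h1, -, h2⟩ := hp f hf.1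
      exact ⟨h1, hf.2, h2⟩)
    have h2 : ((s.filter Irred).card:ℝ) + (s.filter fun f => ¬ f.Irred).card = s.card := by
      exact_mod_cast Finset.card_filter_add_card_filter_not _
    have h3 := mul_le_mul_of_nonneg_right (le_max_right 0 (T*Real.pi/81-ε/2)) (by positivity : (0:ℝ) ≤ n^4)
    nlinarith only [h1, h2, h3, hs]
  · rw [Finset.mem_filter] at hf
    obtain ⟨h0, h1, h2, h3, -⟩ := hp f hf.1
    exact ⟨h0, h1, hf.2, low_roots hTI h0 h1, h2, h3⟩

theorem lower {i : ℕ} {ε : ℝ} (hi : i ≤ 2) (hε : 0 < ε) :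
    ∀ᶠ n : ℕ in atTop, (cls '' AA i (n^2)).Finite → (VV i-ε)*n^4 ≤ ((cls '' AA i (n^2)).ncard : ℝ) := by
  classical
  have one : ∀ {n : ℕ} {s : Finset BQF}, (cls '' AA i (n^2)).Finite → (∀ f ∈ s, f ∈ AA i (n^2)) → (∀ f ∈ s, ∀ g ∈ s, Equivalent f g → f = g) →
      (s.card:ℝ) ≤ ((cls '' AA i (n^2)).ncard : ℝ) := by
    intro n s hfin h1 h2
    rw [← Set.ncard_coe_finset, ← Set.InjOn.ncard_image (f := cls) fun f hf g hg h => h2 f hf g hg (cls_eq.1 h)]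
    exact_mod_cast Set.ncard_le_ncard (Set.image_mono fun f hf => h1 f hf) hfin
  obtain rfl | rfl | rfl : i = 0 ∨ i = 1 ∨ i = 2 := by omega
  · have hT : TI 0 _ _ _ _ := Or.inl ⟨rfl, rfl, rfl, rfl, rfl⟩
    filter_upwards [low_one hT hε] with n ⟨s, hs, hp⟩ hfin
    refine le_trans ?_ (hs.trans (one hfin (fun f hf => (hp f hf).2.2) fun f hf g hg => dist_same hT (hp f hf).1 (hp g hg).1))
    rw [VV, if_pos rfl]; apply le_of_eq; ring
  · have hT : TI 1 _ _ _ _ := Or.inr (Or.inl ⟨rfl, rfl, rfl, rfl, rfl⟩)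
    filter_upwards [low_one hT hε] with n ⟨s, hs, hp⟩ hfin
    refine le_trans ?_ (hs.trans (one hfin (fun f hf => (hp f hf).2.2) fun f hf g hg => dist_same hT (hp f hf).1 (hp g hg).1))
    rw [VV, if_neg one_ne_zero]; apply le_of_eq; ring
  · have hT : TI 2 1 0 1 (Real.pi/2) := Or.inr (Or.inr (Or.inl ⟨rfl, rfl, rfl, rfl, rfl⟩))
    have hT' : TI 2 (-1) 0 (-1) (Real.pi/2) := Or.inr (Or.inr (Or.inr ⟨rfl, rfl, rfl, rfl, rfl⟩))
    filter_upwards [low_one hT (half_pos hε), low_one hT' (half_pos hε)] with n ⟨s, hs, hp⟩ ⟨s', hs', hp'⟩ hfin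
    have hne : ∀ f ∈ s, ∀ g ∈ s', ¬ Equivalent f g := fun f hf g hg =>
      dist_pm (u := 1) (by norm_num) rfl rfl rfl (hp f hf).1 (hp' g hg).1 (hp' g hg).2.1
    have hd : Disjoint s s' := Finset.disjoint_left.2 fun f hf hf' => hne f hf f hf' (Equivalent.refl f)
    refine le_trans ?_ (one (s := s ∪ s') hfin (fun f hf => ?_) fun f hf g hg he => ?_)
    · rw [Finset.card_union_of_disjoint hd, VV, if_neg two_ne_zero]; push_cast; linarith
    · rcases Finset.mem_union.1 hf with h | h
      · exact (hp f h).2.2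
      · exact (hp' f h).2.2
    · rcases Finset.mem_union.1 hf with h | h <;> rcases Finset.mem_union.1 hg with h' | h'
      · exact dist_same hT (hp f h).1 (hp g h').1 he
      · exact (hne f h g h' he).elim
      · exact (hne g h' f h he.symm).elim
      · exact dist_same hT' (hp' f h).1 (hp' g h').1 he
end BQF
end

section
open Filter
namespace BQF
def El (I J : ℤ) : Prop := (3 ∣ I ∧ 27 ∣ J) ∨ (3 ∣ I-1 ∧ (27 ∣ J-1+3*I ∨ 27 ∣ J+1-3*I))
instance (I J : ℤ) : Decidable (El I J) := by unfold El; infer_instance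

theorem elig_iff {I₀ J₀ : ℤ} : Eligible I₀ J₀ ↔ El I₀ J₀ := by
  constructor
  · rintro ⟨⟨a, b, c, d, e⟩, rfl, rfl⟩
    simp only [I, J, El]
    obtain ⟨t, ht⟩ : ∃ t, c = 3*t ∨ c = 3*t+1 ∨ c = 3*t-1 := ⟨(c+1)/3, by omega⟩
    rcases ht with rfl | rfl | rfl
    · exact Or.inl ⟨⟨4*a*e-b*d+3*t^2, by ring⟩, ⟨8*a*t*e+b*t*d-a*d^2-e*b^2-2*t^3, by ring⟩⟩
    · exact Or.inr ⟨⟨4*a*e-b*d+3*t^2+2*t, by ring⟩, Or.inl ⟨8*a*t*e+4*a*e+b*t*d-a*d^2-e*b^2-2*t^3-t^2, by ring⟩⟩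
    · exact Or.inr ⟨⟨4*a*e-b*d+3*t^2-2*t, by ring⟩, Or.inr ⟨8*a*t*e-4*a*e+b*t*d-a*d^2-e*b^2-2*t^3+t^2, by ring⟩⟩
  · rintro (⟨⟨x, hx⟩, ⟨y, hy⟩⟩ | ⟨⟨x, hx⟩, ⟨y, hy⟩ | ⟨y, hy⟩⟩)
    · exact ⟨⟨0, 1, 0, -x, -y⟩, by simp only [I]; linarith, by simp only [J]; linarith⟩
    · exact ⟨⟨0, 1, 1, -x, -y⟩, by simp only [I]; linarith, by simp only [J]; linarith⟩
    · exact ⟨⟨0, 1, -1, -x, -y⟩, by simp only [I]; linarith, by simp only [J]; linarith⟩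

def RR : Finset (ℤ×ℤ) := ((Finset.range 27 ×ˢ Finset.range 27).map ⟨fun x => ((x.1:ℤ), (x.2:ℤ)), fun x y h => by
  simpa [Prod.ext_iff] using h⟩).filter fun p => El p.1 p.2
theorem RR_card : RR.card = 27 := by decide +kernel
theorem El_mod {I J : ℤ} (h : El I J) : (I%27, J%27) ∈ RR := by
  rw [RR, Finset.mem_filter, Finset.mem_map]
  refine ⟨⟨((I%27).toNat, (J%27).toNat), ?_, ?_⟩, ?_⟩
  · simp only [Finset.mem_product, Finset.mem_range]; omega
  · exact Prod.ext (by change ((I%27).toNat:ℤ) = I%27; omega) (by change ((J%27).toNat:ℤ) = J%27; omega)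
  · simp only [El] at h ⊢; omega
theorem El_of {r : ℤ×ℤ} (hr : r ∈ RR) {I J : ℤ} (h1 : I%27 = r.1) (h2 : J%27 = r.2) : El I J := by
  have := (Finset.mem_filter.1 hr).2
  simp only [El, ← h1, ← h2] at this ⊢; omega
theorem RR_lt {r : ℤ×ℤ} (hr : r ∈ RR) : 0 ≤ r.1 ∧ r.1 < 27 ∧ 0 ≤ r.2 ∧ r.2 < 27 := by
  obtain ⟨x, hx, rfl⟩ := Finset.mem_map.1 (Finset.mem_filter.1 hr).1
  simp only [Finset.mem_product, Finset.mem_range] at hx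
  change 0 ≤ (x.1:ℤ) ∧ (x.1:ℤ) < 27 ∧ 0 ≤ (x.2:ℤ) ∧ (x.2:ℤ) < 27; omega

attribute [irreducible] RR
theorem cnt1 (a b : ℤ) (hab : a ≤ b) {u : ℤ} (h0 : 0 ≤ u) (h1 : u < 27) :
    b-a-27 ≤ 27*((Finset.Ico a b).filter fun x => x%27 = u).card ∧
    (27*((Finset.Ico a b).filter fun x => x%27 = u).card:ℤ) ≤ b-a+27 := by
  have e := Int.Ico_filter_modEq_card a b (r := 27) (by norm_num) u
  have e1 : ((Finset.Ico a b).filter fun x => x%27 = u) = (Finset.Ico a b).filter fun x => x ≡ u [ZMOD 27] := by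
    apply Finset.filter_congr; intro x _; unfold Int.ModEq; omega
  rw [e1, e]
  push_cast
  have a1 := Int.le_ceil ((b-u:ℚ)/27); have a2 := Int.ceil_lt_add_one ((b-u:ℚ)/27)
  have a3 := Int.le_ceil ((a-u:ℚ)/27); have a4 := Int.ceil_lt_add_one ((a-u:ℚ)/27)
  have b1 : (b:ℚ)-a-27 ≤ 27*(⌈(b-u:ℚ)/27⌉-⌈(a-u:ℚ)/27⌉) := by linarith
  have b2 : 27*((⌈(b-u:ℚ)/27⌉:ℚ)-⌈(a-u:ℚ)/27⌉) ≤ b-a+27 := by linarith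
  have b1' : b-a-27 ≤ 27*(⌈(b-u:ℚ)/27⌉-⌈(a-u:ℚ)/27⌉) := by exact_mod_cast b1
  have b2' : 27*(⌈(b-u:ℚ)/27⌉-⌈(a-u:ℚ)/27⌉) ≤ b-a+27 := by exact_mod_cast b2
  omega

theorem cnt2 {a b c d : ℤ} (hab : a+27 ≤ b) (hcd : c+27 ≤ d) :
    (b-a-27)*(d-c-27) ≤ 27*((Finset.Ico a b ×ˢ Finset.Ico c d).filter fun p => El p.1 p.2).card ∧
    (27*((Finset.Ico a b ×ˢ Finset.Ico c d).filter fun p => El p.1 p.2).card:ℤ) ≤ (b-a+27)*(d-c+27) := by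
  have hs : ((Finset.Ico a b ×ˢ Finset.Ico c d).filter fun p => El p.1 p.2).card =
      ∑ r ∈ RR, ((Finset.Ico a b).filter fun x => x%27 = r.1).card*((Finset.Ico c d).filter fun x => x%27 = r.2).card := by
    rw [Finset.card_eq_sum_card_fiberwise (t := RR) (f := fun p : ℤ×ℤ => (p.1%27, p.2%27)) fun p hp => El_mod (Finset.mem_filter.1 hp).2]
    refine Finset.sum_congr rfl fun r hr => ?_
    rw [← Finset.card_product]
    congr 1; ext ⟨x, y⟩
    simp only [Finset.mem_filter, Finset.mem_product, Prod.ext_iff]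
    exact ⟨fun h => ⟨⟨h.1.1.1, h.2.1⟩, h.1.1.2, h.2.2⟩, fun h => ⟨⟨⟨h.1.1, h.2.1⟩, El_of hr h.1.2 h.2.2⟩, h.1.2, h.2.2⟩⟩
  rw [hs]
  push_cast
  have hk : ∀ r ∈ RR, (b-a-27)*(d-c-27) ≤ 729*((((Finset.Ico a b).filter fun x => x%27 = r.1).card:ℤ)*((Finset.Ico c d).filter fun x => x%27 = r.2).card) ∧
      729*((((Finset.Ico a b).filter fun x => x%27 = r.1).card:ℤ)*((Finset.Ico c d).filter fun x => x%27 = r.2).card) ≤ (b-a+27)*(d-c+27) := by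
    intro r hr
    obtain ⟨r1, r2, r3, r4⟩ := RR_lt hr
    obtain ⟨x1, x2⟩ := cnt1 a b (by omega) r1 r2
    obtain ⟨y1, y2⟩ := cnt1 c d (by omega) r3 r4
    generalize ((Finset.Ico a b).filter fun x => x%27 = r.1).card = P at x1 x2 ⊢
    generalize ((Finset.Ico c d).filter fun x => x%27 = r.2).card = Q at y1 y2 ⊢
    have z1 := mul_le_mul x1 y1 (by linarith) (by positivity)
    have z2 := mul_le_mul x2 y2 (by positivity) (by linarith)
    constructor <;> linarith only [z1, z2]
  have s1 := Finset.sum_le_sum fun r hr => (hk r hr).1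
  have s2 := Finset.sum_le_sum fun r hr => (hk r hr).2
  rw [Finset.sum_const, RR_card, ← Finset.mul_sum] at s1 s2
  simp only [nsmul_eq_mul, Nat.cast_ofNat] at s1 s2
  constructor <;> linarith
end BQF
end

section
open Filter
namespace BQF
def DS (i : ℕ) (X : ℝ) : Set (ℤ×ℤ) := {p | Eligible p.1 p.2 ∧ 0 < (-1 : ℝ) ^ i * ((4 * (p.1 : ℝ) ^ 3 - (p.2 : ℝ) ^ 2) / 27) ∧
  ((max |p.1| |p.2| : ℤ) : ℝ) < X}

theorem DS_fin (i : ℕ) (X : ℝ) : (DS i X).Finite := by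
  refine ((Finset.Icc (-⌈X⌉) ⌈X⌉ ×ˢ Finset.Icc (-⌈X⌉) ⌈X⌉).finite_toSet).subset fun p hp => ?_
  have h := (max_lt_iff' p X).1 hp.2.2
  have k : ∀ z : ℤ, |(z:ℝ)| < X → -⌈X⌉ ≤ z ∧ z ≤ ⌈X⌉ := fun z hz => abs_le.1 (by exact_mod_cast (hz.trans_le (Int.le_ceil X)).le)
  simp only [Finset.coe_product, Finset.coe_Icc, Set.mem_prod, Set.mem_Icc]
  exact ⟨k _ h.1, k _ h.2⟩

theorem DS_mem {i m : ℕ} {p : ℤ×ℤ} : p ∈ DS i m ↔ El p.1 p.2 ∧ 0 < (-1:ℤ)^i*(4*p.1^3-p.2^2) ∧ |p.1| < m ∧ |p.2| < m := by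
  rw [← elig_iff, DS]
  change _ ∧ _ ∧ _ ↔ _
  rw [max_lt_iff']
  refine and_congr Iff.rfl (and_congr ?_ (by exact_mod_cast Iff.rfl))
  rw [← mul_div_assoc, div_pos_iff_of_pos_right (by norm_num)]; exact_mod_cast Iff.rfl

theorem DS_box {i m k : ℕ} (hi : i ≤ 2) (hk : m^2 ≤ 4*k^3) (hkm : k+28 ≤ m) :
    ((m:ℤ)-k-28)*(2*m-28) ≤ 27*(DS i m).ncard ∧ (27*(DS i m).ncard:ℤ) ≤ (m+k+27)*(2*m+27) := by
  have hk' : (m:ℤ)^2 ≤ 4*k^3 := by exact_mod_cast hk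
  have hbig : ∀ I J : ℤ, (k:ℤ) ≤ I → |J| < m → 0 < 4*I^3-J^2 := fun I J h1 h2 => by
    have := pow_le_pow_left₀ (by positivity) h1 3
    nlinarith only [this, hk', sq_abs J, abs_nonneg J, h2]
  have up : ∀ {a b : ℤ}, a+27 ≤ b → b-a ≤ m+k → (∀ p ∈ DS i m, a ≤ p.1 ∧ p.1 < b) → (27*(DS i m).ncard:ℤ) ≤ (m+k+27)*(2*m+27) := by
    intro a b hab hba h
    have h1 := Set.ncard_le_ncard (s := DS i m) (t := ((Finset.Ico a b ×ˢ Finset.Ico (-(m:ℤ)) m).filter fun p => El p.1 p.2 : Finset (ℤ×ℤ)))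
      (fun p hp => by
        have hp' := DS_mem.1 hp
        have := abs_lt.1 hp'.2.2.2
        simp only [Finset.coe_filter, Finset.mem_product, Finset.mem_Ico, Set.mem_ofPred_eq]
        exact ⟨⟨h p hp, this.1.le, this.2⟩, hp'.1⟩) (Finset.finite_toSet _)
    rw [Set.ncard_coe_finset] at h1
    have h2 := (cnt2 (c := -(m:ℤ)) (d := m) hab (by omega)).2
    nlinarith only [h1, h2, mul_le_mul_of_nonneg_right hba (by positivity : (0:ℤ) ≤ 2*m+27), (Nat.cast_le (α := ℤ)).2 h1]
  have lo : ∀ {a b : ℤ}, a+27 ≤ b → (m:ℤ)-k-1 ≤ b-a → 1-(m:ℤ) ≤ a → b ≤ m → (∀ I J : ℤ, a ≤ I → I < b → |J| < m → 0 < (-1:ℤ)^i*(4*I^3-J^2)) →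
      ((m:ℤ)-k-28)*(2*m-28) ≤ 27*(DS i m).ncard := by
    intro a b hab hba ha hb h
    have h1 := Set.ncard_le_ncard (t := DS i m) (s := ((Finset.Ico a b ×ˢ Finset.Ico (1-(m:ℤ)) m).filter fun p => El p.1 p.2 : Finset (ℤ×ℤ)))
      (fun p hp => by
        simp only [Finset.coe_filter, Finset.mem_product, Finset.mem_Ico, Set.mem_ofPred_eq] at hp
        have hJ : |p.2| < m := abs_lt.2 (by omega)
        exact DS_mem.2 ⟨hp.2, h _ _ hp.1.1.1 hp.1.1.2 hJ, abs_lt.2 (by omega), hJ⟩) (DS_fin _ _)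
    rw [Set.ncard_coe_finset] at h1
    have h2 := (cnt2 (c := 1-(m:ℤ)) (d := m) hab (by omega)).1
    nlinarith only [h2, mul_le_mul_of_nonneg_right hba (by omega : (0:ℤ) ≤ 2*m-28), (Nat.cast_le (α := ℤ)).2 h1]
  have hev : (-1:ℤ)^i = 1 → ((m:ℤ)-k-28)*(2*m-28) ≤ 27*(DS i m).ncard ∧ (27*(DS i m).ncard:ℤ) ≤ (m+k+27)*(2*m+27) := by
    intro e
    refine ⟨lo (a := k) (b := m) (by omega) (by omega) (by omega) le_rfl fun I J h1 h2 h3 => by rw [e, one_mul]; exact hbig I J h1 h3,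
      up (a := 0) (b := m) (by omega) (by omega) fun p hp => ?_⟩
    obtain ⟨-, h1, h2, -⟩ := DS_mem.1 hp
    rw [e, one_mul] at h1
    refine ⟨?_, (abs_lt.1 h2).2⟩
    by_contra! h
    nlinarith only [h1, sq_nonneg p.2, mul_pos_of_neg_of_neg h h, mul_pos (mul_pos_of_neg_of_neg h h) (neg_pos.2 h)]
  obtain rfl | rfl | rfl : i = 0 ∨ i = 1 ∨ i = 2 := by omega
  · exact hev (by norm_num)
  · refine ⟨lo (a := 1-m) (b := 0) (by omega) (by omega) le_rfl (by omega) fun I J h1 h h3 => ?_,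
      up (a := -m) (b := k) (by omega) (by omega) fun p hp => ?_⟩
    · nlinarith only [sq_nonneg J, mul_pos_of_neg_of_neg h h, mul_pos (mul_pos_of_neg_of_neg h h) (neg_pos.2 h)]
    · obtain ⟨-, h1, h2, h3⟩ := DS_mem.1 hp
      refine ⟨(abs_lt.1 h2).1.le, ?_⟩
      by_contra! h
      have := hbig _ _ h h3
      linarith
  · exact hev (by norm_num)

theorem DS_lim {i : ℕ} (hi : i ≤ 2) {ε : ℝ} (hε : 0 < ε) (hε' : ε ≤ 1/2) :
    ∀ᶠ m : ℕ in atTop, (2/27-ε)*m^2 ≤ (DS i m).ncard ∧ ((DS i m).ncard:ℝ) ≤ (2/27+ε)*m^2 := by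
  filter_upwards [tendsto_natCast_atTop_atTop.eventually_ge_atTop (2000/ε), tendsto_natCast_atTop_atTop.eventually_ge_atTop (1/ε^3)] with m h1 h2
  rw [div_le_iff₀ (by positivity)] at h1 h2
  have hm : 2000 ≤ (m:ℝ) := by nlinarith only [h1, hε', (Nat.cast_nonneg m : (0:ℝ) ≤ m)]
  have k1 := Nat.le_ceil (ε*m)
  have k2 := (Nat.ceil_lt_add_one (by positivity : 0 ≤ ε*(m:ℝ))).le
  generalize ⌈ε*(m:ℝ)⌉₊ = k at k1 k2
  have a1 : m^2 ≤ 4*k^3 := by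
    have := pow_le_pow_left₀ (by positivity) k1 3
    have : (m:ℝ)^2 ≤ 4*k^3 := by nlinarith only [this, mul_le_mul_of_nonneg_left h2 (by positivity : (0:ℝ) ≤ m^2), sq_nonneg (m:ℝ)]
    exact_mod_cast this
  have a2 : k+28 ≤ m := by
    have : (k:ℝ)+28 ≤ m := by nlinarith only [k2, hε', hm]
    exact_mod_cast this
  obtain ⟨b1, b2⟩ := DS_box hi a1 a2
  have c1 : ((m:ℝ)-k-28)*(2*m-28) ≤ 27*(DS i m).ncard := by exact_mod_cast b1
  have c2 : (27*(DS i m).ncard:ℝ) ≤ (m+k+27)*(2*m+27) := by exact_mod_cast b2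
  constructor
  · nlinarith only [c1, mul_le_mul_of_nonneg_right k2 (by linarith : (0:ℝ) ≤ 2*m-28), h1, hm, mul_le_mul_of_nonneg_right h1 (by positivity : (0:ℝ) ≤ m), mul_pos hε (by linarith : (0:ℝ) < m)]
  · nlinarith only [c2, mul_le_mul_of_nonneg_right k2 (by positivity : (0:ℝ) ≤ 2*m+27), h1, hm, mul_le_mul_of_nonneg_right h1 (by positivity : (0:ℝ) ≤ m), mul_le_mul_of_nonneg_right hε' (by positivity : (0:ℝ) ≤ m)]

theorem sandw {F : ℝ → ℝ} {c : ℝ} (hF : Monotone F) (hF0 : ∀ x, 0 ≤ F x) (h : ∀ ε > 0, ε ≤ 1/2 → ∀ᶠ n : ℕ in atTop, (c-ε)*n^4 ≤ F (n^2) ∧ F (n^2) ≤ (c+ε)*n^4) :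
    Tendsto (fun X => F X/X^2) atTop (nhds c) := by
  have t1 : Tendsto (fun n : ℕ => F (n^2)/n^4) atTop (nhds c) := by
    rw [Metric.tendsto_atTop']
    intro ε hε
    have hm : 0 < min (ε/2) (1/2) := by positivity
    obtain ⟨N, hN⟩ := eventually_atTop.1 (h _ hm (min_le_right _ _))
    refine ⟨N, fun n hn => ?_⟩
    have hn0 : (0:ℝ) < n^4 := pow_pos (by exact_mod_cast (Nat.zero_le N).trans_lt hn) 4
    obtain ⟨h1, h2⟩ := hN n hn.le
    rw [← le_div_iff₀ hn0] at h1; rw [← div_le_iff₀ hn0] at h2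
    rw [Real.dist_eq, abs_lt]
    have := min_le_left (ε/2) (1/2)
    constructor <;> linarith
  have t2 : Tendsto (fun n : ℕ => ((n:ℝ)/(n+1))^4) atTop (nhds 1) := by
    simpa using (tendsto_natCast_div_add_atTop (1:ℝ)).pow 4
  have hfl : Tendsto (fun X : ℝ => ⌊√X⌋₊) atTop atTop := tendsto_nat_floor_atTop.comp Real.tendsto_sqrt_atTop
  have lo := (t1.mul t2).comp hfl
  have up := ((t1.comp (tendsto_add_atTop_nat 1)).mul (t2.inv₀ one_ne_zero)).comp hfl
  rw [mul_one] at lo; rw [inv_one, mul_one] at up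
  refine tendsto_of_tendsto_of_tendsto_of_le_of_le' lo up ?_ ?_ <;> filter_upwards [eventually_ge_atTop 1] with X hX
  all_goals
    have hs : 1 ≤ √X := Real.one_le_sqrt.2 hX
    have hn : 1 ≤ ⌊√X⌋₊ := Nat.le_floor (by simpa using hs)
    have hn' : (1:ℝ) ≤ ⌊√X⌋₊ := by exact_mod_cast hn
    have b1 : (⌊√X⌋₊:ℝ)^2 ≤ X := by
      have := pow_le_pow_left₀ (by positivity) (Nat.floor_le (Real.sqrt_nonneg X)) 2
      rwa [Real.sq_sqrt (by linarith)] at this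
    have b2 : X ≤ ((⌊√X⌋₊:ℝ)+1)^2 := by
      have := pow_le_pow_left₀ (Real.sqrt_nonneg X) (Nat.lt_floor_add_one √X).le 2
      rwa [Real.sq_sqrt (by linarith)] at this
    simp only [Function.comp_apply]
    generalize ⌊√X⌋₊ = n at *
  · rw [div_pow, div_mul_div_comm, mul_comm ((n:ℝ)^4), mul_div_mul_right _ _ (by positivity)]
    refine div_le_div₀ (hF0 _) (hF b1) (by positivity) ?_
    nlinarith only [b2, hX]
  · rw [div_pow, inv_div, div_mul_div_comm]; push_cast
    rw [mul_comm (((n:ℝ)+1)^4), mul_div_mul_right _ _ (by positivity)]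
    refine div_le_div₀ (hF0 _) (hF b2) (by positivity) ?_
    nlinarith only [b1, hX, hn']
end BQF
end

section
open Filter
namespace BQF
theorem AA_fin {i : ℕ} (hi : i ≤ 2) (X : ℝ) : (cls '' AA i X).Finite := by
  obtain ⟨n, hn, hX⟩ := ((upper hi one_pos).and (tendsto_natCast_atTop_atTop.eventually_ge_atTop (max X 1))).exists
  refine hn.1.subset (Set.image_mono fun f hf => ?_)
  have h1 := (le_max_left _ _).trans hX
  have h2 := (le_max_right _ _).trans hX
  have h3 : X ≤ (n:ℝ)^2 := by nlinarith only [h1, h2]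
  exact ⟨hf.1, hf.2.1, hf.2.2.1.trans_le h3, hf.2.2.2.trans_le h3⟩

theorem numlim {i : ℕ} (hi : i ≤ 2) : Tendsto (fun X : ℝ => ((cls '' AA i X).ncard:ℝ)/X^2) atTop (nhds (VV i)) := by
  refine sandw (F := fun X => ((cls '' AA i X).ncard:ℝ)) (fun X Y h => ?_) (fun _ => Nat.cast_nonneg _) fun ε hε _ => ?_
  · exact Nat.cast_le.2 (Set.ncard_le_ncard (Set.image_mono fun f hf => ⟨hf.1, hf.2.1, hf.2.2.1.trans_le h, hf.2.2.2.trans_le h⟩) (AA_fin hi Y))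
  · filter_upwards [upper hi hε, lower hi hε] with n h1 h2
    exact ⟨h2 h1.1, h1.2⟩

theorem denlim {i : ℕ} (hi : i ≤ 2) : Tendsto (fun X : ℝ => ((DS i X).ncard:ℝ)/X^2) atTop (nhds (2/27)) := by
  refine sandw (F := fun X => ((DS i X).ncard:ℝ)) (fun X Y h => ?_) (fun _ => Nat.cast_nonneg _) fun ε hε h' => ?_
  · exact Nat.cast_le.2 (Set.ncard_le_ncard (fun f hf => ⟨hf.1, hf.2.1, hf.2.2.trans_le h⟩) (DS_fin i Y))
  · have := (tendsto_pow_atTop two_ne_zero).eventually (DS_lim hi hε h')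
    filter_upwards [this] with n h1
    push_cast at h1
    rw [← pow_mul] at h1; exact h1
end BQF
end

/-- On average there are `2ζ(2)/n_i` classes of irreducible integral binary quartic
forms with `4 - 2i` real roots per eligible pair `(I,J)` with `(-1)^i Δ(I,J) > 0`,
where `n₀ = 4`, `n₁ = 2`, `n₂ = 2`, `Δ(I,J) = (4I³ - J²)/27`, and `ζ(2) = π²/6`. -/
theorem average_classes_per_eligible_pair (i : ℕ) (hi : i ≤ 2)
    (n : ℕ) (hn : n = if i = 0 then 4 else 2) :
    Tendsto (fun X : ℝ =>
        (∑' p : ℤ × ℤ, if ((max |p.1| |p.2| : ℤ) : ℝ) < X then (hIJ i p.1 p.2 : ℝ) else 0) /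
          (({p : ℤ × ℤ | Eligible p.1 p.2 ∧
              0 < (-1 : ℝ) ^ i * ((4 * (p.1 : ℝ) ^ 3 - (p.2 : ℝ) ^ 2) / 27) ∧
              ((max |p.1| |p.2| : ℤ) : ℝ) < X}.ncard : ℝ)))
      atTop (nhds (2 * (Real.pi ^ 2 / 6) / n)) := by
  have h := (BQF.numlim hi).div (BQF.denlim hi) (by norm_num)
  have e : BQF.VV i/(2/27) = 2 * (Real.pi ^ 2 / 6) / n := by
    rw [hn, BQF.VV]; split_ifs <;> push_cast <;> ring
  rw [e] at h
  refine h.congr' ?_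
  filter_upwards [eventually_gt_atTop 0] with X hX
  rw [BQF.numer_eq i X (BQF.AA_fin hi X)]
  exact div_div_div_cancel_right₀ (by positivity) _ _
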